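/- For every fixed ε > 0, every sufficiently large cubefree integer m, and every invertible element λ of ℤ/mℤ, there exist positive integers x₁, …, x₈, each at most m^(1/4+ε), such that λ ≡ x₁x₂x₃x₄x₅x₆x₇x₈ (mod m). -/

import Mathlib

open Polynomial in
/-- A nonzero element in the kernel of a linear system of polynomial equations. -/
theorem exists_ne_zero_sum_smul_eq_zero {F ι : Type*} [Field F] [Fintype ι] (w : ι → F[X]) (M : ℕ)
    (hw : ∀ i, (w i).degree < M) (hM : M < Fintype.card ι) :
    ∃ c : ι → F, c ≠ 0 ∧ ∑ i, c i • w i = 0 := by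
  let φ : (ι → F) →ₗ[F] (Fin M → F) :=
    LinearMap.pi (fun m => (lcoeff F (m : ℕ)) ∘ₗ (Fintype.linearCombination F w))
  have hker : LinearMap.ker φ ≠ ⊥ := by
    apply LinearMap.ker_ne_bot_of_finrank_lt
    simpa using hM
  obtain ⟨c, hc, hc0⟩ := (Submodule.ne_bot_iff _).1 hker
  refine ⟨c, hc0, ?_⟩
  ext m
  by_cases hm : m < M
  · have := congrFun (LinearMap.mem_ker.1 hc) ⟨m, hm⟩
    simpa [φ, Fintype.linearCombination_apply] using this
  · rw [coeff_zero, finsetSum_coeff]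
    refine Finset.sum_eq_zero fun i _ => ?_
    rw [coeff_smul, coeff_eq_zero_of_degree_lt, smul_zero]
    exact (hw i).trans_le (by exact_mod_cast not_lt.1 hm)

/-- The degrees of the monomials in Stepanov's auxiliary polynomial are distinct. -/
theorem stepanov_exponents_injective {d D t i j l i' j' l' : ℕ} (hcop : D.Coprime d)
    (ht : 2 * D ≤ t) (hi : i < d) (hi' : i' < d) (hl : l ≤ t - D) (hl' : l' ≤ t - D)
    (h : l + i * t * D + j * (d * t + 1) = l' + i' * t * D + j' * (d * t + 1)) :
    i = i' ∧ j = j' ∧ l = l' := by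
  have hDt : D ≤ t := by omega
  obtain ⟨B, hB⟩ := Nat.exists_eq_add_of_le hDt
  have hlB : l ≤ B := by omega
  have hlB' : l' ≤ B := by omega
  have key : ((d * t + 1 : ℕ) : ℤ) * ((i * D + d * j : ℤ) - (i' * D + d * j')) =
      (d * l' - i' * D : ℤ) - (d * l - i * D) := by
    have h' : (l + i * t * D + j * (d * t + 1) : ℤ) = l' + i' * t * D + j' * (d * t + 1) := by
      exact_mod_cast h
    push_cast
    linear_combination (d : ℤ) * h'
  have b1 : (d * l' - i' * D : ℤ) - (d * l - i * D) < (d * t + 1 : ℕ) := by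
    have e1 : (d : ℤ) * l' ≤ d * B := by exact_mod_cast Nat.mul_le_mul_left d hlB'
    have e2 : (i : ℤ) * D ≤ d * D := by exact_mod_cast Nat.mul_le_mul_right D hi.le
    have e3 : (0 : ℤ) ≤ d * l := by positivity
    have e4 : (0 : ℤ) ≤ i' * D := by positivity
    have e5 : ((d * t + 1 : ℕ) : ℤ) = d * D + d * B + 1 := by rw [hB]; push_cast; ring
    linarith
  have b2 : -((d * t + 1 : ℕ) : ℤ) < (d * l' - i' * D : ℤ) - (d * l - i * D) := by
    have e1 : (d : ℤ) * l ≤ d * B := by exact_mod_cast Nat.mul_le_mul_left d hlB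
    have e2 : (i' : ℤ) * D ≤ d * D := by exact_mod_cast Nat.mul_le_mul_right D hi'.le
    have e3 : (0 : ℤ) ≤ d * l' := by positivity
    have e4 : (0 : ℤ) ≤ i * D := by positivity
    have e5 : ((d * t + 1 : ℕ) : ℤ) = d * D + d * B + 1 := by rw [hB]; push_cast; ring
    linarith
  have z : (i * D + d * j : ℤ) - (i' * D + d * j') = 0 := by
    have hq : (0 : ℤ) < (d * t + 1 : ℕ) := by positivity
    rw [← key] at b1 b2
    have c1 := (mul_lt_iff_lt_one_right hq).1 b1
    have c2 : -1 < (i * D + d * j : ℤ) - (i' * D + d * j') := by nlinarith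
    omega
  have hd0 : 0 < d := by omega
  have hii : i = i' := by
    have hdvd : (d : ℤ) ∣ (i - i') * D := ⟨j' - j, by linear_combination z⟩
    have h2 : (d : ℤ) ∣ i - i' :=
      IsCoprime.dvd_of_dvd_mul_right (Nat.isCoprime_iff_coprime.2 hcop.symm) hdvd
    have h3 := Int.eq_zero_of_abs_lt_dvd h2 (by rw [abs_lt]; omega)
    omega
  subst hii
  have hjj : j = j' := by
    have : (d : ℤ) * (j - j') = 0 := by linear_combination z
    have hd' : (d : ℤ) ≠ 0 := by omega
    have := (mul_eq_zero.1 this).resolve_left hd'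
    omega
  subst hjj
  exact ⟨rfl, rfl, by omega⟩

open Polynomial in
/-- Stepanov's bound for the number of points at which a power of `f` takes a given value. -/
theorem stepanov_bound {F : Type*} [Field F] [Fintype F] [DecidableEq F] (p s d t D : ℕ)
    [Fact p.Prime] [CharP F p] (hq : Fintype.card F = (p ^ s) ^ 2) (hd : p ^ s = d * t + 1)
    (hd2 : 2 ≤ d) (f : F[X]) (hf : f.natDegree = D) (hcop : D.Coprime d)
    (ht : 2 * D ≤ t) (ht0 : 0 < t) (ζ : F) (hζ : ζ ≠ 0) :
    d * (Finset.univ.filter fun x : F => f.eval x ^ (t * (p ^ s + 1)) = ζ).card ≤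
      (p ^ s) ^ 2 + (1 + 3 * d * D) * p ^ s := by
  classical
  have hf0 : f ≠ 0 := by
    rintro rfl
    simp at hf
    subst hf
    simp at hcop
    omega
  set J := t + 2 * D + 1 with hJ
  set B := t - D with hB
  set q := p ^ s with hqdef
  let ι := Fin d × Fin J × Fin (B + 1)
  let w : ι → F[X] := fun a => C (ζ ^ (a.1 : ℕ)) * (X ^ ((a.2.2 : ℕ) * q)
    * f ^ ((d - 1 - a.1) * t) * X ^ (a.2.1 : ℕ))
  let M := B * q + (d - 1) * t * D + J
  have hw : ∀ a, (w a).degree < M := by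
    rintro ⟨i, j, l⟩
    have h1 : (w (i, j, l)).natDegree ≤ l * q + (d - 1 - i) * t * D + j := by
      refine (natDegree_C_mul_le _ _).trans ?_
      refine natDegree_mul_le.trans ?_
      refine add_le_add (natDegree_mul_le.trans (add_le_add ?_ ?_)) ?_
      · simp
      · rw [natDegree_pow, hf]
      · simp
    have h2 : l * q + (d - 1 - i) * t * D + (j : ℕ) < M := by
      have e1 : (l : ℕ) * q ≤ B * q := Nat.mul_le_mul_right _ (by omega)
      have e2 : (d - 1 - i) * t * D ≤ (d - 1) * t * D :=
        Nat.mul_le_mul_right _ (Nat.mul_le_mul_right _ (by omega))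
      have := j.2
      omega
    exact (degree_le_natDegree.trans_lt (by exact_mod_cast h1.trans_lt h2))
  have hM : M < Fintype.card ι := by
    have hcard : Fintype.card ι = d * (J * (B + 1)) := by simp [ι]
    rw [hcard]
    obtain ⟨e, rfl⟩ := Nat.exists_eq_add_of_le hd2
    have hBt : t ≤ 2 * B := by omega
    have hB1 : 1 ≤ B := by omega
    have h1 : 2 + e - 1 = 1 + e := by omega
    have hM' : M = B * ((2 + e) * t + 1) + (1 + e) * t * D + J := by
      simp only [M]; rw [hd, h1]
    rw [hM', hJ]
    have h3 : (1 + e) * t * D ≤ (1 + e) * (2 * B) * D := by gcongr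
    nlinarith [Nat.zero_le (e * B * D), Nat.zero_le (B * D), Nat.zero_le (e * t),
      Nat.zero_le (e * D), Nat.zero_le (e * B)]
  obtain ⟨c, hc0, hc⟩ := exists_ne_zero_sum_smul_eq_zero w M hw hM
  let u : ι → F[X] := fun a => C (c a ^ q) * (X ^ (a.2.2 : ℕ) * f ^ ((a.1 : ℕ) * t)
    * X ^ ((a.2.1 : ℕ) * q))
  let P : F[X] := ∑ a, u a
  have hudeg : ∀ a, c a ≠ 0 → (u a).degree =
      (((a.2.2 : ℕ) + (a.1 : ℕ) * t * D + (a.2.1 : ℕ) * q : ℕ) : WithBot ℕ) := by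
    intro a ha
    have h0 : u a ≠ 0 := by
      simp only [u]
      refine mul_ne_zero (by simpa using fun h => absurd h ha) ?_
      exact mul_ne_zero (mul_ne_zero (pow_ne_zero _ X_ne_zero) (pow_ne_zero _ hf0))
        (pow_ne_zero _ X_ne_zero)
    rw [degree_eq_natDegree h0]
    congr 1
    simp only [u]
    rw [natDegree_C_mul (pow_ne_zero _ ha), natDegree_mul, natDegree_mul]
    · simp only [natDegree_pow, natDegree_X, hf, mul_one]
    · exact pow_ne_zero _ X_ne_zero
    · exact pow_ne_zero _ hf0
    · exact mul_ne_zero (pow_ne_zero _ X_ne_zero) (pow_ne_zero _ hf0)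
    · exact pow_ne_zero _ X_ne_zero
  have hune : ∀ a, u a ≠ 0 → c a ≠ 0 := by
    intro a ha h
    apply ha
    simp only [u, h]
    rw [zero_pow (by rw [hd]; omega)]
    simp
  have hP0 : P ≠ 0 := by
    have hsum : P.degree = Finset.univ.sup fun a => (u a).degree := by
      apply degree_sum_eq_of_disjoint
      rintro a ⟨-, ha⟩ b ⟨-, hb⟩ hab
      intro hdeg
      simp only [Function.comp] at hdeg
      rw [hudeg a (hune a ha), hudeg b (hune b hb)] at hdeg
      have hdeg' := WithBot.coe_injective hdeg
      simp only [Nat.cast_id] at hdeg'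
      rw [hd] at hdeg'
      obtain ⟨e1, e2, e3⟩ := stepanov_exponents_injective hcop ht a.1.2 b.1.2
        (Nat.lt_succ_iff.1 a.2.2.2) (Nat.lt_succ_iff.1 b.2.2.2) hdeg'
      exact hab (Prod.ext (Fin.ext e1) (Prod.ext (Fin.ext e2) (Fin.ext e3)))
    intro h
    obtain ⟨a, ha⟩ := Function.ne_iff.1 hc0
    have hle := Finset.le_sup (f := fun a => (u a).degree) (Finset.mem_univ a)
    rw [← hsum, h, degree_zero, hudeg a ha] at hle
    exact absurd hle (WithBot.bot_lt_coe _).not_ge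
  have hPdeg : P.natDegree ≤ B + (d - 1) * t * D + (t + 2 * D) * q := by
    refine natDegree_sum_le_of_forall_le _ _ fun a _ => ?_
    by_cases ha : c a = 0
    · have : u a = 0 := by
        by_contra h
        exact hune a h ha
      simp [this]
    · rw [natDegree_eq_of_degree_eq_some (hudeg a ha)]
      have h1 : (a.1 : ℕ) * t * D ≤ (d - 1) * t * D :=
        Nat.mul_le_mul_right _ (Nat.mul_le_mul_right _ (by omega))
      have h2 : (a.2.1 : ℕ) * q ≤ (t + 2 * D) * q := Nat.mul_le_mul_right _ (by omega)
      omega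
  have hroot : (Finset.univ.filter fun x : F => f.eval x ^ (t * (q + 1)) = ζ).card ≤
      P.natDegree := by
    refine card_le_degree_of_subset_roots (p := P) ?_
    intro x hx
    have hx' : f.eval x ^ (t * (q + 1)) = ζ := by simpa using hx
    rw [mem_roots hP0, IsRoot.def]
    have hfx : f.eval x ≠ 0 := by
      intro h
      rw [h, zero_pow (by positivity)] at hx'
      exact hζ hx'.symm
    have hxq : ∀ y : F, (y ^ q) ^ q = y := by
      intro y
      rw [← pow_mul, ← sq, ← hq, FiniteField.pow_card]
    have hpow : P.eval x ^ q * f.eval x ^ ((d - 1) * t) = 0 := by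
      have hQ := congrArg (eval x) hc
      rw [eval_zero, eval_finsetSum] at hQ
      rw [← hQ]
      simp only [P, eval_finsetSum]
      rw [hqdef, sum_pow_char_pow, ← hqdef, Finset.sum_mul]
      refine Finset.sum_congr rfl fun a _ => ?_
      simp only [u, w, eval_mul, eval_C, eval_pow, eval_X, eval_smul, smul_eq_mul, mul_pow, hxq]
      rw [← hx', ← pow_mul x, ← pow_mul x, mul_assoc (a.2.1 : ℕ), pow_mul x _ (q * q),
        pow_mul (x ^ (a.2.1 : ℕ)), hxq]
      have hexp : f.eval x ^ ((d - 1) * t) * (f.eval x ^ ((a.1 : ℕ) * t)) ^ q =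
          (f.eval x ^ (t * (q + 1))) ^ (a.1 : ℕ) * f.eval x ^ ((d - 1 - a.1) * t) := by
        rw [← pow_mul, ← pow_mul, ← pow_add, ← pow_add]
        congr 1
        obtain ⟨e, he⟩ := Nat.exists_eq_add_of_le (Nat.le_sub_one_of_lt a.1.2)
        rw [he]
        have : (a.1 : ℕ) + e - a.1 = e := by omega
        rw [this]
        ring
      linear_combination (c a * x ^ ((a.2.2 : ℕ) * q) * x ^ (a.2.1 : ℕ)) * hexp
    have := (mul_eq_zero.1 hpow).resolve_right (pow_ne_zero _ hfx)
    exact pow_eq_zero_iff (by rw [hd]; omega) |>.1 this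
  have hfin := hroot.trans hPdeg
  refine (Nat.mul_le_mul_left d hfin).trans ?_
  obtain ⟨e, rfl⟩ := Nat.exists_eq_add_of_le hd2
  have h1 : 2 + e - 1 = 1 + e := by omega
  rw [h1]
  have hBt : B ≤ t := by omega
  have hdt : (2 + e) * t ≤ q := by omega
  have a1 : (2 + e) * B ≤ q := (Nat.mul_le_mul_left _ hBt).trans hdt
  have a2 : (2 + e) * ((1 + e) * t * D) ≤ (2 + e) * D * q := by
    calc (2 + e) * ((1 + e) * t * D) = ((2 + e) * t) * ((1 + e) * D) := by ring
      _ ≤ q * ((2 + e) * D) := by gcongr; omega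
      _ = _ := by ring
  have a3 : (2 + e) * ((t + 2 * D) * q) ≤ q ^ 2 + 2 * (2 + e) * D * q := by
    calc (2 + e) * ((t + 2 * D) * q) = ((2 + e) * t) * q + 2 * (2 + e) * D * q := by ring
      _ ≤ q * q + 2 * (2 + e) * D * q := by gcongr
      _ = _ := by ring
  calc (2 + e) * (B + (1 + e) * t * D + (t + 2 * D) * q)
      = (2 + e) * B + (2 + e) * ((1 + e) * t * D) + (2 + e) * ((t + 2 * D) * q) := by ring
    _ ≤ q + (2 + e) * D * q + (q ^ 2 + 2 * (2 + e) * D * q) := by gcongr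
    _ = _ := by ring

/-- In a finite field with `d * e + 1` elements, a multiplicative character of order dividing `d`
depends only on the `e`-th power of its argument. -/
theorem exists_generator_mulChar_eq {L : Type*} [Field L] [Fintype L] {d e : ℕ}
    (hde : Fintype.card L = d * e + 1) (hd : 0 < d) (he : 0 < e) (Ψ : MulChar L ℂ)
    (hΨ : Ψ ^ d = 1) (hΨ1 : Ψ ≠ 1) :
    ∃ g : L, g ≠ 0 ∧ ∑ i ∈ Finset.range d, Ψ g ^ i = 0 ∧ ‖Ψ g‖ = 1 ∧
      ∀ y : L, y ≠ 0 → ∃ i ∈ Finset.range d, Ψ y = Ψ g ^ i ∧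
        ∀ j ∈ Finset.range d, y ^ e = g ^ (j * e) ↔ j = i := by
  classical
  obtain ⟨g, hg⟩ := IsCyclic.exists_generator (α := Lˣ)
  have hord : orderOf g = d * e := by
    rw [orderOf_eq_card_of_forall_mem_zpowers hg, Nat.card_eq_fintype_card, Fintype.card_units,
      hde]
    simp
  have hωd : Ψ (g : L) ^ d = 1 := by
    rw [← MulChar.pow_apply_coe, hΨ, MulChar.one_apply_coe]
  have hpow : ∀ y : L, y ≠ 0 → ∃ k : ℕ, y = (g : L) ^ k := by
    intro y hy
    obtain ⟨k, hk⟩ := (mem_powers_iff_mem_zpowers.2 (hg (Units.mk0 y hy)))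
    exact ⟨k, by simpa using (congrArg Units.val hk).symm⟩
  have hω1 : Ψ (g : L) ≠ 1 := by
    intro h
    apply hΨ1
    ext y
    obtain ⟨k, hk⟩ := hpow y y.ne_zero
    rw [hk, map_pow, h, one_pow, MulChar.one_apply]
    exact (Units.isUnit g).pow k
  refine ⟨g, g.ne_zero, ?_, ?_, ?_⟩
  · have := geom_sum_mul (Ψ (g : L)) d
    rw [hωd, sub_self] at this
    exact (mul_eq_zero.1 this).resolve_right (sub_ne_zero.2 hω1)
  · exact Complex.norm_eq_one_of_pow_eq_one hωd hd.ne'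
  · intro y hy
    obtain ⟨k, rfl⟩ := hpow y hy
    refine ⟨k % d, Finset.mem_range.2 (Nat.mod_lt _ hd), ?_, ?_⟩
    · rw [map_pow]
      conv_lhs => rw [← Nat.div_add_mod k d, pow_add, pow_mul, hωd, one_pow, one_mul]
    · intro j hj
      have hj' := Finset.mem_range.1 hj
      rw [← pow_mul, ← Units.val_pow_eq_pow_val, ← Units.val_pow_eq_pow_val, Units.val_inj,
        pow_eq_pow_iff_modEq, hord]
      have : k * e ≡ j * e [MOD d * e] ↔ k ≡ j [MOD d] :=
        ⟨fun h => Nat.ModEq.mul_right_cancel' he.ne' h, fun h => Nat.ModEq.mul_right' e h⟩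
      rw [this, Nat.ModEq, Nat.mod_eq_of_lt hj']
      exact eq_comm

open Polynomial in
/-- Square-root cancellation, with an inexplicit constant, for a multiplicative character sum over
a finite field of square order, evaluated at a polynomial of degree prime to the order. -/
theorem norm_sum_mulChar_eval_le {L : Type*} [Field L] [Fintype L] (p s d t D : ℕ)
    [Fact p.Prime] [CharP L p] (hq : Fintype.card L = (p ^ s) ^ 2) (hd : p ^ s = d * t + 1)
    (hd2 : 2 ≤ d) (f : L[X]) (hf : f.natDegree = D) (hcop : D.Coprime d)
    (ht : 2 * D ≤ t) (ht0 : 0 < t) (Ψ : MulChar L ℂ) (hΨ : Ψ ^ d = 1) (hΨ1 : Ψ ≠ 1) :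
    ‖∑ x, Ψ (f.eval x)‖ ≤ (1 + 4 * d * D) * (p : ℝ) ^ s := by
  classical
  have hf0 : f ≠ 0 := by
    rintro rfl
    simp at hf
    subst hf
    simp at hcop
    omega
  set q := p ^ s with hqdef
  set e := t * (q + 1) with he
  have hcard : Fintype.card L = d * e + 1 := by
    rw [hq, he]
    rw [hd]
    ring
  obtain ⟨g, hg0, hsum, hnorm, hlog⟩ := exists_generator_mulChar_eq hcard (by omega)
    (by positivity) Ψ hΨ hΨ1
  let N : ℕ → ℕ := fun i => (Finset.univ.filter fun x : L => f.eval x ^ e = g ^ (i * e)).card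
  have hN : ∀ i, (d : ℝ) * N i ≤ (q : ℝ) ^ 2 + (1 + 3 * d * D) * q := fun i => by
    exact_mod_cast stepanov_bound p s d t D hq hd hd2 f hf hcop ht ht0 (g ^ (i * e))
      (pow_ne_zero _ hg0)
  have h1 : ∑ x, Ψ (f.eval x) = ∑ i ∈ Finset.range d, Ψ g ^ i * (N i : ℂ) := by
    have : ∀ i, Ψ g ^ i * (N i : ℂ) =
        ∑ x : L, if f.eval x ^ e = g ^ (i * e) then Ψ g ^ i else 0 := by
      intro i
      rw [← Finset.sum_filter, Finset.sum_const, nsmul_eq_mul, mul_comm]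
    simp_rw [this]
    rw [Finset.sum_comm]
    refine Finset.sum_congr rfl fun x _ => ?_
    by_cases hx : f.eval x = 0
    · rw [hx, MulChar.map_zero]
      refine (Finset.sum_eq_zero fun i _ => if_neg ?_).symm
      rw [zero_pow (by positivity)]
      exact (pow_ne_zero _ hg0).symm
    · obtain ⟨i, hi, hΨi, hj⟩ := hlog _ hx
      rw [Finset.sum_eq_single_of_mem i hi, if_pos ((hj i hi).2 rfl), hΨi]
      intro j hjr hji
      exact if_neg fun h => hji ((hj j hjr).1 h)
  have h2 : (q : ℝ) ^ 2 - D ≤ ∑ i ∈ Finset.range d, (N i : ℝ) := by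
    have e1 : (Finset.univ.filter fun x : L => f.eval x ≠ 0).card ≤ ∑ i ∈ Finset.range d, N i := by
      refine (Finset.card_le_card ?_).trans Finset.card_biUnion_le
      intro x hx
      obtain ⟨i, hi, -, hj⟩ := hlog _ (Finset.mem_filter.1 hx).2
      exact Finset.mem_biUnion.2 ⟨i, hi, Finset.mem_filter.2 ⟨Finset.mem_univ _, (hj i hi).2 rfl⟩⟩
    have e2 : (Finset.univ.filter fun x : L => f.eval x = 0).card ≤ D := by
      rw [← hf]
      refine card_le_degree_of_subset_roots ?_
      intro x hx
      exact (mem_roots hf0).2 (by simpa using hx)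
    have e3 := Finset.card_filter_add_card_filter_not (s := (Finset.univ : Finset L))
      (fun x : L => f.eval x = 0)
    rw [Finset.card_univ, hq] at e3
    have e4 : q ^ 2 ≤ D + ∑ i ∈ Finset.range d, N i := by
      rw [← e3]
      exact add_le_add e2 e1
    have e5 : (q : ℝ) ^ 2 ≤ D + ∑ i ∈ Finset.range d, (N i : ℝ) := by exact_mod_cast e4
    linarith
  have hd0 : (0 : ℝ) < d := by exact_mod_cast (by omega : 0 < d)
  set M : ℝ := ((q : ℝ) ^ 2 + (1 + 3 * d * D) * q) / d with hM
  have hNM : ∀ i, (N i : ℝ) ≤ M := fun i => by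
    rw [hM, le_div_iff₀ hd0, mul_comm]
    exact hN i
  have h3 : ∑ x, Ψ (f.eval x) = ∑ i ∈ Finset.range d, Ψ g ^ i * ((N i : ℂ) - (M : ℂ)) := by
    rw [h1]
    simp_rw [mul_sub]
    rw [Finset.sum_sub_distrib, ← Finset.sum_mul, hsum, zero_mul, sub_zero]
  rw [h3]
  calc ‖∑ i ∈ Finset.range d, Ψ g ^ i * ((N i : ℂ) - (M : ℂ))‖
      ≤ ∑ i ∈ Finset.range d, (M - N i) := by
        refine norm_sum_le_of_le _ fun i _ => ?_
        rw [norm_mul, norm_pow, hnorm, one_pow, one_mul, ← Complex.ofReal_natCast,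
          ← Complex.ofReal_sub, Complex.norm_real, Real.norm_eq_abs, abs_sub_comm,
          abs_of_nonneg (sub_nonneg.2 (hNM i))]
    _ = d * M - ∑ i ∈ Finset.range d, (N i : ℝ) := by
        rw [Finset.sum_sub_distrib, Finset.sum_const, Finset.card_range, nsmul_eq_mul]
    _ ≤ (1 + 3 * d * D) * q + D := by
        rw [hM, mul_div_cancel₀ _ hd0.ne']
        linarith
    _ ≤ (1 + 4 * d * D) * (p : ℝ) ^ s := by
        have hqr : (q : ℝ) = (p : ℝ) ^ s := by rw [hqdef]; push_cast; rfl
        rw [← hqr]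
        have hq1 : (1 : ℝ) ≤ q := by exact_mod_cast (by omega : 1 ≤ q)
        have hd1 : (1 : ℝ) ≤ d := by exact_mod_cast (by omega : 1 ≤ d)
        have hD0 : (0 : ℝ) ≤ D := by positivity
        have : (D : ℝ) ≤ d * D * q := by
          calc (D : ℝ) = 1 * D * 1 := by ring
            _ ≤ d * D * q := by gcongr
        linarith

open Polynomial in
/-- The inexplicit square-root bound for a product of shifted powers of a character, one of the
shifts being different from all the others. -/
theorem norm_sum_prod_mulChar_sub_le {L ι : Type*} [Field L] [Fintype L] [Fintype ι]
    [DecidableEq ι] (p s d t : ℕ) [Fact p.Prime] [CharP L p]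
    (hq : Fintype.card L = (p ^ s) ^ 2) (hd : p ^ s = d * t + 1)
    (hd2 : 2 ≤ d) (a : ι → L) (e : ι → ℕ) (j : ι) (hj : ∀ i ≠ j, a i ≠ a j)
    (he : ∀ i, 1 ≤ e i) (hej : (e j).Coprime d)
    (ht : 2 * (d * ∑ i, e i) ≤ t) (Ψ : MulChar L ℂ) (hΨ : Ψ ^ d = 1) (hΨ1 : Ψ ≠ 1) :
    ‖∑ x, ∏ i, Ψ (a i - x) ^ e i‖ ≤ (1 + 4 * d * (d * ∑ i, e i : ℕ)) * (p : ℝ) ^ s := by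
  classical
  let f : L[X] := ∏ i, (X ^ ((d - 1) * e i) * (1 + C (a i - a j) * X) ^ e i)
  have hlin0 : ∀ b : L, (1 + C b * X : L[X]) ≠ 0 := by
    intro b h
    have := congrArg (eval 0) h
    simp at this
  have hlin : ∀ b : L, b ≠ 0 → (1 + C b * X : L[X]).natDegree = 1 := by
    intro b hb
    rw [add_comm, ← C_1, natDegree_linear hb]
  have hdegi : ∀ i, (X ^ ((d - 1) * e i) * (1 + C (a i - a j) * X) ^ e i : L[X]).natDegree =
      (d - 1) * e i + if i = j then 0 else e i := by
    intro i
    rw [natDegree_mul (pow_ne_zero _ X_ne_zero) (pow_ne_zero _ (hlin0 _)), natDegree_X_pow,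
      natDegree_pow]
    split_ifs with h
    · simp [h]
    · rw [hlin _ (sub_ne_zero.2 (hj i h)), mul_one]
  have hdeg : f.natDegree + e j = d * ∑ i, e i := by
    simp only [f]
    rw [natDegree_prod]
    · simp_rw [hdegi]
      rw [Finset.sum_add_distrib, add_assoc]
      have : (∑ i, if i = j then 0 else e i) + e j = ∑ i, e i := by
        rw [← Finset.sum_erase_add _ _ (Finset.mem_univ j)]
        simp only [↓reduceIte, add_zero]
        rw [← Finset.sum_erase_add _ (fun i => e i) (Finset.mem_univ j)]
        congr 1
        exact Finset.sum_congr rfl fun i hi => if_neg (Finset.ne_of_mem_erase hi)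
      rw [this, ← Finset.mul_sum]
      obtain ⟨k, rfl⟩ := Nat.exists_eq_add_of_le hd2
      have : 2 + k - 1 = 1 + k := by omega
      rw [this]
      ring
    · intro i _
      exact mul_ne_zero (pow_ne_zero _ X_ne_zero) (pow_ne_zero _ (hlin0 _))
  have hcop : f.natDegree.Coprime d := by
    have h1 : Nat.gcd f.natDegree d ∣ e j := by
      rw [← Nat.dvd_add_right (Nat.gcd_dvd_left f.natDegree d), hdeg]
      exact (Nat.gcd_dvd_right _ _).mul_right _
    exact Nat.dvd_one.1 (hej ▸ Nat.dvd_gcd h1 (Nat.gcd_dvd_right _ _))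
  have hle : f.natDegree ≤ d * ∑ i, e i := by omega
  have hpos : 0 < d * ∑ i, e i := by
    have : e j ≤ ∑ i, e i := Finset.single_le_sum (fun _ _ => Nat.zero_le _) (Finset.mem_univ j)
    have := he j
    exact Nat.mul_pos (by omega) (by omega)
  have hmain := norm_sum_mulChar_eval_le p s d t f.natDegree hq hd hd2 f rfl hcop (by omega)
    (by omega) Ψ hΨ hΨ1
  have heq : ∑ x, ∏ i, Ψ (a i - x) ^ e i = ∑ y, Ψ (f.eval y) := by
    symm
    refine Fintype.sum_equiv ((Equiv.inv L).trans (Equiv.subLeft (a j))) _ _ fun y => ?_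
    simp only [f, Equiv.trans_apply, Equiv.inv_apply, Equiv.subLeft_apply, eval_prod, map_prod]
    by_cases hy : y = 0
    · subst hy
      rw [Finset.prod_eq_zero (Finset.mem_univ j), Finset.prod_eq_zero (Finset.mem_univ j)]
      · simp [Nat.one_le_iff_ne_zero.1 (he j), MulChar.map_zero]
      · have : (d - 1) * e j ≠ 0 := by
          have := he j
          exact Nat.mul_ne_zero (by omega) (by omega)
        simp [this, MulChar.map_zero]
    · refine Finset.prod_congr rfl fun i _ => ?_
      have hb : a i - (a j - y⁻¹) = (1 + (a i - a j) * y) * y⁻¹ := by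
        field_simp
        ring
      have hyd : Ψ y ^ d = 1 := by
        have := congrArg (fun φ => φ y) hΨ
        simpa [MulChar.pow_apply' _ (by omega : d ≠ 0), MulChar.one_apply (isUnit_iff_ne_zero.2 hy)]
          using this
      have hinv : Ψ y ^ (d - 1) = Ψ y⁻¹ := by
        have h1 : Ψ y * Ψ y⁻¹ = 1 := by
          rw [← map_mul, mul_inv_cancel₀ hy, map_one]
        have h2 : Ψ y ^ (d - 1) * Ψ y = 1 := by
          rw [← pow_succ, Nat.sub_add_cancel (by omega), hyd]
        calc Ψ y ^ (d - 1) = Ψ y ^ (d - 1) * (Ψ y * Ψ y⁻¹) := by rw [h1, mul_one]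
          _ = Ψ y⁻¹ := by rw [← mul_assoc, h2, one_mul]
      rw [hb, map_mul]
      simp only [eval_mul, eval_pow, eval_X, eval_add, eval_one, eval_C, map_mul, map_pow]
      rw [pow_mul, hinv, mul_pow, mul_comm]
  rw [heq]
  refine hmain.trans ?_
  have : (f.natDegree : ℝ) ≤ (d * ∑ i, e i : ℕ) := by exact_mod_cast hle
  gcongr

open Polynomial in
/-- If the logarithmic derivative of a polynomial has coefficients `O(ρ ^ n)`, then the polynomial
does not vanish in the disc of radius `1 / ρ`. -/
theorem one_le_mul_norm_of_isRoot {M : ℂ[X]} (hM : M ≠ 0) {E : PowerSeries ℂ}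
    (hE : PowerSeries.X * (derivative M : PowerSeries ℂ) = (M : PowerSeries ℂ) * E) {A ρ : ℝ}
    (hρ : 0 < ρ) (hC : ∀ n, ‖PowerSeries.coeff n E‖ ≤ A * ρ ^ n) {z : ℂ} (hz0 : z ≠ 0)
    (hz : M.IsRoot z) : 1 ≤ ρ * ‖z‖ := by
  by_contra! hlt
  obtain ⟨K, hK, hKz⟩ := exists_eq_pow_rootMultiplicity_mul_and_not_dvd M hM z
  have hs : M.rootMultiplicity z ≠ 0 := ((rootMultiplicity_pos hM).2 hz).ne'
  obtain ⟨s, hs'⟩ := Nat.exists_eq_succ_of_ne_zero hs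
  rw [hs'] at hK
  have hKz' : K.eval z ≠ 0 := fun h => hKz (dvd_iff_isRoot.2 h)
  set Q : ℂ[X] := X * ((s + 1 : ℂ[X]) * K + (X - C z) * derivative K) with hQ
  have hder : X * derivative M = (X - C z) ^ s * Q := by
    rw [hK, derivative_mul, derivative_X_sub_C_pow, hQ]
    simp only [Nat.succ_eq_add_one, Nat.add_sub_cancel, Nat.cast_add, Nat.cast_one, map_add,
      map_natCast, map_one]
    ring
  have hpow : (((X - C z) ^ s : ℂ[X]) : PowerSeries ℂ) ≠ 0 := by
    rw [Ne, Polynomial.coe_eq_zero_iff]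
    exact pow_ne_zero _ (X_sub_C_ne_zero z)
  set U : PowerSeries ℂ := (K : PowerSeries ℂ) * E with hU
  have hQU : (Q : PowerSeries ℂ) = ((X - C z : ℂ[X]) : PowerSeries ℂ) * U := by
    apply mul_left_cancel₀ hpow
    rw [← Polynomial.coe_mul, ← hder, Polynomial.coe_mul, Polynomial.coe_X, hE, hU, hK,
      Polynomial.coe_mul, pow_succ, Polynomial.coe_mul]
    ring
  have hcoef0 : Q.coeff 0 = -z * PowerSeries.coeff 0 U := by
    rw [← Polynomial.coeff_coe, hQU]
    simp [sub_mul]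
  have hcoef : ∀ n, Q.coeff (n + 1) = PowerSeries.coeff n U - z * PowerSeries.coeff (n + 1) U := by
    intro n
    rw [← Polynomial.coeff_coe, hQU]
    simp [sub_mul, PowerSeries.coeff_succ_X_mul]
  have htel : ∀ n, ∑ i ∈ Finset.range (n + 1), Q.coeff i * z ^ i =
      -PowerSeries.coeff n U * z ^ (n + 1) := by
    intro n
    induction n with
    | zero => simp [hcoef0]; ring
    | succ n ih => rw [Finset.sum_range_succ, ih, hcoef]; ring
  obtain ⟨C', hC'⟩ : ∃ C' : ℝ, ∀ n, ‖PowerSeries.coeff n U‖ ≤ C' * ρ ^ n := by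
    refine ⟨∑ i ∈ Finset.range (K.natDegree + 1), ‖K.coeff i‖ * A / ρ ^ i, fun n => ?_⟩
    have h1 : PowerSeries.coeff n U = ∑ i ∈ Finset.range (n + 1),
        K.coeff i * PowerSeries.coeff (n - i) E := by
      rw [hU, PowerSeries.coeff_mul, Finset.Nat.sum_antidiagonal_eq_sum_range_succ
        (fun i j => PowerSeries.coeff i (K : PowerSeries ℂ) * PowerSeries.coeff j E)]
      simp
    have hC0 : 0 ≤ A := by
      have := (norm_nonneg _).trans (hC 0)
      simpa using this
    rw [h1]
    calc ‖∑ i ∈ Finset.range (n + 1), K.coeff i * PowerSeries.coeff (n - i) E‖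
        ≤ ∑ i ∈ Finset.range (n + 1), ‖K.coeff i‖ * A / ρ ^ i * ρ ^ n := by
          refine norm_sum_le_of_le _ fun i hi => ?_
          have hin : i ≤ n := Nat.lt_succ_iff.1 (Finset.mem_range.1 hi)
          rw [norm_mul]
          have h2 := hC (n - i)
          have h3 : ρ ^ n = ρ ^ (n - i) * ρ ^ i := by rw [← pow_add, Nat.sub_add_cancel hin]
          have h4 : ‖K.coeff i‖ * A / ρ ^ i * ρ ^ n = ‖K.coeff i‖ * (A * ρ ^ (n - i)) := by
            rw [h3]
            field_simp
          rw [h4]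
          gcongr
      _ ≤ ∑ i ∈ Finset.range (n + 1 + (K.natDegree + 1)), ‖K.coeff i‖ * A / ρ ^ i * ρ ^ n := by
          refine Finset.sum_le_sum_of_subset_of_nonneg
            (Finset.range_mono (Nat.le_add_right _ _)) fun i _ _ => by positivity
      _ = ∑ i ∈ Finset.range (K.natDegree + 1), ‖K.coeff i‖ * A / ρ ^ i * ρ ^ n := by
          symm
          refine Finset.sum_subset (Finset.range_mono (Nat.le_add_left _ _)) fun i _ hi => ?_
          rw [coeff_eq_zero_of_natDegree_lt (by simpa using hi)]
          simp
      _ = _ := by rw [Finset.sum_mul]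
  have hev : ∀ n, Q.natDegree ≤ n → Q.eval z = -PowerSeries.coeff n U * z ^ (n + 1) := by
    intro n hn
    rw [← htel n]
    exact eval_eq_sum_range' (Nat.lt_succ_iff.2 hn) z
  have hlim : Filter.Tendsto (fun n : ℕ => C' * ‖z‖ * (ρ * ‖z‖) ^ n) Filter.atTop (nhds 0) := by
    have := tendsto_pow_atTop_nhds_zero_of_lt_one (by positivity) hlt
    simpa using this.const_mul (C' * ‖z‖)
  have hQz : Q.eval z = 0 := by
    rw [← norm_le_zero_iff]
    refine ge_of_tendsto hlim ?_
    filter_upwards [Filter.eventually_ge_atTop Q.natDegree] with n hn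
    rw [hev n hn, norm_mul, norm_neg, norm_pow]
    calc ‖PowerSeries.coeff n U‖ * ‖z‖ ^ (n + 1) ≤ C' * ρ ^ n * ‖z‖ ^ (n + 1) := by
          gcongr
          exact hC' n
      _ = _ := by rw [mul_pow]; ring
  have : Q.eval z = z * ((s + 1) * K.eval z) := by
    rw [hQ]
    simp
  rw [this] at hQz
  have hs1 : (s : ℂ) + 1 ≠ 0 := by exact_mod_cast Nat.succ_ne_zero s
  exact (mul_ne_zero hz0 (mul_ne_zero hs1 hKz')) hQz

open Polynomial in
/-- If a polynomial Dirichlet series of degree `< k` has power sums of even index `O(ρ ^ n)`, then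
its linear coefficient is at most `k * ρ`. -/
theorem norm_coeff_one_le_of_newton {c S : ℕ → ℂ} {k : ℕ} (hc0 : c 0 = 1)
    (hck : ∀ n, k < n → c n = 0)
    (hcS : ∀ n : ℕ, (n : ℂ) * c n = ∑ j ∈ Finset.Icc 1 n, S j * c (n - j)) {A ρ : ℝ} (hρ : 0 < ρ)
    (hS : ∀ n, 1 ≤ n → ‖S (2 * n)‖ ≤ A * ρ ^ (2 * n)) : ‖c 1‖ ≤ k * ρ := by
  let L : ℂ[X] := ∑ i ∈ Finset.range (k + 1), C (c i) * X ^ i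
  have hLc : ∀ n, L.coeff n = c n := by
    intro n
    simp only [L, finsetSum_coeff, coeff_C_mul_X_pow]
    rw [Finset.sum_ite_eq]
    split_ifs with h
    · rfl
    · exact (hck n (by simpa using h)).symm
  let G : PowerSeries ℂ := PowerSeries.mk fun n => if n = 0 then 0 else S n
  have hLG : PowerSeries.X * (derivative L : PowerSeries ℂ) = (L : PowerSeries ℂ) * G := by
    ext n
    have hl : PowerSeries.coeff n (PowerSeries.X * (derivative L : PowerSeries ℂ)) = n * c n := by
      cases n with
      | zero => simp
      | succ n =>
        rw [PowerSeries.coeff_succ_X_mul, Polynomial.coeff_coe, coeff_derivative, hLc]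
        push_cast
        ring
    rw [hl, mul_comm (L : PowerSeries ℂ) G, PowerSeries.coeff_mul,
      Finset.Nat.sum_antidiagonal_eq_sum_range_succ
        (fun i j => PowerSeries.coeff i G * PowerSeries.coeff j (L : PowerSeries ℂ)), hcS,
      Finset.range_eq_Ico]
    rw [Finset.sum_eq_sum_Ico_succ_bot (Nat.succ_pos n)]
    simp only [G, PowerSeries.coeff_mk, Polynomial.coeff_coe, hLc, if_true, zero_mul, zero_add]
    refine Finset.sum_congr (by ext; simp) fun j hj => ?_
    have := (Finset.mem_Ico.1 hj).1
    rw [if_neg (by omega)]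
  let L' : ℂ[X] := L.comp (-X)
  have hL'c : ∀ n, L'.coeff n = (-1) ^ n * c n := by
    intro n
    simp only [L']
    have h1 : (-X : ℂ[X]) = C (-1) * X := by simp
    rw [h1, comp_C_mul_X_coeff, hLc, mul_comm]
  let G' : PowerSeries ℂ := PowerSeries.mk fun n => (-1) ^ n * if n = 0 then 0 else S n
  have hLG' : PowerSeries.X * (derivative L' : PowerSeries ℂ) = (L' : PowerSeries ℂ) * G' := by
    ext n
    have h := congrArg (PowerSeries.coeff n) hLG
    rw [PowerSeries.coeff_mul, PowerSeries.coeff_mul] at h ⊢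
    have : ∀ x ∈ Finset.HasAntidiagonal.antidiagonal n, PowerSeries.coeff x.1 (L' : PowerSeries ℂ) *
        PowerSeries.coeff x.2 G' = (-1) ^ n * (PowerSeries.coeff x.1 (L : PowerSeries ℂ) *
        PowerSeries.coeff x.2 G) := by
      intro x hx
      rw [← Finset.HasAntidiagonal.mem_antidiagonal.1 hx, pow_add]
      simp only [Polynomial.coeff_coe, hL'c, hLc, G, G', PowerSeries.coeff_mk]
      ring
    rw [Finset.sum_congr rfl this, ← Finset.mul_sum, ← h, ← PowerSeries.coeff_mul,
      ← PowerSeries.coeff_mul]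
    cases n with
    | zero => simp
    | succ n =>
      rw [PowerSeries.coeff_succ_X_mul, PowerSeries.coeff_succ_X_mul, Polynomial.coeff_coe,
        Polynomial.coeff_coe, coeff_derivative, coeff_derivative, hLc, hL'c]
      ring
  have hM : PowerSeries.X * (derivative (L * L') : PowerSeries ℂ) =
      ((L * L' : ℂ[X]) : PowerSeries ℂ) * (G + G') := by
    rw [derivative_mul, Polynomial.coe_add, Polynomial.coe_mul, Polynomial.coe_mul,
      Polynomial.coe_mul]
    linear_combination (L' : PowerSeries ℂ) * hLG + (L : PowerSeries ℂ) * hLG'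
  have hL0 : L.eval 0 = 1 := by rw [← coeff_zero_eq_eval_zero, hLc, hc0]
  have hLne : L ≠ 0 := by
    intro h
    rw [h] at hL0
    simp at hL0
  have hL'ne : L' ≠ 0 := by
    intro h
    have := hL'c 0
    rw [h] at this
    simp [hc0] at this
  have hC0 : 0 ≤ A := by
    have := (norm_nonneg _).trans (hS 1 le_rfl)
    exact nonneg_of_mul_nonneg_left this (by positivity)
  have hroot : ∀ z ∈ L.roots, 1 ≤ ρ * ‖z‖ := by
    intro z hz
    have hz' := (mem_roots hLne).1 hz
    have hz0 : z ≠ 0 := by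
      rintro rfl
      rw [IsRoot.def, hL0] at hz'
      exact one_ne_zero hz'
    refine one_le_mul_norm_of_isRoot (mul_ne_zero hLne hL'ne) hM (A := 2 * A) hρ ?_ hz0
      (root_mul.2 (Or.inl hz'))
    intro n
    simp only [G, G', map_add, PowerSeries.coeff_mk]
    rcases Nat.even_or_odd' n with ⟨m, rfl | rfl⟩
    · rw [pow_mul, neg_one_sq, one_pow, one_mul, ← two_mul]
      split_ifs with h
      · simp only [mul_zero, norm_zero]; positivity
      · rw [norm_mul, Complex.norm_ofNat, mul_assoc]
        have := hS m (by omega)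
        gcongr
    · rw [pow_succ, pow_mul, neg_one_sq, one_pow]
      simp only [one_mul, neg_mul, add_neg_cancel, norm_zero]
      positivity
  have hdeg : L.natDegree ≤ k := by
    refine natDegree_sum_le_of_forall_le _ _ fun i hi => (natDegree_C_mul_X_pow_le _ _).trans ?_
    exact Nat.lt_succ_iff.1 (Finset.mem_range.1 hi)
  have hlog := (IsAlgClosed.splits L).eval_derivative_div_eval_of_ne_zero (x := 0)
    (by rw [hL0]; exact one_ne_zero)
  rw [hL0, div_one, ← coeff_zero_eq_eval_zero, coeff_derivative, hLc] at hlog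
  norm_num at hlog
  rw [hlog]
  calc _ ≤ ((L.roots.map fun z => ‖(-z⁻¹ : ℂ)‖)).sum := by
        simpa using norm_multiset_sum_le (L.roots.map fun z => (-z⁻¹ : ℂ))
    _ ≤ Multiset.card (L.roots.map fun z => ‖(-z⁻¹ : ℂ)‖) • ρ := by
        refine Multiset.sum_le_card_nsmul _ _ fun x hx => ?_
        obtain ⟨z, hz, rfl⟩ := Multiset.mem_map.1 hx
        have := hroot z hz
        have hz0 : 0 < ‖z‖ := by
          by_contra! h
          nlinarith [norm_nonneg z]
        rw [norm_neg, norm_inv, inv_le_iff_one_le_mul₀ hz0]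
        exact this
    _ ≤ k * ρ := by
        rw [Multiset.card_map, nsmul_eq_mul]
        have : (Multiset.card L.roots : ℝ) ≤ k := by exact_mod_cast (card_roots' L).trans hdeg
        gcongr

open Polynomial in
theorem finite_setOf_monic_natDegree_eq (K : Type*) [Field K] [Finite K] (n : ℕ) :
    {g : K[X] | g.Monic ∧ g.natDegree = n}.Finite :=
  Set.finite_coe_iff.1 (Finite.of_equiv _
    ((monicEquivDegreeLT n).trans (degreeLTEquiv K n).toEquiv).symm)

open Polynomial in
/-- The monic polynomials of degree `n` over a finite field. -/
noncomputable def monicsOfDegree (K : Type*) [Field K] [Finite K] (n : ℕ) : Finset K[X] :=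
  (finite_setOf_monic_natDegree_eq K n).toFinset

open Polynomial in
theorem mem_monicsOfDegree {K : Type*} [Field K] [Finite K] {n : ℕ} {g : K[X]} :
    g ∈ monicsOfDegree K n ↔ g.Monic ∧ g.natDegree = n := by
  simp [monicsOfDegree]

open Polynomial Classical in
/-- The monic irreducible polynomials of degree at most `n` over a finite field. -/
noncomputable def monicIrreduciblesLE (K : Type*) [Field K] [Finite K] (n : ℕ) : Finset K[X] :=
  ((Finset.range (n + 1)).biUnion (monicsOfDegree K)).filter Irreducible

open Polynomial in
theorem mem_monicIrreduciblesLE {K : Type*} [Field K] [Finite K] {n : ℕ} {g : K[X]} :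
    g ∈ monicIrreduciblesLE K n ↔ g.Monic ∧ Irreducible g ∧ g.natDegree ≤ n := by
  simp only [monicIrreduciblesLE, Finset.mem_filter, Finset.mem_biUnion, mem_monicsOfDegree,
    Finset.mem_range, Nat.lt_succ_iff]
  constructor
  · rintro ⟨⟨a, ha, hg, rfl⟩, h⟩
    exact ⟨hg, h, ha⟩
  · rintro ⟨hg, h, ha⟩
    exact ⟨⟨_, ha, hg, rfl⟩, h⟩

open Polynomial Classical in
theorem natDegree_eq_sum_monicIrreduciblesLE {K : Type*} [Field K] [Finite K] {n : ℕ} {g : K[X]}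
    (hg : g ∈ monicsOfDegree K n) : n = ∑ P ∈ monicIrreduciblesLE K n, ∑ a ∈ Finset.Icc 1 n,
      if P ^ a ∣ g then P.natDegree else 0 := by
  obtain ⟨hgm, hgn⟩ := mem_monicsOfDegree.1 hg
  have hg0 := hgm.ne_zero
  set m := UniqueFactorizationMonoid.normalizedFactors g with hm
  have hmem : ∀ P, P ∈ m ↔ Irreducible P ∧ P.Monic ∧ P ∣ g := fun P =>
    Polynomial.mem_normalizedFactors_iff hg0
  have h1 : n = (m.map natDegree).sum := by
    have h := leadingCoeff_mul_prod_normalizedFactors g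
    rw [hgm.leadingCoeff, C_1, one_mul] at h
    rw [← hgn, ← h, ← hm, natDegree_multiset_prod_of_monic]
    intro P hP
    exact ((hmem P).1 hP).2.1
  have hsub : m.toFinset ⊆ monicIrreduciblesLE K n := by
    intro P hP
    obtain ⟨h2, h3, h4⟩ := (hmem P).1 (Multiset.mem_toFinset.1 hP)
    exact mem_monicIrreduciblesLE.2 ⟨h3, h2, hgn ▸ natDegree_le_of_dvd h4 hg0⟩
  have hcount : ∀ P ∈ monicIrreduciblesLE K n, m.count P * P.natDegree =
      ∑ a ∈ Finset.Icc 1 n, if P ^ a ∣ g then P.natDegree else 0 := by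
    intro P hP
    obtain ⟨hPm, hPi, hPn⟩ := mem_monicIrreduciblesLE.1 hP
    have hfin : FiniteMultiplicity P g := FiniteMultiplicity.of_not_isUnit hPi.not_isUnit hg0
    have hc : m.count P = multiplicity P g := by
      rw [UniqueFactorizationMonoid.multiplicity_eq_count_normalizedFactors hPi hg0,
        hPm.normalize_eq_self]
    have hle : multiplicity P g ≤ n := by
      have h5 := natDegree_le_of_dvd (pow_multiplicity_dvd P g) hg0
      rw [natDegree_pow, hgn] at h5
      have h6 := hPi.natDegree_pos
      nlinarith
    rw [← Finset.sum_filter, Finset.sum_const, smul_eq_mul, hc]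
    congr 1
    have : (Finset.Icc 1 n).filter (fun a => P ^ a ∣ g) = Finset.Icc 1 (multiplicity P g) := by
      ext a
      rw [Finset.mem_filter, Finset.mem_Icc, Finset.mem_Icc, hfin.pow_dvd_iff_le_multiplicity]
      omega
    rw [this, Nat.card_Icc, Nat.add_sub_cancel]
  rw [← Finset.sum_congr rfl hcount]
  refine h1.trans ?_
  rw [Finset.sum_multiset_map_count]
  simp only [smul_eq_mul]
  refine (Finset.sum_subset hsub fun P _ hP => ?_)
  rw [Multiset.count_eq_zero.2 (fun h => hP (Multiset.mem_toFinset.2 h)), zero_mul]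

open Polynomial Classical in
/-- Newton's identities for the coefficients of the Euler product of a completely multiplicative
function on monic polynomials. -/
theorem natCast_mul_sum_monicsOfDegree {K : Type*} [Field K] [Finite K] (X : K[X] →* ℂ) (n : ℕ) :
    (n : ℂ) * ∑ g ∈ monicsOfDegree K n, X g = ∑ j ∈ Finset.Icc 1 n,
      (∑ P ∈ (monicIrreduciblesLE K j).filter (fun P => P.natDegree ∣ j),
        (P.natDegree : ℂ) * X P ^ (j / P.natDegree)) * ∑ g ∈ monicsOfDegree K (n - j), X g := by
  have hinner : ∀ P ∈ monicIrreduciblesLE K n, ∀ a ∈ Finset.Icc 1 n,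
      ∑ g ∈ monicsOfDegree K n, (if P ^ a ∣ g then X g else 0) =
      if a * P.natDegree ≤ n then
        X P ^ a * ∑ g ∈ monicsOfDegree K (n - a * P.natDegree), X g else 0 := by
    intro P hP a ha
    obtain ⟨hPm, hPi, hPn⟩ := mem_monicIrreduciblesLE.1 hP
    split_ifs with hle
    · rw [← Finset.sum_filter, Finset.mul_sum]
      symm
      refine Finset.sum_bij (fun h _ => P ^ a * h) ?_ ?_ ?_ ?_
      · intro h hh
        obtain ⟨h1, h2⟩ := mem_monicsOfDegree.1 hh
        rw [Finset.mem_filter, mem_monicsOfDegree]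
        refine ⟨⟨(hPm.pow a).mul h1, ?_⟩, dvd_mul_right _ _⟩
        rw [(hPm.pow a).natDegree_mul h1, hPm.natDegree_pow, h2]
        omega
      · intro h _ h' _ heq
        exact mul_left_cancel₀ (hPm.pow a).ne_zero heq
      · intro g hg
        rw [Finset.mem_filter, mem_monicsOfDegree] at hg
        obtain ⟨⟨hgm, hgn⟩, h, rfl⟩ := hg
        have hhm : h.Monic := (hPm.pow a).of_mul_monic_left hgm
        refine ⟨h, mem_monicsOfDegree.2 ⟨hhm, ?_⟩, rfl⟩
        rw [(hPm.pow a).natDegree_mul hhm, hPm.natDegree_pow] at hgn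
        omega
      · intro h _
        rw [map_mul, map_pow]
    · refine Finset.sum_eq_zero fun g hg => if_neg fun hdvd => hle ?_
      obtain ⟨h1, h2⟩ := mem_monicsOfDegree.1 hg
      have := natDegree_le_of_dvd hdvd h1.ne_zero
      rwa [natDegree_pow, h2] at this
  calc (n : ℂ) * ∑ g ∈ monicsOfDegree K n, X g
      = ∑ g ∈ monicsOfDegree K n, ∑ P ∈ monicIrreduciblesLE K n, ∑ a ∈ Finset.Icc 1 n,
          (P.natDegree : ℂ) * if P ^ a ∣ g then X g else 0 := by
        rw [Finset.mul_sum]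
        refine Finset.sum_congr rfl fun g hg => ?_
        conv_lhs => rw [natDegree_eq_sum_monicIrreduciblesLE hg]
        push_cast
        rw [Finset.sum_mul]
        refine Finset.sum_congr rfl fun P _ => ?_
        rw [Finset.sum_mul]
        refine Finset.sum_congr rfl fun a _ => ?_
        split_ifs <;> simp
    _ = ∑ P ∈ monicIrreduciblesLE K n, ∑ a ∈ Finset.Icc 1 n, if a * P.natDegree ≤ n then
          (P.natDegree : ℂ) * (X P ^ a * ∑ g ∈ monicsOfDegree K (n - a * P.natDegree), X g)
          else 0 := by
        rw [Finset.sum_comm]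
        refine Finset.sum_congr rfl fun P hP => ?_
        rw [Finset.sum_comm]
        refine Finset.sum_congr rfl fun a ha => ?_
        rw [← Finset.mul_sum, hinner P hP a ha]
        split_ifs <;> simp
    _ = ∑ x ∈ (monicIrreduciblesLE K n ×ˢ Finset.Icc 1 n).filter
          (fun x => x.2 * x.1.natDegree ≤ n), (x.1.natDegree : ℂ) * (X x.1 ^ x.2 *
            ∑ g ∈ monicsOfDegree K (n - x.2 * x.1.natDegree), X g) := by
        rw [Finset.sum_filter, Finset.sum_product]
    _ = _ := by
        have hmaps : ∀ x ∈ (monicIrreduciblesLE K n ×ˢ Finset.Icc 1 n).filter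
            (fun x => x.2 * x.1.natDegree ≤ n), x.2 * x.1.natDegree ∈ Finset.Icc 1 n := by
          intro x hx
          simp only [Finset.mem_filter, Finset.mem_product, mem_monicIrreduciblesLE,
            Finset.mem_Icc] at hx ⊢
          exact ⟨Nat.mul_pos hx.1.2.1 hx.1.1.2.1.natDegree_pos, hx.2⟩
        rw [← Finset.sum_fiberwise_of_maps_to hmaps]
        refine Finset.sum_congr rfl fun j hj => ?_
        rw [Finset.mem_Icc] at hj
        rw [Finset.sum_mul]
        refine Finset.sum_bij (fun x _ => x.1) ?_ ?_ ?_ ?_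
        · rintro ⟨P, a⟩ hx
          simp only [Finset.mem_filter, Finset.mem_product, mem_monicIrreduciblesLE,
            Finset.mem_Icc] at hx ⊢
          obtain ⟨⟨⟨⟨h1, h2, h3⟩, h4, h5⟩, h6⟩, rfl⟩ := hx
          exact ⟨⟨h1, h2, Nat.le_mul_of_pos_left _ h4⟩, dvd_mul_left _ _⟩
        · rintro ⟨P, a⟩ hx ⟨P', a'⟩ hx' hPP
          simp only [Finset.mem_filter, Finset.mem_product, mem_monicIrreduciblesLE,
            Finset.mem_Icc] at hx hx' hPP
          subst hPP
          have h7 := hx.1.1.1.2.1.natDegree_pos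
          have h8 : a = a' := Nat.eq_of_mul_eq_mul_right h7 (hx.2.trans hx'.2.symm)
          rw [h8]
        · intro P hP
          simp only [Finset.mem_filter, mem_monicIrreduciblesLE] at hP
          obtain ⟨⟨h1, h2, h3⟩, h4⟩ := hP
          have h5 := Nat.div_mul_cancel h4
          have h6 : 1 ≤ j / P.natDegree := Nat.div_pos h3 h2.natDegree_pos
          have h7 := Nat.div_le_self j P.natDegree
          refine ⟨(P, j / P.natDegree), ?_, rfl⟩
          simp only [Finset.mem_filter, Finset.mem_product, mem_monicIrreduciblesLE,
            Finset.mem_Icc]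
          exact ⟨⟨⟨⟨h1, h2, h3.trans hj.2⟩, h6, h7.trans hj.2⟩, h5.le.trans hj.2⟩, h5⟩
        · rintro ⟨P, a⟩ hx
          simp only [Finset.mem_filter, Finset.mem_product, mem_monicIrreduciblesLE,
            Finset.mem_Icc] at hx
          obtain ⟨⟨⟨⟨h1, h2, h3⟩, h4, h5⟩, h6⟩, rfl⟩ := hx
          simp only
          rw [Nat.mul_div_cancel _ h2.natDegree_pos]
          ring

open Polynomial in
/-- The norm of `a - x` is a power of the value at `a` of the minimal polynomial of `x`. -/
theorem norm_algebraMap_sub_eq_eval_minpoly {K L : Type*} [Field K] [Field L] [Algebra K L]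
    [FiniteDimensional K L] [Algebra.IsSeparable K L] (a : K) (x : L) :
    Algebra.norm K (algebraMap K L a - x) =
      (minpoly K x).eval a ^ (Module.finrank K L / (minpoly K x).natDegree) := by
  have hx : ∀ y : L, IsIntegral K y := fun y => Algebra.IsIntegral.isIntegral y
  have hmul := fun y : L => Module.finrank_mul_finrank K (IntermediateField.adjoin K {y}) L
  have hdeg := fun y : L => IntermediateField.adjoin.finrank (hx y)
  set y := x - algebraMap K L a with hy
  have hmin : minpoly K y = (minpoly K x).comp (X + C a) := minpoly.sub_algebraMap x a
  have hdy : (minpoly K y).natDegree = (minpoly K x).natDegree := by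
    rw [hmin, natDegree_comp, natDegree_X_add_C, mul_one]
  have hc0 : (minpoly K y).coeff 0 = (minpoly K x).eval a := by
    rw [hmin, coeff_zero_eq_eval_zero, eval_comp]
    simp
  have hny : Algebra.norm K (IntermediateField.AdjoinSimple.gen K y) =
      (-1) ^ (minpoly K x).natDegree * (minpoly K x).eval a := by
    have h := Algebra.PowerBasis.norm_gen_eq_coeff_zero_minpoly
      (IntermediateField.adjoin.powerBasis (hx y))
    rw [IntermediateField.adjoin.powerBasis_gen, IntermediateField.adjoin.powerBasis_dim,
      IntermediateField.minpoly_gen, hc0, hdy] at h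
    exact h
  have hpos : 0 < (minpoly K x).natDegree := minpoly.natDegree_pos (hx x)
  have hq : Module.finrank (IntermediateField.adjoin K {y}) L =
      Module.finrank K L / (minpoly K x).natDegree := by
    rw [← hmul y, hdeg, hdy, Nat.mul_div_cancel_left _ hpos]
  have hneg : algebraMap K L a - x = algebraMap K L (-1) * y := by
    rw [hy, map_neg, map_one]
    ring
  have hfin : (minpoly K x).natDegree * (Module.finrank K L / (minpoly K x).natDegree) =
      Module.finrank K L := by
    rw [← hq, ← hdy, ← hdeg y, hmul]
  rw [hneg, map_mul, Algebra.norm_algebraMap, Algebra.norm_eq_norm_adjoin K y, hny, hq, mul_pow,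
    ← pow_mul, hfin, ← mul_assoc, ← mul_pow]
  simp

open Polynomial Classical in
/-- Grouping the elements of a finite extension by minimal polynomial. -/
theorem sum_minpoly_eq_sum_monicIrreduciblesLE {K L : Type*} [Field K] [Finite K] [Field L]
    [Fintype L] [Algebra K L] (F : K[X] → ℂ) :
    ∑ x : L, F (minpoly K x) = ∑ P ∈ (monicIrreduciblesLE K (Module.finrank K L)).filter
      (fun P => P.natDegree ∣ Module.finrank K L), (P.natDegree : ℂ) * F P := by
  have hx : ∀ y : L, IsIntegral K y := fun y => Algebra.IsIntegral.isIntegral y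
  have hmaps : ∀ x ∈ (Finset.univ : Finset L), minpoly K x ∈
      (monicIrreduciblesLE K (Module.finrank K L)).filter
        (fun P => P.natDegree ∣ Module.finrank K L) := by
    intro x _
    rw [Finset.mem_filter, mem_monicIrreduciblesLE]
    exact ⟨⟨minpoly.monic (hx x), minpoly.irreducible (hx x), minpoly.natDegree_le x⟩,
      minpoly.degree_dvd (hx x)⟩
  rw [← Finset.sum_fiberwise_of_maps_to hmaps]
  refine Finset.sum_congr rfl fun P hP => ?_
  obtain ⟨hP1, hdvd⟩ := Finset.mem_filter.1 hP
  obtain ⟨hPm, hPi, -⟩ := mem_monicIrreduciblesLE.1 hP1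
  have hset : (Finset.univ.filter fun x : L => minpoly K x = P) = (P.rootSet L).toFinset := by
    ext x
    rw [Finset.mem_filter, Set.mem_toFinset, mem_rootSet_of_ne hPm.ne_zero]
    constructor
    · rintro ⟨-, rfl⟩
      exact minpoly.aeval K x
    · intro h
      exact ⟨Finset.mem_univ _, (minpoly.eq_of_irreducible_of_monic hPi h hPm).symm⟩
  rw [Finset.sum_congr rfl (g := fun _ => F P) fun x hx => by rw [(Finset.mem_filter.1 hx).2],
    Finset.sum_const, hset, nsmul_eq_mul]
  congr 2
  rw [Set.toFinset_card]
  refine card_rootSet_eq_natDegree (PerfectField.separable_of_irreducible hPi) ?_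
  have h1 := hPi.natDegree_dvd_iff_dvd_X_pow_card_pow_sub_X.1 hdvd
  have hcard : Nat.card K ^ Module.finrank K L = Nat.card L :=
    (Module.natCard_eq_pow_finrank (K := K) (V := L)).symm
  rw [hcard, Nat.card_eq_fintype_card] at h1
  have hne : (X ^ Fintype.card L - X : L[X]) ≠ 0 := FiniteField.X_pow_card_sub_X_ne_zero L
    Fintype.one_lt_card
  refine Splits.of_dvd (g := X ^ Fintype.card L - X) ?_ hne ?_
  · rw [splits_iff_card_roots, FiniteField.roots_X_pow_card_sub_X,
      FiniteField.X_pow_card_sub_X_natDegree_eq _ Fintype.one_lt_card]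
    rfl
  · have := map_dvd (mapRingHom (algebraMap K L)) h1
    simpa using this

open Polynomial in
/-- The completely multiplicative function `g ↦ ∏ i, χ i (g (a i))` on polynomials. -/
noncomputable def evalChar {K ι : Type*} [Field K] [Fintype ι] (a : ι → K)
    (χ : ι → MulChar K ℂ) : K[X] →* ℂ :=
  ∏ i, (χ i).toMonoidHom.comp (evalRingHom (a i) : K[X] →* K)

open Polynomial in
theorem evalChar_apply {K ι : Type*} [Field K] [Fintype ι] (a : ι → K)
    (χ : ι → MulChar K ℂ) (g : K[X]) : evalChar a χ g = ∏ i, χ i (g.eval (a i)) := by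
  simp [evalChar, MonoidHom.finsetProd_apply]

open Polynomial Classical in
/-- The `L`-function attached to `evalChar` is a polynomial. -/
theorem sum_evalChar_eq_zero {K ι : Type*} [Field K] [Finite K] [Fintype ι] (a : ι → K)
    (χ : ι → MulChar K ℂ) (j : ι) (hj : ∀ i ≠ j, a i ≠ a j) (hχ : χ j ≠ 1) {n : ℕ}
    (hn : Fintype.card ι ≤ n) : ∑ g ∈ monicsOfDegree K n, evalChar a χ g = 0 := by
  have := Fintype.ofFinite K
  let u₀ : K[X] := ∏ i ∈ Finset.univ.erase j, (X - C (a i))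
  have hu₀j : u₀.eval (a j) ≠ 0 := by
    simp only [u₀, eval_prod, eval_sub, eval_X, eval_C]
    exact Finset.prod_ne_zero_iff.2 fun i hi =>
      sub_ne_zero.2 (hj i (Finset.ne_of_mem_erase hi)).symm
  let u : K[X] := C (u₀.eval (a j))⁻¹ * u₀
  have huj : u.eval (a j) = 1 := by simp [u, hu₀j]
  have hui : ∀ i ≠ j, u.eval (a i) = 0 := by
    intro i hi
    have h0 : ∏ l ∈ Finset.univ.erase j, (a i - a l) = 0 :=
      Finset.prod_eq_zero (Finset.mem_erase.2 ⟨hi, Finset.mem_univ i⟩) (sub_self _)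
    simp only [u, u₀, eval_mul, eval_prod, eval_sub, eval_X, eval_C, h0, mul_zero]
  have hudeg : u.natDegree < n := by
    refine (natDegree_C_mul_le _ _).trans_lt ?_
    have : u₀.natDegree = (Finset.univ.erase j).card := by
      simp only [u₀]
      rw [natDegree_prod_of_monic _ _ fun i _ => monic_X_sub_C _]
      simp
    rw [this, Finset.card_erase_of_mem (Finset.mem_univ j), Finset.card_univ]
    have := Fintype.card_pos_iff.2 ⟨j⟩
    omega
  have hmem : ∀ b : K, ∀ g ∈ monicsOfDegree K n, g + C b * u ∈ monicsOfDegree K n := by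
    intro b g hg
    obtain ⟨h1, h2⟩ := mem_monicsOfDegree.1 hg
    have h3 : (C b * u).natDegree < g.natDegree := by
      rw [h2]
      exact (natDegree_C_mul_le _ _).trans_lt hudeg
    exact mem_monicsOfDegree.2 ⟨h1.add_of_left (degree_lt_degree h3),
      (natDegree_add_eq_left_of_natDegree_lt h3).trans h2⟩
  have hshift : ∀ b : K, ∑ g ∈ monicsOfDegree K n, evalChar a χ g =
      ∑ g ∈ monicsOfDegree K n, evalChar a χ (g + C b * u) := by
    intro b
    symm
    refine Finset.sum_bij (fun g _ => g + C b * u) (hmem b) ?_ ?_ fun _ _ => rfl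
    · intro g _ g' _ h
      exact add_right_cancel h
    · intro g hg
      exact ⟨g + C (-b) * u, hmem (-b) g hg, by simp⟩
  have hzero : ∀ g, ∑ b : K, evalChar a χ (g + C b * u) = 0 := by
    intro g
    have : ∀ b : K, evalChar a χ (g + C b * u) =
        χ j (g.eval (a j) + b) * ∏ i ∈ Finset.univ.erase j, χ i (g.eval (a i)) := by
      intro b
      rw [evalChar_apply, ← Finset.mul_prod_erase _ _ (Finset.mem_univ j)]
      congr 1
      · simp [huj]
      · refine Finset.prod_congr rfl fun i hi => ?_
        simp [hui i (Finset.ne_of_mem_erase hi)]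
    have hs : ∑ b : K, χ j (g.eval (a j) + b) = 0 :=
      (Equiv.sum_comp (Equiv.addLeft (g.eval (a j))) (χ j ·)).trans
        (MulChar.sum_eq_zero_of_ne_one hχ)
    rw [Finset.sum_congr rfl fun b _ => this b, ← Finset.sum_mul, hs, zero_mul]
  have hsum : (Fintype.card K : ℂ) * ∑ g ∈ monicsOfDegree K n, evalChar a χ g = 0 := by
    calc (Fintype.card K : ℂ) * ∑ g ∈ monicsOfDegree K n, evalChar a χ g
        = ∑ b : K, ∑ g ∈ monicsOfDegree K n, evalChar a χ (g + C b * u) := by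
          rw [← Finset.sum_congr rfl fun b _ => hshift b, Finset.sum_const, nsmul_eq_mul,
            Finset.card_univ]
      _ = 0 := by
          rw [Finset.sum_comm]
          exact Finset.sum_eq_zero fun g _ => hzero g
  exact (mul_eq_zero.1 hsum).resolve_left (Nat.cast_ne_zero.2 Fintype.card_ne_zero)

open Polynomial in
theorem sum_monicsOfDegree_zero {K : Type*} [Field K] [Finite K] (F : K[X] →* ℂ) :
    ∑ g ∈ monicsOfDegree K 0, F g = 1 := by
  have : monicsOfDegree K 0 = {1} := by
    ext g
    rw [mem_monicsOfDegree, Finset.mem_singleton]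
    constructor
    · rintro ⟨h1, h2⟩
      exact h1.natDegree_eq_zero.1 h2
    · rintro rfl
      exact ⟨monic_one, natDegree_one⟩
  rw [this, Finset.sum_singleton, map_one]

open Polynomial in
theorem sum_monicsOfDegree_one {K : Type*} [Field K] [Fintype K] (F : K[X] → ℂ) :
    ∑ g ∈ monicsOfDegree K 1, F g = ∑ x : K, F (X - C x) := by
  symm
  refine Finset.sum_bij (fun x _ => X - C x) ?_ ?_ ?_ fun _ _ => rfl
  · intro x _
    exact mem_monicsOfDegree.2 ⟨monic_X_sub_C x, natDegree_X_sub_C x⟩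
  · intro x _ y _ h
    simpa using h
  · intro g hg
    obtain ⟨h1, h2⟩ := mem_monicsOfDegree.1 hg
    refine ⟨-g.coeff 0, Finset.mem_univ _, ?_⟩
    rw [h1.eq_X_add_C h2]
    simp

theorem MulChar.norm_le_one_of_finite {R : Type*} [CommRing R] [Finite R] (χ : MulChar R ℂ) (x : R) :
    ‖χ x‖ ≤ 1 := by
  by_cases hx : IsUnit x
  · obtain ⟨u, rfl⟩ := hx
    have h : χ u ^ Nat.card Rˣ = 1 := by
      rw [← map_pow, ← Units.val_pow_eq_pow_val, pow_card_eq_one', Units.val_one, map_one]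
    exact (Complex.norm_eq_one_of_pow_eq_one h Nat.card_pos.ne').le
  · rw [χ.map_nonunit hx, norm_zero]
    exact zero_le_one

/-- The composition of a multiplicative character with the norm. -/
noncomputable def MulChar.compNorm {K : Type*} (L : Type*) [Field K] [Field L] [Algebra K L]
    [FiniteDimensional K L] (χ : MulChar K ℂ) : MulChar L ℂ where
  toMonoidHom := χ.toMonoidHom.comp (Algebra.norm K)
  map_nonunit' x hx := by
    have : x = 0 := by simpa using hx
    subst this
    simp

theorem MulChar.compNorm_apply {K : Type*} (L : Type*) [Field K] [Field L] [Algebra K L]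
    [FiniteDimensional K L] (χ : MulChar K ℂ) (x : L) :
    χ.compNorm L x = χ (Algebra.norm K x) := rfl

open Polynomial Classical in
/-- The Newton power sums of the `L`-function are character sums over extensions. -/
theorem newtonSum_evalChar_eq {K L ι : Type*} [Field K] [Finite K] [Field L] [Fintype L]
    [Algebra K L] [Fintype ι] (a : ι → K) (χ : ι → MulChar K ℂ) :
    ∑ P ∈ (monicIrreduciblesLE K (Module.finrank K L)).filter
      (fun P => P.natDegree ∣ Module.finrank K L),
        (P.natDegree : ℂ) * evalChar a χ P ^ (Module.finrank K L / P.natDegree) =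
      ∑ x : L, ∏ i, (χ i).compNorm L (algebraMap K L (a i) - x) := by
  rw [← sum_minpoly_eq_sum_monicIrreduciblesLE
    (fun P => evalChar a χ P ^ (Module.finrank K L / P.natDegree))]
  refine Finset.sum_congr rfl fun x _ => ?_
  rw [evalChar_apply, ← Finset.prod_pow]
  refine Finset.prod_congr rfl fun i _ => ?_
  rw [MulChar.compNorm_apply, norm_algebraMap_sub_eq_eval_minpoly, map_pow]

theorem exists_field_finrank_zmod_eq (p m : ℕ) [Fact p.Prime] (hm : m ≠ 0) :
    ∃ (L : Type) (_ : Field L) (_ : Fintype L) (_ : Algebra (ZMod p) L),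
      Module.finrank (ZMod p) L = m := by
  have : Fintype (GaloisField p m) := Fintype.ofFinite _
  exact ⟨GaloisField p m, inferInstance, this, inferInstance, GaloisField.finrank p hm⟩

/-- The square-root bound with an inexplicit constant, over an extension of even degree. -/
theorem norm_sum_prod_compNorm_le {p n : ℕ} [Fact p.Prime] {ι L : Type*} [Fintype ι] [Field L]
    [Fintype L] [Algebra (ZMod p) L] (hfr : Module.finrank (ZMod p) L = 2 * n)
    (χ : MulChar (ZMod p) ℂ) (hχ : χ ≠ 1) (ψ : ι → MulChar (ZMod p) ℂ) (e : ι → ℕ)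
    (he : ∀ i, ψ i = χ ^ e i) (he1 : ∀ i, 1 ≤ e i) (a : ι → ZMod p) (j : ι)
    (hj : ∀ i ≠ j, a i ≠ a j) (hecop : (e j).Coprime (orderOf χ)) :
    ‖∑ x : L, ∏ i, (ψ i).compNorm L (algebraMap (ZMod p) L (a i) - x)‖ ≤
      (1 + 4 * orderOf χ * (orderOf χ * ∑ i, e i : ℕ)) * (p : ℝ) ^ n := by
  classical
  have hp : p.Prime := Fact.out
  set d := orderOf χ with hd
  have hdpos : 0 < d := orderOf_pos χ
  have hd2 : 2 ≤ d := by
    have : d ≠ 1 := fun h => hχ (orderOf_eq_one_iff.1 h)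
    omega
  have hdp : d ∣ p - 1 := by
    have := MulChar.orderOf_dvd_card_sub_one (ZMod p) χ
    rwa [ZMod.card] at this
  set E := ∑ i, e i with hE
  have : CharP L p := charP_of_injective_algebraMap (algebraMap (ZMod p) L).injective p
  have hcard : Fintype.card L = (p ^ n) ^ 2 := by
    rw [Module.card_eq_pow_finrank (K := ZMod p), ZMod.card, hfr, mul_comm, pow_mul]
  let T : ℂ := ∑ x : L, ∏ i, (ψ i).compNorm L (algebraMap (ZMod p) L (a i) - x)
  change ‖T‖ ≤ _
  set Ψ := χ.compNorm L with hΨ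
  have hterm : ∀ i, ∀ y : L, (ψ i).compNorm L y = Ψ y ^ e i := by
    intro i y
    rw [hΨ, MulChar.compNorm_apply, MulChar.compNorm_apply, he i,
      MulChar.pow_apply' _ (Nat.one_le_iff_ne_zero.1 (he1 i))]
  have hT : T = ∑ x : L, ∏ i, Ψ (algebraMap (ZMod p) L (a i) - x) ^ e i := by
    simp only [T]
    exact Finset.sum_congr rfl fun x _ => Finset.prod_congr rfl fun i _ => hterm i _
  have hΨd : Ψ ^ d = 1 := by
    ext u
    have h := congrArg (fun φ => φ (Algebra.norm (ZMod p) (u : L))) (pow_orderOf_eq_one χ)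
    rw [← hd, MulChar.pow_apply' _ hdpos.ne',
      MulChar.one_apply (u.isUnit.map (Algebra.norm (ZMod p)))] at h
    rw [MulChar.pow_apply_coe, hΨ, MulChar.compNorm_apply, h, MulChar.one_apply_coe]
  have hΨ1 : Ψ ≠ 1 := by
    intro h
    apply hχ
    ext u
    obtain ⟨x, hx⟩ := FiniteField.norm_surjective (ZMod p) L (u : ZMod p)
    have hx0 : x ≠ 0 := by
      rintro rfl
      rw [Algebra.norm_zero] at hx
      exact u.ne_zero hx.symm
    rw [← hx, ← MulChar.compNorm_apply L, ← hΨ, h, MulChar.one_apply hx0.isUnit, hx,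
      MulChar.one_apply_coe]
  have hdpn : d ∣ p ^ n - 1 := hdp.trans (by simpa using Nat.sub_dvd_pow_sub_pow p 1 n)
  obtain ⟨t, ht⟩ := hdpn
  have hpn : p ^ n = d * t + 1 := by
    have := Nat.one_le_pow n p hp.pos
    omega
  by_cases hlarge : 2 * (d * E) ≤ t
  · rw [hT]
    exact norm_sum_prod_mulChar_sub_le p n d t hcard hpn hd2
      (fun i => algebraMap (ZMod p) L (a i)) e j
      (fun i hi h => hj i hi ((algebraMap (ZMod p) L).injective h)) he1 hecop hlarge Ψ hΨd
      hΨ1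
  · have h1 : ‖T‖ ≤ Fintype.card L := by
      rw [hT]
      refine (norm_sum_le _ _).trans ?_
      rw [← Finset.card_univ, ← nsmul_one, ← Finset.sum_const]
      refine Finset.sum_le_sum fun x _ => ?_
      rw [norm_prod]
      refine Finset.prod_le_one (fun _ _ => norm_nonneg _) fun i _ => ?_
      rw [norm_pow]
      exact pow_le_one₀ (norm_nonneg _) (Ψ.norm_le_one_of_finite _)
    have h2 : p ^ n ≤ 1 + 4 * d * (d * E) := by
      have : t ≤ 2 * (d * E) := by omega
      nlinarith
    have h3 : (p : ℝ) ^ n ≤ 1 + 4 * d * (d * E : ℕ) := by exact_mod_cast h2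
    calc ‖T‖ ≤ (Fintype.card L : ℝ) := h1
      _ = (p : ℝ) ^ n * (p : ℝ) ^ n := by rw [hcard]; push_cast; ring
      _ ≤ _ := by gcongr

open Polynomial Classical in
/-- **Weil's bound** for sums of products of shifts of a character and its inverse, one of the
shifts being different from all the others. -/
theorem norm_sum_prod_mulChar_le_sqrt {p : ℕ} [Fact p.Prime] {ι : Type*} [Fintype ι]
    (χ : MulChar (ZMod p) ℂ) (hχ : χ ≠ 1) (ψ : ι → MulChar (ZMod p) ℂ)
    (hψ : ∀ i, ψ i = χ ∨ ψ i = χ⁻¹) (a : ι → ZMod p) (j : ι) (hj : ∀ i ≠ j, a i ≠ a j) :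
    ‖∑ x, ∏ i, ψ i (a i - x)‖ ≤ Fintype.card ι * √p := by
  have hp : p.Prime := Fact.out
  set d := orderOf χ with hd
  have hdpos : 0 < d := orderOf_pos χ
  have hd2 : 2 ≤ d := by
    have : d ≠ 1 := fun h => hχ (orderOf_eq_one_iff.1 h)
    omega
  have hinv : χ⁻¹ = χ ^ (d - 1) := by
    rw [inv_eq_iff_mul_eq_one, ← pow_succ', Nat.sub_add_cancel (by omega), pow_orderOf_eq_one]
  let e : ι → ℕ := fun i => if ψ i = χ then 1 else d - 1
  have he : ∀ i, ψ i = χ ^ e i := by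
    intro i
    simp only [e]
    split_ifs with h
    · rw [pow_one, h]
    · rw [← hinv]
      exact (hψ i).resolve_left h
  have he1 : ∀ i, 1 ≤ e i := by
    intro i
    simp only [e]
    split_ifs <;> omega
  have hecop : ∀ i, (e i).Coprime d := by
    intro i
    simp only [e]
    split_ifs
    · exact Nat.coprime_one_left d
    · have := (Nat.coprime_self_add_right (m := d - 1) (n := 1)).2 (Nat.coprime_one_right _)
      rwa [Nat.sub_add_cancel (by omega)] at this
  have hψj : ψ j ≠ 1 := by
    rcases hψ j with h | h <;> rw [h]
    · exact hχ
    · simpa using hχ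
  set E := ∑ i, e i with hE
  let S : ℕ → ℂ := fun m => ∑ P ∈ (monicIrreduciblesLE (ZMod p) m).filter
    (fun P => P.natDegree ∣ m), (P.natDegree : ℂ) * evalChar a ψ P ^ (m / P.natDegree)
  have hp0 : (0 : ℝ) < p := by exact_mod_cast hp.pos
  have hS : ∀ n, 1 ≤ n → ‖S (2 * n)‖ ≤ (1 + 4 * d * (d * E : ℕ)) * √p ^ (2 * n) := by
    intro n hn
    obtain ⟨L, _, _, _, hfr⟩ := exists_field_finrank_zmod_eq p (2 * n) (by omega)
    have hSL : S (2 * n) = ∑ x : L, ∏ i, (ψ i).compNorm L (algebraMap (ZMod p) L (a i) - x) := by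
      rw [← newtonSum_evalChar_eq, hfr]
    rw [hSL, pow_mul, Real.sq_sqrt hp0.le]
    exact norm_sum_prod_compNorm_le hfr χ hχ ψ e he he1 a j hj (hecop j)
  have hmain := norm_coeff_one_le_of_newton
    (c := fun n => ∑ g ∈ monicsOfDegree (ZMod p) n, evalChar a ψ g) (S := S)
    (sum_monicsOfDegree_zero _)
    (fun n hn => sum_evalChar_eq_zero a ψ j hj hψj hn.le)
    (fun n => natCast_mul_sum_monicsOfDegree _ n) (Real.sqrt_pos.2 hp0) hS
  simp only [sum_monicsOfDegree_one, evalChar_apply, eval_sub, eval_X, eval_C] at hmain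
  exact hmain

/-- A character modulo `q` that is primitive at every prime divisor of `q`. -/
def MulChar.LocallyPrimitive {q : ℕ} (χ : MulChar (ZMod q) ℂ) : Prop :=
  ∀ p : ℕ, p.Prime → p ∣ q → ∃ z : ℤ, χ (1 + (q / p : ℕ) * z) ≠ 0 ∧ χ (1 + (q / p : ℕ) * z) ≠ 1

theorem MulChar.norm_ringHom_prod_le_one {R ι : Type*} [CommRing R] [Finite R] [Fintype ι]
    (χ : MulChar R ℂ) (σ : ι → ℂ →+* ℂ) (hσ : ∀ i, σ i = RingHom.id ℂ ∨ σ i = starRingEnd ℂ)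
    (f : ι → R) : ‖∏ i, σ i (χ (f i))‖ ≤ 1 := by
  rw [norm_prod]
  refine Finset.prod_le_one (fun _ _ => norm_nonneg _) fun i _ => ?_
  have := χ.norm_le_one_of_finite (f i)
  rcases hσ i with h | h <;> rw [h] <;> simpa using this

theorem norm_sum_prod_prime_le {p : ℕ} [Fact p.Prime] {ι : Type*} [Fintype ι]
    (χ : MulChar (ZMod p) ℂ) (hχ : χ ≠ 1) (σ : ι → ℂ →+* ℂ)
    (hσ : ∀ i, σ i = RingHom.id ℂ ∨ σ i = starRingEnd ℂ) (h : ι → ZMod p) (j : ι)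
    (hj : ∀ i ≠ j, h i ≠ h j) :
    ‖∑ x : ZMod p, ∏ i, σ i (χ (x + h i))‖ ≤ Fintype.card ι * √p := by
  classical
  let ψ : ι → MulChar (ZMod p) ℂ := fun i => if σ i = RingHom.id ℂ then χ else χ⁻¹
  have hψ : ∀ i, ψ i = χ ∨ ψ i = χ⁻¹ := fun i => ite_eq_or_eq _ _ _
  have hσψ : ∀ i z, σ i (χ z) = ψ i z := by
    intro i z
    simp only [ψ]
    split_ifs with hi
    · rw [hi, RingHom.id_apply]
    · rw [(hσ i).resolve_left hi, starRingEnd_apply, ← MulChar.star_apply, MulChar.star_eq_inv]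
  have := norm_sum_prod_mulChar_le_sqrt χ hχ ψ hψ h j hj
  rw [← Equiv.sum_comp (Equiv.neg (ZMod p))] at this
  simpa [hσψ, add_comm] using this

theorem AddChar.map_sum_eq_prod_apply {A M ι : Type*} [AddCommMonoid A] [CommMonoid M]
    (θ : AddChar A M) (s : Finset ι) (f : ι → A) : θ (∑ i ∈ s, f i) = ∏ i ∈ s, θ (f i) := by
  classical
  induction s using Finset.induction_on with
  | empty => simp
  | insert i s hi ih => rw [Finset.sum_insert hi, Finset.prod_insert hi, θ.map_add_eq_mul, ih]

theorem ZMod.castHom_eq_zero_of_not_isUnit {p : ℕ} [Fact p.Prime] {n : ℕ} (hn : n ≠ 0)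
    {x : ZMod (p ^ n)} (hx : ¬IsUnit x) : ZMod.castHom (dvd_pow_self p hn) (ZMod p) x = 0 := by
  have hp : p.Prime := Fact.out
  have : NeZero (p ^ n) := ⟨pow_ne_zero _ hp.ne_zero⟩
  rw [← ZMod.natCast_zmod_val x, ZMod.isUnit_iff_coprime, Nat.coprime_pow_right_iff
    (Nat.pos_of_ne_zero hn), Nat.coprime_comm, hp.coprime_iff_not_dvd, not_not] at hx
  rw [← ZMod.natCast_zmod_val x, map_natCast]
  exact (ZMod.natCast_eq_zero_iff _ _).2 hx

/-- The additive character `a ↦ χ (1 + p * a)` attached to a character modulo `p ^ 2`. -/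
noncomputable def MulChar.linearize {p : ℕ} (χ : MulChar (ZMod (p ^ 2)) ℂ) :
    AddChar (ZMod (p ^ 2)) ℂ where
  toFun a := χ (1 + p * a)
  map_zero_eq_one' := by simp
  map_add_eq_mul' a b := by
    rw [← map_mul]
    congr 1
    have : (p : ZMod (p ^ 2)) ^ 2 = 0 := by exact_mod_cast ZMod.natCast_self (p ^ 2)
    linear_combination -(a * b) * this

theorem MulChar.linearize_apply {p : ℕ} (χ : MulChar (ZMod (p ^ 2)) ℂ) (a : ZMod (p ^ 2)) :
    χ.linearize a = χ (1 + p * a) := rfl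

open Polynomial in
theorem card_filter_sum_inv_eq_zero_le {F ι : Type*} [Field F] [Fintype F] [DecidableEq F]
    [Fintype ι] (s h : ι → F) (j : ι) (hs : s j ≠ 0) (hj : ∀ i ≠ j, h i ≠ h j) :
    (Finset.univ.filter fun y : F => (∀ i, y + h i ≠ 0) ∧ ∑ i, s i * (y + h i)⁻¹ = 0).card ≤
      Fintype.card ι := by
  classical
  let P : F[X] := ∑ i, C (s i) * ∏ l ∈ Finset.univ.erase i, (X + C (h l))
  have hev : ∀ y, P.eval y = ∑ i, s i * ∏ l ∈ Finset.univ.erase i, (y + h l) := by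
    intro y
    simp [P, eval_finsetSum, eval_prod]
  have hP : P ≠ 0 := by
    intro h0
    have h1 := hev (-h j)
    rw [h0, eval_zero, Finset.sum_eq_single j] at h1
    · refine mul_ne_zero hs (Finset.prod_ne_zero_iff.2 fun l hl h2 => ?_) h1.symm
      exact hj l (Finset.ne_of_mem_erase hl) (neg_add_eq_zero.1 h2).symm
    · intro i _ hi
      rw [Finset.prod_eq_zero (Finset.mem_erase.2 ⟨hi.symm, Finset.mem_univ j⟩)
        (neg_add_cancel _), mul_zero]
    · simp
  have hdeg : P.natDegree ≤ Fintype.card ι := by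
    refine natDegree_sum_le_of_forall_le _ _ fun i _ => (natDegree_C_mul_le _ _).trans ?_
    rw [natDegree_prod_of_monic _ _ fun l _ => monic_X_add_C _]
    simp only [natDegree_X_add_C, Finset.sum_const, smul_eq_mul, mul_one]
    exact (Finset.card_le_card (Finset.erase_subset _ _)).trans_eq Finset.card_univ
  refine le_trans (Finset.card_le_card ?_) ((P.roots.toFinset_card_le.trans (card_roots' P)).trans
    hdeg)
  intro y hy
  obtain ⟨-, hy1, hy2⟩ := Finset.mem_filter.1 hy
  rw [Multiset.mem_toFinset, mem_roots hP, IsRoot.def, hev]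
  have : ∀ i, s i * ∏ l ∈ Finset.univ.erase i, (y + h l) =
      (s i * (y + h i)⁻¹) * ∏ l, (y + h l) := by
    intro i
    rw [← Finset.mul_prod_erase _ _ (Finset.mem_univ i), mul_assoc, inv_mul_cancel_left₀ (hy1 i)]
  rw [Finset.sum_congr rfl fun i _ => this i, ← Finset.sum_mul, hy2, zero_mul]

theorem ZMod.sum_eq_sum_range {M : Type*} [AddCommMonoid M] (q : ℕ) [NeZero q] (f : ZMod q → M) :
    ∑ x, f x = ∑ i ∈ Finset.range q, f i := by
  symm
  refine Finset.sum_bij (fun i _ => (i : ZMod q)) (fun _ _ => Finset.mem_univ _) ?_ ?_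
    fun _ _ => rfl
  · intro i hi i' hi' h
    have := congrArg ZMod.val h
    rwa [ZMod.val_cast_of_lt (Finset.mem_range.1 hi),
      ZMod.val_cast_of_lt (Finset.mem_range.1 hi')] at this
  · intro x _
    exact ⟨x.val, Finset.mem_range.2 x.val_lt, ZMod.natCast_zmod_val x⟩

theorem Finset.sum_range_mul_eq {M : Type*} [AddCommMonoid M] (m n : ℕ) (f : ℕ → M) :
    ∑ i ∈ range (m * n), f i = ∑ b ∈ range m, ∑ a ∈ range n, f (b + m * a) := by
  induction n with
  | zero => simp
  | succ n ih =>
    rw [Nat.mul_succ, Finset.sum_range_add, ih, ← Finset.sum_add_distrib]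
    refine Finset.sum_congr rfl fun b _ => ?_
    rw [Finset.sum_range_succ, add_comm b (m * n)]

theorem norm_sum_prod_prime_sq_le {p : ℕ} [Fact p.Prime] {ι : Type*} [Fintype ι]
    (χ : MulChar (ZMod (p ^ 2)) ℂ) (hχ : χ.linearize ≠ 1) (σ : ι → ℂ →+* ℂ)
    (hσ : ∀ i, σ i = RingHom.id ℂ ∨ σ i = starRingEnd ℂ) (h : ι → ℤ) (j : ι)
    (hj : ∀ i ≠ j, (h i : ZMod p) ≠ h j) :
    ‖∑ x : ZMod (p ^ 2), ∏ i, σ i (χ (x + h i))‖ ≤ Fintype.card ι * p := by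
  classical
  have hp : p.Prime := Fact.out
  have : NeZero (p ^ 2) := ⟨pow_ne_zero _ hp.ne_zero⟩
  have hpp : (p : ZMod (p ^ 2)) * p = 0 := by
    rw [← pow_two]
    exact_mod_cast ZMod.natCast_self (p ^ 2)
  set φ := ZMod.castHom (dvd_pow_self p two_ne_zero) (ZMod p)
  let s : ι → ℤ := fun i => if σ i = RingHom.id ℂ then 1 else -1
  have hlin1 : ∀ a, χ.linearize a * χ.linearize (-a) = 1 := by
    intro a
    rw [← AddChar.map_add_eq_mul, add_neg_cancel, AddChar.map_zero_eq_one]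
  have hnorm : ∀ a, ‖χ.linearize a‖ = 1 := by
    intro a
    have h1 : χ.linearize a ^ p = 1 := by
      rw [← AddChar.map_nsmul_eq_pow, MulChar.linearize_apply, nsmul_eq_mul, ← mul_assoc, hpp,
        zero_mul, add_zero, map_one]
    exact Complex.norm_eq_one_of_pow_eq_one h1 hp.ne_zero
  have hσs : ∀ i a, σ i (χ.linearize a) = χ.linearize (s i * a) := by
    intro i a
    simp only [s]
    split_ifs with hi
    · rw [hi]
      simp
    · rw [(hσ i).resolve_left hi]
      push_cast
      rw [neg_one_mul, ← Complex.inv_eq_conj (hnorm a)]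
      exact inv_eq_of_mul_eq_one_right (hlin1 a)
  have hinner : ∀ y : ℕ, ‖∑ w ∈ Finset.range p,
      ∏ i, σ i (χ (((y + p * w : ℕ) : ZMod (p ^ 2)) + h i))‖ ≤
      if (∀ i, (y : ZMod p) + h i ≠ 0) ∧ ∑ i, (s i : ZMod p) * ((y : ZMod p) + h i)⁻¹ = 0 then
        (p : ℝ) else 0 := by
    intro y
    have hφu : ∀ i, φ ((y : ZMod (p ^ 2)) + h i) = y + h i := by
      intro i
      rw [map_add, map_natCast, map_intCast]
    by_cases hu : ∀ i, (y : ZMod p) + h i ≠ 0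
    · have hun : ∀ i, IsUnit ((y : ZMod (p ^ 2)) + h i) := by
        intro i
        by_contra hi
        exact hu i ((hφu i).symm.trans (ZMod.castHom_eq_zero_of_not_isUnit two_ne_zero hi))
      choose u hu' using hun
      set Λ : ZMod (p ^ 2) := ∑ i, (s i : ZMod (p ^ 2)) * (↑(u i)⁻¹ : ZMod (p ^ 2)) with hΛ
      have hφΛ : φ Λ = ∑ i, (s i : ZMod p) * ((y : ZMod p) + h i)⁻¹ := by
        rw [hΛ, map_sum]
        refine Finset.sum_congr rfl fun i _ => ?_
        rw [map_mul, map_intCast]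
        congr 1
        rw [← hφu i, ← hu' i]
        refine eq_inv_of_mul_eq_one_left ?_
        rw [← map_mul, Units.inv_mul, map_one]
      have hterm : ∀ w : ℕ, ∏ i, σ i (χ (((y + p * w : ℕ) : ZMod (p ^ 2)) + h i)) =
          (∏ i, σ i (χ (u i))) * χ.linearize Λ ^ w := by
        intro w
        rw [← AddChar.map_nsmul_eq_pow, hΛ, Finset.smul_sum, AddChar.map_sum_eq_prod_apply,
          ← Finset.prod_mul_distrib]
        refine Finset.prod_congr rfl fun i _ => ?_
        have h2 : w • ((s i : ZMod (p ^ 2)) * (↑(u i)⁻¹ : ZMod (p ^ 2))) =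
            s i * (w * (↑(u i)⁻¹ : ZMod (p ^ 2))) := by
          rw [nsmul_eq_mul]; ring
        rw [h2, ← hσs, ← map_mul, MulChar.linearize_apply, ← map_mul]
        congr 2
        push_cast
        have h3 := hu' i
        have h4 := (u i).mul_inv
        linear_combination -h3 - (p * w : ZMod (p ^ 2)) * h4
      rw [Finset.sum_congr rfl fun w _ => hterm w, ← Finset.mul_sum, norm_mul]
      have hA := χ.norm_ringHom_prod_le_one σ hσ (fun i => (u i : ZMod (p ^ 2)))
      by_cases hθ : χ.linearize Λ = 1
      · rw [if_pos]
        · rw [hθ]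
          simp only [one_pow, Finset.sum_const, Finset.card_range, nsmul_eq_mul, mul_one]
          rw [Complex.norm_natCast]
          exact mul_le_of_le_one_left (Nat.cast_nonneg p) hA
        · refine ⟨hu, ?_⟩
          rw [← hφΛ]
          refine ZMod.castHom_eq_zero_of_not_isUnit two_ne_zero ?_
          rintro ⟨v, hv⟩
          refine hχ (DFunLike.ext _ _ fun z => ?_)
          have h5 : z = (↑v⁻¹ * z : ZMod (p ^ 2)).val • Λ := by
            rw [nsmul_eq_mul, ZMod.natCast_zmod_val, ← hv, mul_comm, Units.mul_inv_cancel_left]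
          rw [h5, AddChar.map_nsmul_eq_pow, hθ, one_pow, AddChar.one_apply]
      · have h6 : ∑ w ∈ Finset.range p, χ.linearize Λ ^ w = 0 := by
          have h1 : χ.linearize Λ ^ p = 1 := by
            rw [← AddChar.map_nsmul_eq_pow, MulChar.linearize_apply, nsmul_eq_mul, ← mul_assoc, hpp,
              zero_mul, add_zero, map_one]
          rw [geom_sum_eq hθ, h1, sub_self, zero_div]
        rw [h6, norm_zero, mul_zero]
        split_ifs
        · exact Nat.cast_nonneg p
        · exact le_rfl
    · rw [if_neg fun hc => hu hc.1]
      push Not at hu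
      obtain ⟨i, hi⟩ := hu
      rw [Finset.sum_eq_zero, norm_zero]
      intro w _
      refine Finset.prod_eq_zero (Finset.mem_univ i) ?_
      rw [χ.map_nonunit, map_zero]
      intro h7
      refine (h7.map φ).ne_zero ?_
      rw [map_add, map_natCast, map_intCast]
      push_cast
      rw [ZMod.natCast_self, zero_mul, add_zero, hi]
  have hcard := card_filter_sum_inv_eq_zero_le (fun i => (s i : ZMod p)) (fun i => (h i : ZMod p)) j
    (by simp only [s]; split_ifs <;> simp) hj
  have hpow : Finset.range (p ^ 2) = Finset.range (p * p) := by rw [pow_two]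
  rw [ZMod.sum_eq_sum_range, hpow, Finset.sum_range_mul_eq]
  refine (norm_sum_le _ _).trans ((Finset.sum_le_sum fun y _ => hinner y).trans ?_)
  rw [← ZMod.sum_eq_sum_range p (fun y => if (∀ i, y + (h i : ZMod p) ≠ 0) ∧
    ∑ i, (s i : ZMod p) * (y + h i)⁻¹ = 0 then (p : ℝ) else 0), ← Finset.sum_filter,
    Finset.sum_const, nsmul_eq_mul]
  gcongr

/-- The component modulo `m` of a character modulo `m * n`. -/
noncomputable def MulChar.leftComponent {m n : ℕ} (hmn : m.Coprime n)
    (χ : MulChar (ZMod (m * n)) ℂ) : MulChar (ZMod m) ℂ where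
  toMonoidHom := (χ.toMonoidHom.comp (ZMod.chineseRemainder hmn).symm.toMonoidHom).comp
    (MonoidHom.inl (ZMod m) (ZMod n))
  map_nonunit' x hx := χ.map_nonunit fun hu => hx (by
    have := (hu.map (ZMod.chineseRemainder hmn)).map (RingHom.fst (ZMod m) (ZMod n))
    simpa using this)

/-- The component modulo `n` of a character modulo `m * n`. -/
noncomputable def MulChar.rightComponent {m n : ℕ} (hmn : m.Coprime n)
    (χ : MulChar (ZMod (m * n)) ℂ) : MulChar (ZMod n) ℂ where
  toMonoidHom := (χ.toMonoidHom.comp (ZMod.chineseRemainder hmn).symm.toMonoidHom).comp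
    (MonoidHom.inr (ZMod m) (ZMod n))
  map_nonunit' x hx := χ.map_nonunit fun hu => hx (by
    have := (hu.map (ZMod.chineseRemainder hmn)).map (RingHom.snd (ZMod m) (ZMod n))
    simpa using this)

theorem MulChar.leftComponent_apply {m n : ℕ} (hmn : m.Coprime n) (χ : MulChar (ZMod (m * n)) ℂ)
    (x : ZMod m) : χ.leftComponent hmn x = χ ((ZMod.chineseRemainder hmn).symm (x, 1)) := rfl

theorem MulChar.rightComponent_apply {m n : ℕ} (hmn : m.Coprime n) (χ : MulChar (ZMod (m * n)) ℂ)
    (x : ZMod n) : χ.rightComponent hmn x = χ ((ZMod.chineseRemainder hmn).symm (1, x)) := rfl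

theorem MulChar.leftComponent_mul_rightComponent {m n : ℕ} (hmn : m.Coprime n)
    (χ : MulChar (ZMod (m * n)) ℂ) (x : ZMod m × ZMod n) :
    χ.leftComponent hmn x.1 * χ.rightComponent hmn x.2 =
      χ ((ZMod.chineseRemainder hmn).symm x) := by
  rw [leftComponent_apply, rightComponent_apply, ← map_mul, ← map_mul]
  simp

theorem MulChar.LocallyPrimitive.leftComponent {m n : ℕ} (hmn : m.Coprime n)
    {χ : MulChar (ZMod (m * n)) ℂ} (hχ : χ.LocallyPrimitive) :
    (χ.leftComponent hmn).LocallyPrimitive := by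
  intro p hp hpm
  obtain ⟨z, hz⟩ := hχ p hp (hpm.mul_right n)
  refine ⟨n * z, ?_⟩
  have : (ZMod.chineseRemainder hmn).symm (1 + (m / p : ℕ) * ((n * z : ℤ) : ZMod m), 1) =
      1 + (m * n / p : ℕ) * z := by
    rw [RingEquiv.symm_apply_eq, Nat.mul_div_right_comm hpm]
    ext <;> simp [mul_assoc]
  rw [leftComponent_apply, this]
  exact hz

theorem MulChar.LocallyPrimitive.rightComponent {m n : ℕ} (hmn : m.Coprime n)
    {χ : MulChar (ZMod (m * n)) ℂ} (hχ : χ.LocallyPrimitive) :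
    (χ.rightComponent hmn).LocallyPrimitive := by
  intro p hp hpn
  obtain ⟨z, hz⟩ := hχ p hp (hpn.mul_left m)
  refine ⟨m * z, ?_⟩
  have : (ZMod.chineseRemainder hmn).symm (1, 1 + (n / p : ℕ) * ((m * z : ℤ) : ZMod n)) =
      1 + (m * n / p : ℕ) * z := by
    rw [RingEquiv.symm_apply_eq, Nat.mul_div_assoc _ hpn]
    ext
    · simp
    · simp
      ring
  rw [rightComponent_apply, this]
  exact hz

theorem sum_prod_leftComponent_mul_sum_prod_rightComponent {m n : ℕ} [NeZero m] [NeZero n]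
    [NeZero (m * n)] (hmn : m.Coprime n) {ι : Type*} [Fintype ι] (χ : MulChar (ZMod (m * n)) ℂ)
    (σ : ι → ℂ →+* ℂ) (h : ι → ℤ) :
    ∑ x : ZMod (m * n), ∏ i, σ i (χ (x + h i)) =
      (∑ x : ZMod m, ∏ i, σ i (χ.leftComponent hmn (x + h i))) *
        ∑ x : ZMod n, ∏ i, σ i (χ.rightComponent hmn (x + h i)) := by
  rw [Fintype.sum_mul_sum, ← Fintype.sum_prod_type', ← Equiv.sum_comp
    (ZMod.chineseRemainder hmn).symm.toEquiv]
  refine Finset.sum_congr rfl fun x _ => ?_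
  rw [← Finset.prod_mul_distrib]
  refine Finset.prod_congr rfl fun i _ => ?_
  rw [← map_mul]
  congr 1
  have := χ.leftComponent_mul_rightComponent hmn (x.1 + h i, x.2 + h i)
  simp only at this
  rw [this]
  congr 1
  have h1 : ((x.1 + h i, x.2 + h i) : ZMod m × ZMod n) = x + (h i : ZMod m × ZMod n) := by
    ext <;> simp
  rw [h1, map_add, map_intCast]
  rfl

theorem card_le_card_divisors_pow {q k : ℕ} (hq : 1 < q) : k ≤ q.divisors.card ^ k := by
  have h2 : 2 ≤ q.divisors.card := by
    rw [Nat.succ_le_iff, Finset.one_lt_card]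
    exact ⟨1, Nat.one_mem_divisors.2 (by omega), q, Nat.mem_divisors_self q (by omega), by omega⟩
  exact (Nat.lt_two_pow_self).le.trans (Nat.pow_le_pow_left h2 k)

open Classical in
theorem one_le_prod_gcd {ι : Type*} [Fintype ι] {q : ℕ} (hq : q ≠ 0) (h : ι → ℤ) (s : Finset ι)
    (j : ι) : 1 ≤ ∏ i ∈ s, Int.gcd q (h i - h j) :=
  Finset.one_le_prod' fun _ _ => Nat.pos_of_ne_zero fun h0 =>
    hq (by exact_mod_cast (Int.gcd_eq_zero_iff.1 h0).1)

open Classical in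
theorem le_prod_gcd_of_dvd {ι : Type*} [Fintype ι] {p q : ℕ} (hq : q ≠ 0) (hpq : p ∣ q)
    (h : ι → ℤ) {i j : ι} (hij : i ≠ j) (hp : (p : ℤ) ∣ h i - h j) :
    p ≤ ∏ i ∈ Finset.univ.erase j, Int.gcd q (h i - h j) := by
  have h1 : 1 ≤ Int.gcd q (h i - h j) := Nat.pos_of_ne_zero fun h0 =>
    hq (by exact_mod_cast (Int.gcd_eq_zero_iff.1 h0).1)
  rw [← Finset.mul_prod_erase _ _ (Finset.mem_erase.2 ⟨hij, Finset.mem_univ i⟩)]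
  have h2 : p ≤ Int.gcd q (h i - h j) := Nat.le_of_dvd h1 (by
    have := Int.dvd_gcd (Int.natCast_dvd_natCast.2 hpq) hp
    exact_mod_cast this)
  exact h2.trans (Nat.le_mul_of_pos_right _ (one_le_prod_gcd hq h _ j))

theorem ZMod.intCast_ne_of_not_dvd_sub {p : ℕ} {a b : ℤ} (h : ¬(p : ℤ) ∣ a - b) :
    (a : ZMod p) ≠ b := by
  intro heq
  refine h ?_
  rw [← ZMod.intCast_zmod_eq_zero_iff_dvd]
  push_cast
  rw [heq, sub_self]

theorem norm_sum_prod_le_of_eq_prime {ι : Type*} [Fintype ι] (σ : ι → ℂ →+* ℂ)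
    (hσ : ∀ i, σ i = RingHom.id ℂ ∨ σ i = starRingEnd ℂ) (h : ι → ℤ) (j : ι) {p q : ℕ}
    (hp : p.Prime) [NeZero q] (hq : q = p) (χ : MulChar (ZMod q) ℂ) (hχ : χ.LocallyPrimitive)
    (hd : ∀ i ≠ j, ¬(p : ℤ) ∣ h i - h j) :
    ‖∑ x : ZMod q, ∏ i, σ i (χ (x + h i))‖ ≤ Fintype.card ι * √q := by
  subst hq
  have : Fact q.Prime := ⟨hp⟩
  obtain ⟨z, hz0, hz1⟩ := hχ q hp dvd_rfl
  have hχ1 : χ ≠ 1 := by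
    rintro rfl
    have hu : IsUnit (1 + ((q / q : ℕ) : ZMod q) * z) := by
      by_contra hc
      exact hz0 (MulChar.map_nonunit _ hc)
    exact hz1 (MulChar.one_apply hu)
  convert norm_sum_prod_prime_le χ hχ1 σ hσ (fun i => (h i : ZMod q)) j
    (fun i hi => ZMod.intCast_ne_of_not_dvd_sub (hd i hi)) using 2

theorem norm_sum_prod_le_of_eq_prime_sq {ι : Type*} [Fintype ι] (σ : ι → ℂ →+* ℂ)
    (hσ : ∀ i, σ i = RingHom.id ℂ ∨ σ i = starRingEnd ℂ) (h : ι → ℤ) (j : ι) {p q : ℕ}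
    (hp : p.Prime) [NeZero q] (hq : q = p ^ 2) (χ : MulChar (ZMod q) ℂ)
    (hχ : χ.LocallyPrimitive) (hd : ∀ i ≠ j, ¬(p : ℤ) ∣ h i - h j) :
    ‖∑ x : ZMod q, ∏ i, σ i (χ (x + h i))‖ ≤ Fintype.card ι * √q := by
  subst hq
  have : Fact p.Prime := ⟨hp⟩
  obtain ⟨z, hz0, hz1⟩ := hχ p hp (dvd_pow_self p two_ne_zero)
  have hsq : √((p ^ 2 : ℕ) : ℝ) = p := by
    push_cast
    exact Real.sqrt_sq (Nat.cast_nonneg p)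
  rw [hsq]
  have hlin : χ.linearize ≠ 1 := by
    intro hc
    have := DFunLike.congr_fun hc (z : ZMod (p ^ 2))
    rw [MulChar.linearize_apply, AddChar.one_apply] at this
    rw [show p ^ 2 / p = p by rw [pow_two, Nat.mul_div_cancel _ hp.pos]] at hz1
    exact hz1 this
  convert norm_sum_prod_prime_sq_le χ hlin σ hσ h j
    (fun i hi => ZMod.intCast_ne_of_not_dvd_sub (hd i hi)) using 2

open Classical in
theorem norm_sum_prod_le_of_eq_prime_pow {ι : Type*} [Fintype ι] (σ : ι → ℂ →+* ℂ)
    (hσ : ∀ i, σ i = RingHom.id ℂ ∨ σ i = starRingEnd ℂ) (h : ι → ℤ) (j : ι) {p q n : ℕ}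
    (hp : p.Prime) (hn : 0 < n) [NeZero q] (hq : q = p ^ n) (hcf : ∀ p : ℕ, p.Prime → ¬p ^ 3 ∣ q)
    (χ : MulChar (ZMod q) ℂ) (hχ : χ.LocallyPrimitive) :
    ‖∑ x : ZMod q, ∏ i, σ i (χ (x + h i))‖ ≤ (q.divisors.card : ℝ) ^ Fintype.card ι * √q *
      (∏ i ∈ Finset.univ.erase j, Int.gcd q (h i - h j) : ℕ) := by
  have hq0 : q ≠ 0 := NeZero.ne q
  have hn2 : n < 3 := by
    by_contra! h3
    exact hcf p hp (hq ▸ pow_dvd_pow p h3)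
  have hpq : p ∣ q := hq ▸ dvd_pow_self p hn.ne'
  have hq1 : 1 < q := hq ▸ Nat.one_lt_pow hn.ne' hp.one_lt
  have hτ : (Fintype.card ι : ℝ) ≤ (q.divisors.card : ℝ) ^ Fintype.card ι := by
    exact_mod_cast card_le_card_divisors_pow hq1
  have hτ1 : (1 : ℝ) ≤ (q.divisors.card : ℝ) ^ Fintype.card ι := by
    have : 1 ≤ Fintype.card ι := Fintype.card_pos_iff.2 ⟨j⟩
    exact le_trans (by exact_mod_cast this) hτ
  have hG1 : (1 : ℝ) ≤ (∏ i ∈ Finset.univ.erase j, Int.gcd q (h i - h j) : ℕ) := by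
    exact_mod_cast one_le_prod_gcd hq0 h _ j
  by_cases hd : ∃ i, i ≠ j ∧ (p : ℤ) ∣ h i - h j
  · obtain ⟨i, hij, hdvd⟩ := hd
    have hG : (p : ℝ) ≤ (∏ i ∈ Finset.univ.erase j, Int.gcd q (h i - h j) : ℕ) := by
      exact_mod_cast le_prod_gcd_of_dvd hq0 hpq h hij hdvd
    have htriv : ‖∑ x : ZMod q, ∏ i, σ i (χ (x + h i))‖ ≤ q := by
      refine (norm_sum_le_of_le _ fun x _ => χ.norm_ringHom_prod_le_one σ hσ _).trans ?_
      simp [ZMod.card]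
    have hsqp : √(q : ℝ) ≤ p := by
      rw [Real.sqrt_le_left (Nat.cast_nonneg p), hq]
      exact_mod_cast Nat.pow_le_pow_right hp.pos (by omega)
    calc _ ≤ (q : ℝ) := htriv
      _ = 1 * √q * √q := by rw [one_mul, Real.mul_self_sqrt (Nat.cast_nonneg _)]
      _ ≤ 1 * √q * p := by gcongr
      _ ≤ _ := by gcongr
  · push Not at hd
    have hs : ‖∑ x : ZMod q, ∏ i, σ i (χ (x + h i))‖ ≤ Fintype.card ι * √q := by
      have hcases : n = 1 ∨ n = 2 := by omega
      rcases hcases with rfl | rfl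
      · exact norm_sum_prod_le_of_eq_prime σ hσ h j hp (hq.trans (pow_one p)) χ hχ hd
      · exact norm_sum_prod_le_of_eq_prime_sq σ hσ h j hp hq χ hχ hd
    calc _ ≤ Fintype.card ι * √q * 1 := by rwa [mul_one]
      _ ≤ _ := by gcongr

open Classical in
/-- The complete sum bound modulo a cubefree number. -/
theorem norm_sum_prod_le_of_locallyPrimitive {ι : Type*} [Fintype ι] (σ : ι → ℂ →+* ℂ)
    (hσ : ∀ i, σ i = RingHom.id ℂ ∨ σ i = starRingEnd ℂ) (h : ι → ℤ) (j : ι) (q : ℕ) :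
    ∀ [NeZero q], (∀ p : ℕ, p.Prime → ¬p ^ 3 ∣ q) → ∀ χ : MulChar (ZMod q) ℂ,
      χ.LocallyPrimitive → ‖∑ x : ZMod q, ∏ i, σ i (χ (x + h i))‖ ≤
        (q.divisors.card : ℝ) ^ Fintype.card ι * √q *
          (∏ i ∈ Finset.univ.erase j, Int.gcd q (h i - h j) : ℕ) := by
  induction q using Nat.recOnPosPrimePosCoprime with
  | zero =>
    intro h0
    exact absurd rfl h0.out
  | one =>
    intro _ _ χ _
    simp only [Nat.divisors_one, Finset.card_singleton, Nat.cast_one, one_pow, Real.sqrt_one,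
      one_mul]
    have h1 : ‖∑ x : ZMod 1, ∏ i, σ i (χ (x + h i))‖ ≤ 1 := by
      rw [Fintype.sum_subsingleton _ (0 : ZMod 1)]
      exact χ.norm_ringHom_prod_le_one σ hσ _
    exact h1.trans (by exact_mod_cast one_le_prod_gcd one_ne_zero h _ j)
  | prime_pow p n hp hn =>
    intro _ hcf χ hχ
    exact norm_sum_prod_le_of_eq_prime_pow σ hσ h j hp hn rfl hcf χ hχ
  | coprime a b ha hb hab iha ihb =>
    intro hne hcf χ hχ
    have : NeZero a := ⟨by omega⟩
    have : NeZero b := ⟨by omega⟩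
    have h1 := iha (fun p hp hd => hcf p hp (hd.mul_right b)) (χ.leftComponent hab)
      (hχ.leftComponent hab)
    have h2 := ihb (fun p hp hd => hcf p hp (hd.mul_left a)) (χ.rightComponent hab)
      (hχ.rightComponent hab)
    rw [sum_prod_leftComponent_mul_sum_prod_rightComponent hab, norm_mul]
    refine (mul_le_mul h1 h2 (norm_nonneg _) (by positivity)).trans_eq ?_
    have hgcd : ∀ i, Int.gcd (a * b : ℕ) (h i - h j) =
        Int.gcd a (h i - h j) * Int.gcd b (h i - h j) := by
      intro i
      rw [Int.gcd_def, Int.gcd_def, Int.gcd_def]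
      simp only [Int.natAbs_natCast]
      rw [Nat.gcd_comm, Nat.Coprime.gcd_mul _ hab, Nat.gcd_comm a, Nat.gcd_comm b]
    rw [hab.card_divisors_mul, Finset.prod_congr rfl fun i _ => hgcd i, Finset.prod_mul_distrib]
    push_cast
    rw [Real.sqrt_mul (Nat.cast_nonneg a)]
    ring

theorem exists_card_divisors_le {η : ℝ} (hη : 0 < η) :
    ∃ C : ℝ, 1 ≤ C ∧ ∀ n : ℕ, n ≠ 0 → (n.divisors.card : ℝ) ≤ C * (n : ℝ) ^ η := by
  have hlog : 0 < η * Real.log 2 := mul_pos hη (Real.log_pos one_lt_two)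
  set D : ℝ := 1 + 1 / (η * Real.log 2) with hD
  have hD1 : 1 ≤ D := by
    rw [hD]
    have : 0 < 1 / (η * Real.log 2) := by positivity
    linarith
  obtain ⟨P, hP⟩ := exists_nat_ge ((2 : ℝ) ^ (1 / η))
  have hsmall : ∀ p v : ℕ, 2 ≤ p → ((v + 1 : ℕ) : ℝ) ≤ D * ((p : ℝ) ^ v) ^ η := by
    intro p v hp
    have h1 : 1 + v * (η * Real.log 2) ≤ ((p : ℝ) ^ v) ^ η := by
      calc 1 + v * (η * Real.log 2) ≤ Real.exp (v * (η * Real.log 2)) := by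
            have := Real.add_one_le_exp (v * (η * Real.log 2))
            linarith
        _ = ((2 : ℝ) ^ v) ^ η := by
            rw [Real.rpow_def_of_pos (by positivity), Real.log_pow]
            ring_nf
        _ ≤ _ := by
            gcongr
            exact_mod_cast hp
    have h2 : ((v + 1 : ℕ) : ℝ) ≤ D * (1 + v * (η * Real.log 2)) := by
      have h3 : D * (1 + v * (η * Real.log 2)) =
          1 + v + v * (η * Real.log 2) + 1 / (η * Real.log 2) := by
        rw [hD]
        field_simp
        ring
      rw [h3]
      push_cast
      have : 0 ≤ v * (η * Real.log 2) := by positivity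
      have : 0 < 1 / (η * Real.log 2) := by positivity
      linarith
    exact h2.trans (by gcongr)
  have hlarge : ∀ p v : ℕ, P ≤ p → ((v + 1 : ℕ) : ℝ) ≤ ((p : ℝ) ^ v) ^ η := by
    intro p v hp
    have h1 : (2 : ℝ) ≤ (p : ℝ) ^ η := by
      calc (2 : ℝ) = ((2 : ℝ) ^ (1 / η)) ^ η := by
            rw [← Real.rpow_mul zero_le_two, one_div_mul_cancel hη.ne', Real.rpow_one]
        _ ≤ _ := by
            gcongr
            exact hP.trans (by exact_mod_cast hp)
    rw [← Real.rpow_natCast, ← Real.rpow_mul (Nat.cast_nonneg _), mul_comm,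
      Real.rpow_mul (Nat.cast_nonneg _), Real.rpow_natCast]
    calc ((v + 1 : ℕ) : ℝ) ≤ 2 ^ v := by exact_mod_cast Nat.lt_two_pow_self
      _ ≤ _ := by gcongr
  refine ⟨D ^ P, one_le_pow₀ hD1, fun n hn => ?_⟩
  have hprod : (n : ℝ) ^ η = ∏ p ∈ n.primeFactors, ((p : ℝ) ^ n.factorization p) ^ η := by
    rw [Real.finsetProd_rpow _ _ fun _ _ => by positivity]
    congr 1
    conv_lhs => rw [← Nat.prod_factorization_pow_eq_self hn]
    rw [Finsupp.prod]
    push_cast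
    rfl
  rw [Nat.card_divisors hn, hprod]
  push_cast
  have hite : ∏ p ∈ n.primeFactors, (if p < P then D else 1) ≤ D ^ P := by
    rw [← Finset.prod_filter, Finset.prod_const]
    refine pow_le_pow_right₀ hD1 ?_
    refine (Finset.card_le_card (t := Finset.range P) fun p hp => ?_).trans
      (Finset.card_range P).le
    exact Finset.mem_range.2 (Finset.mem_filter.1 hp).2
  calc ∏ p ∈ n.primeFactors, ((n.factorization p : ℝ) + 1)
      ≤ ∏ p ∈ n.primeFactors, ((if p < P then D else 1) * ((p : ℝ) ^ n.factorization p) ^ η) := by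
        refine Finset.prod_le_prod (fun _ _ => by positivity) fun p hp => ?_
        split_ifs with h
        · exact_mod_cast hsmall p _ (Nat.prime_of_mem_primeFactors hp).two_le
        · rw [one_mul]
          exact_mod_cast hlarge p _ (not_lt.1 h)
    _ = (∏ p ∈ n.primeFactors, (if p < P then D else 1)) *
        ∏ p ∈ n.primeFactors, ((p : ℝ) ^ n.factorization p) ^ η := Finset.prod_mul_distrib
    _ ≤ _ := by gcongr

theorem Nat.le_totient_mul_card_divisors {m : ℕ} (hm : m ≠ 0) :
    m ≤ m.totient * m.divisors.card := by
  calc m = ∑ d ∈ m.divisors, d.totient := (Nat.sum_totient m).symm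
    _ ≤ ∑ _d ∈ m.divisors, m.totient := Finset.sum_le_sum fun d hd =>
        Nat.le_of_dvd (Nat.totient_pos.2 (Nat.pos_of_ne_zero hm))
          (Nat.totient_dvd_of_dvd (Nat.dvd_of_mem_divisors hd))
    _ = _ := by rw [Finset.sum_const, smul_eq_mul, mul_comm]

theorem Nat.sum_Icc_filter_dvd_eq {M : Type*} [AddCommMonoid M] (N : ℕ) {d : ℕ} (hd : 0 < d)
    (f : ℕ → M) :
    ∑ n ∈ Finset.Icc 1 N with d ∣ n, f n = ∑ k ∈ Finset.Icc 1 (N / d), f (d * k) := by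
  symm
  refine Finset.sum_bij (fun k _ => d * k) ?_ ?_ ?_ fun _ _ => rfl
  · intro k hk
    rw [Finset.mem_Icc] at hk
    rw [Finset.mem_filter, Finset.mem_Icc]
    exact ⟨⟨Nat.mul_pos hd hk.1, (Nat.mul_le_mul_left d hk.2).trans (Nat.mul_div_le N d)⟩,
      dvd_mul_right d k⟩
  · intro a _ b _ h
    exact Nat.eq_of_mul_eq_mul_left hd h
  · intro n hn
    rw [Finset.mem_filter, Finset.mem_Icc] at hn
    obtain ⟨⟨h1, h2⟩, k, rfl⟩ := hn
    refine ⟨k, ?_, rfl⟩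
    rw [Finset.mem_Icc]
    exact ⟨Nat.pos_of_mul_pos_left h1, (Nat.le_div_iff_mul_le hd).2 (by rwa [mul_comm])⟩

/-- Removing a coprimality condition by Möbius inversion. -/
theorem Nat.sum_Icc_filter_coprime_eq {R : Type*} [CommRing R] (N : ℕ) {m : ℕ} (hm : m ≠ 0)
    (f : ℕ → R) :
    ∑ n ∈ Finset.Icc 1 N with n.Coprime m, f n =
      ∑ d ∈ m.divisors, (ArithmeticFunction.moebius d : R) *
        ∑ k ∈ Finset.Icc 1 (N / d), f (d * k) := by
  have h1 : ∀ n ∈ Finset.Icc 1 N, (if n.Coprime m then f n else 0) =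
      ∑ d ∈ m.divisors, if d ∣ n then (ArithmeticFunction.moebius d : R) * f n else 0 := by
    intro n _
    have hg : n.gcd m ≠ 0 := Nat.gcd_ne_zero_right hm
    have h2 : ∑ d ∈ (n.gcd m).divisors, ArithmeticFunction.moebius d =
        if n.gcd m = 1 then 1 else 0 := by
      rw [← ArithmeticFunction.coe_mul_zeta_apply, ArithmeticFunction.moebius_mul_coe_zeta,
        ArithmeticFunction.one_apply]
    have h3 : (n.gcd m).divisors = m.divisors.filter (· ∣ n) := by
      ext d
      simp only [Nat.mem_divisors, Finset.mem_filter, Nat.dvd_gcd_iff]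
      tauto
    rw [← Finset.sum_filter, ← h3, ← Finset.sum_mul, ← Int.cast_sum, h2]
    by_cases hc : n.Coprime m
    · rw [if_pos hc, if_pos (Nat.coprime_iff_gcd_eq_one.1 hc), Int.cast_one, one_mul]
    · rw [if_neg hc, if_neg fun h => hc (Nat.coprime_iff_gcd_eq_one.2 h), Int.cast_zero, zero_mul]
  rw [Finset.sum_filter, Finset.sum_congr rfl h1, Finset.sum_comm]
  refine Finset.sum_congr rfl fun d hd => ?_
  rw [← Finset.sum_filter, ← Finset.mul_sum,
    Nat.sum_Icc_filter_dvd_eq N (Nat.pos_of_mem_divisors hd)]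

theorem Nat.card_filter_coprime_ge (N : ℕ) {m : ℕ} (hm : m ≠ 0) :
    (N : ℝ) / m.divisors.card - m.divisors.card ≤
      ((Finset.Icc 1 N).filter fun n => n.Coprime m).card := by
  have hm0 : (0 : ℝ) < m := by exact_mod_cast Nat.pos_of_ne_zero hm
  have hτ0 : 0 < m.divisors.card := Finset.card_pos.2 ⟨1, Nat.one_mem_divisors.2 hm⟩
  have h1 := Nat.sum_Icc_filter_coprime_eq (R := ℝ) N hm fun _ => 1
  have h2 := Nat.sum_Icc_filter_coprime_eq (R := ℝ) m hm fun _ => 1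
  simp only [Finset.sum_const, nsmul_eq_mul, mul_one, Nat.card_Icc, add_tsub_cancel_right]
    at h1 h2
  have h3 : ((Finset.Icc 1 m).filter fun n => n.Coprime m).card = m.totient := by
    rw [← Nat.filter_coprime_Ico_eq_totient m 1]
    congr 1
    ext n
    simp only [Finset.mem_filter, Finset.mem_Icc, Finset.mem_Ico, Nat.coprime_comm (m := m)]
    omega
  rw [h3] at h2
  have h4 : (m : ℝ) ≤ m.totient * m.divisors.card := by
    exact_mod_cast Nat.le_totient_mul_card_divisors hm
  have h5 : (N : ℝ) / m.divisors.card ≤ N / m * m.totient := by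
    rw [div_le_iff₀ (by exact_mod_cast hτ0)]
    calc (N : ℝ) = N / m * m := by field_simp
      _ ≤ N / m * (m.totient * m.divisors.card) := by gcongr
      _ = _ := by ring
  have h6 : N / m * (m.totient : ℝ) - m.divisors.card ≤
      ((Finset.Icc 1 N).filter fun n => n.Coprime m).card := by
    rw [h1, h2, Finset.mul_sum, ← nsmul_one m.divisors.card, ← Finset.sum_const,
      ← Finset.sum_sub_distrib]
    refine Finset.sum_le_sum fun d hd => ?_
    have hd0 : (0 : ℝ) < d := by exact_mod_cast Nat.pos_of_mem_divisors hd
    have h7 : ((m / d : ℕ) : ℝ) = m / d := Nat.cast_div (Nat.dvd_of_mem_divisors hd) hd0.ne'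
    have h8 : N / m * (ArithmeticFunction.moebius d * ((m / d : ℕ) : ℝ)) =
        ArithmeticFunction.moebius d * ((N : ℝ) / d) := by
      rw [h7]
      field_simp
    have h9 : |(ArithmeticFunction.moebius d : ℝ)| ≤ 1 := by
      exact_mod_cast ArithmeticFunction.abs_moebius_le_one
    have h10 : ((N / d : ℕ) : ℝ) ≤ N / d := Nat.cast_div_le
    have h11 : (N : ℝ) / d ≤ (N / d : ℕ) + 1 := by
      rw [← Nat.floor_div_eq_div (K := ℝ)]
      exact (Nat.lt_floor_add_one _).le
    rw [h8, sub_le_iff_le_add, ← sub_le_iff_le_add', ← mul_sub]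
    refine (le_abs_self _).trans ?_
    rw [abs_mul]
    refine mul_le_one₀ h9 (abs_nonneg _) ?_
    rw [abs_le]
    constructor <;> linarith
  linarith

/-- A divisor-bounded map into `[1, B]` takes values in a residue class at most `(B / m + 1) F`
times. -/
theorem card_filter_natCast_eq_le {α : Type*} (s : Finset α) (f : α → ℕ) {m B F : ℕ}
    (hm : m ≠ 0) (hf : ∀ x ∈ s, f x ∈ Finset.Icc 1 B)
    (hF : ∀ t ∈ Finset.Icc 1 B, (s.filter fun x => f x = t).card ≤ F) (c : ZMod m) :
    (s.filter fun x => (f x : ZMod m) = c).card ≤ F * (B / m + 1) := by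
  classical
  have : NeZero m := ⟨hm⟩
  refine (Finset.card_le_mul_card_image (f := f) _ F fun t ht => ?_).trans
    (Nat.mul_le_mul_left F ?_)
  · obtain ⟨x, hx, rfl⟩ := Finset.mem_image.1 ht
    refine (Finset.card_le_card fun y hy => ?_).trans
      (hF (f x) (hf x (Finset.mem_filter.1 hx).1))
    rw [Finset.mem_filter, Finset.mem_filter] at hy
    exact Finset.mem_filter.2 ⟨hy.1.1, hy.2⟩
  · refine (Finset.card_le_card_of_injOn (t := Finset.range (B / m + 1)) (fun t => t / m)
      ?_ ?_).trans (Finset.card_range _).le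
    · intro t ht
      obtain ⟨x, hx, rfl⟩ := Finset.mem_image.1 (Finset.mem_coe.1 ht)
      have := Finset.mem_Icc.1 (hf x (Finset.mem_filter.1 hx).1)
      exact Finset.mem_coe.2 (Finset.mem_range.2 (Nat.lt_succ_of_le (Nat.div_le_div_right this.2)))
    · intro t ht u hu htu
      obtain ⟨x, hx, rfl⟩ := Finset.mem_image.1 (Finset.mem_coe.1 ht)
      obtain ⟨y, hy, rfl⟩ := Finset.mem_image.1 (Finset.mem_coe.1 hu)
      have h1 := ((Finset.mem_filter.1 hx).2).trans (Finset.mem_filter.1 hy).2.symm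
      rw [ZMod.natCast_eq_natCast_iff'] at h1
      simp only at htu
      rw [← Nat.div_add_mod (f x) m, ← Nat.div_add_mod (f y) m, h1, htu]

theorem card_piFinset_filter_prod_eq_le {ι : Type*} [Fintype ι] [DecidableEq ι]
    (s : ι → Finset ℕ) {t D : ℕ} (ht : t ≠ 0) (hD : t.divisors.card ≤ D) :
    ((Fintype.piFinset s).filter fun x => ∏ i, x i = t).card ≤ D ^ Fintype.card ι := by
  refine (Finset.card_le_card (t := Fintype.piFinset fun _ => t.divisors) fun x hx => ?_).trans ?_
  · rw [Fintype.mem_piFinset]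
    intro i
    rw [Finset.mem_filter] at hx
    exact Nat.mem_divisors.2 ⟨hx.2 ▸ Finset.dvd_prod_of_mem x (Finset.mem_univ i), ht⟩
  · rw [Fintype.card_piFinset, Finset.prod_const, Finset.card_univ]
    exact Nat.pow_le_pow_left hD _

/-- Products of elements of intervals in a fixed residue class. -/
theorem card_piFinset_filter_natCast_prod_eq_le {ι : Type*} [Fintype ι] [DecidableEq ι]
    (B : ι → ℕ) {m D : ℕ} (hm : m ≠ 0) (hD : ∀ t ∈ Finset.Icc 1 (∏ i, B i), t.divisors.card ≤ D)
    (c : ZMod m) :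
    ((Fintype.piFinset fun i => Finset.Icc 1 (B i)).filter
      fun x : ι → ℕ => ((∏ i, x i : ℕ) : ZMod m) = c).card ≤
        D ^ Fintype.card ι * ((∏ i, B i) / m + 1) := by
  refine card_filter_natCast_eq_le _ (fun x : ι → ℕ => ∏ i, x i) hm (fun x hx => ?_) (fun t ht => ?_) c
  · rw [Fintype.mem_piFinset] at hx
    simp only [Finset.mem_Icc] at hx ⊢
    exact ⟨Finset.one_le_prod' fun i _ => (hx i).1, Finset.prod_le_prod' fun i _ => (hx i).2⟩
  · exact card_piFinset_filter_prod_eq_le _ (by have := (Finset.mem_Icc.1 ht).1; omega) (hD t ht)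

theorem Nat.sum_Icc_gcd_le (q H : ℕ) (hq : q ≠ 0) :
    ∑ k ∈ Finset.Icc 1 H, Nat.gcd q k ≤ H * q.divisors.card := by
  calc ∑ k ∈ Finset.Icc 1 H, Nat.gcd q k
      ≤ ∑ k ∈ Finset.Icc 1 H, ∑ d ∈ q.divisors, if d ∣ k then d else 0 := by
        refine Finset.sum_le_sum fun k _ => ?_
        have hmem : Nat.gcd q k ∈ q.divisors := Nat.mem_divisors.2 ⟨Nat.gcd_dvd_left q k, hq⟩
        refine le_trans ?_ (Finset.single_le_sum (f := fun d => if d ∣ k then d else 0)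
          (fun _ _ => Nat.zero_le _) hmem)
        simp only [if_pos (Nat.gcd_dvd_right q k), le_refl]
    _ = ∑ d ∈ q.divisors, ∑ k ∈ Finset.Icc 1 H, if d ∣ k then d else 0 := Finset.sum_comm
    _ ≤ ∑ _d ∈ q.divisors, H := by
        refine Finset.sum_le_sum fun d hd => ?_
        rw [← Finset.sum_filter, Nat.sum_Icc_filter_dvd_eq H (Nat.pos_of_mem_divisors hd)
          (fun _ => d), Finset.sum_const, Nat.card_Icc, smul_eq_mul, add_tsub_cancel_right]
        exact Nat.div_mul_le_self H d
    _ = _ := by rw [Finset.sum_const, smul_eq_mul, mul_comm]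

theorem Nat.sum_range_gcd_sub_le (q H a : ℕ) (hq : q ≠ 0) (ha : a < H) :
    ∑ b ∈ Finset.range H, (if b = a then 0 else Int.gcd q (b - a)) ≤
      2 * H * q.divisors.card := by
  have hsplit : ∀ b ∈ Finset.range H, (if b = a then 0 else Int.gcd q (b - a)) =
      (if b < a then Nat.gcd q (a - b) else 0) + if a < b then Nat.gcd q (b - a) else 0 := by
    intro b _
    rw [Int.gcd_def, Int.natAbs_natCast]
    rcases lt_trichotomy b a with h | h | h
    · rw [if_neg h.ne, if_pos h, if_neg h.not_gt, add_zero]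
      congr 1
      omega
    · simp [h]
    · rw [if_neg h.ne', if_neg h.not_gt, if_pos h, zero_add]
      congr 1
      omega
  have hone : ∀ (s : Finset ℕ) (g : ℕ → ℕ), (∀ b ∈ s, g b ∈ Finset.Icc 1 H) →
      Set.InjOn g s → ∑ b ∈ s, Nat.gcd q (g b) ≤ H * q.divisors.card := by
    intro s g hg hinj
    rw [← Finset.sum_image (f := fun k => Nat.gcd q k) hinj]
    refine (Finset.sum_le_sum_of_subset ?_).trans (Nat.sum_Icc_gcd_le q H hq)
    exact Finset.image_subset_iff.2 hg
  rw [Finset.sum_congr rfl hsplit, Finset.sum_add_distrib, ← Finset.sum_filter,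
    ← Finset.sum_filter, mul_assoc, two_mul]
  refine add_le_add (hone _ (fun b => a - b) ?_ ?_) (hone _ (fun b => b - a) ?_ ?_)
  · intro b hb
    simp only [Finset.mem_filter, Finset.mem_range, Finset.mem_Icc] at hb ⊢
    omega
  · intro b hb c hc hbc
    simp only [Finset.coe_filter, Finset.mem_range, Set.mem_ofPred_eq] at hb hc hbc
    omega
  · intro b hb
    simp only [Finset.mem_filter, Finset.mem_range, Finset.mem_Icc] at hb ⊢
    omega
  · intro b hb c hc hbc
    simp only [Finset.coe_filter, Finset.mem_range, Set.mem_ofPred_eq] at hb hc hbc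
    omega

open Classical in
/-- Tuples of length `2 r` in which every value is repeated. -/
theorem card_filter_forall_exists_ne_le {ι : Type*} [Fintype ι] {r H : ℕ}
    (hι : Fintype.card ι = 2 * r) (hH : 0 < H) :
    ((Fintype.piFinset fun _ : ι => Finset.range H).filter
      fun g => ∀ j, ∃ i, i ≠ j ∧ g i = g j).card ≤ H ^ r * r ^ (2 * r) := by
  have himg : ∀ g : ι → ℕ, (∀ j, ∃ i, i ≠ j ∧ g i = g j) →
      (Finset.univ.image g).card ≤ r := by
    intro g hg
    have h1 : 2 * (Finset.univ.image g).card ≤ (Finset.univ : Finset ι).card := by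
      refine Finset.mul_card_image_le_card_of_maps_to
        (fun x _ => Finset.mem_image_of_mem g (Finset.mem_univ x)) 2 ?_
      intro b hb
      obtain ⟨j, _, rfl⟩ := Finset.mem_image.1 hb
      obtain ⟨i, hij, hi⟩ := hg j
      rw [Nat.succ_le_iff, Finset.one_lt_card]
      exact ⟨i, by simp [hi], j, by simp, hij⟩
    rw [Finset.card_univ, hι] at h1
    omega
  let T : Finset ((Fin r → ℕ) × (ι → Fin r)) :=
    (Fintype.piFinset fun _ : Fin r => Finset.range H) ×ˢ Finset.univ
  have hT : T.card = H ^ r * r ^ (2 * r) := by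
    simp [T, Finset.card_product, Fintype.card_piFinset, hι]
  rw [← hT]
  refine Finset.card_le_card_of_surjOn (fun ck => ck.1 ∘ ck.2) ?_
  intro g hg
  simp only [Finset.coe_filter, Fintype.mem_piFinset, Set.mem_ofPred_eq] at hg
  obtain ⟨hgH, hgr⟩ := hg
  have hcard : Fintype.card (Finset.univ.image g) ≤ Fintype.card (Fin r) := by
    rw [Fintype.card_coe, Fintype.card_fin]
    exact himg g hgr
  obtain ⟨e⟩ := Function.Embedding.nonempty_of_card_le hcard
  let k : ι → Fin r := fun i => e ⟨g i, Finset.mem_image_of_mem g (Finset.mem_univ i)⟩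
  let c : Fin r → ℕ := Function.extend e Subtype.val fun _ => 0
  refine ⟨(c, k), ?_, ?_⟩
  · simp only [T, Finset.coe_product, Set.mem_prod, Finset.mem_coe, Fintype.mem_piFinset,
      Finset.mem_univ, and_true, Finset.mem_range]
    intro a
    by_cases ha : ∃ x, e x = a
    · obtain ⟨x, rfl⟩ := ha
      simp only [c, e.injective.extend_apply]
      obtain ⟨i, _, hi⟩ := Finset.mem_image.1 x.2
      rw [← hi]
      exact Finset.mem_range.1 (hgH i)
    · simp only [c, Function.extend_apply' _ _ _ ha]
      exact hH
  · funext i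
    simp only [Function.comp_apply, c, k, e.injective.extend_apply]

open Classical in
theorem sum_piFinset_prod_gcd_le {ι : Type*} [Fintype ι] (q H : ℕ) (hq : q ≠ 0) (j : ι) :
    ∑ g ∈ Fintype.piFinset fun _ : ι => Finset.range H,
      (if ∀ i ≠ j, g i ≠ g j then ∏ i ∈ Finset.univ.erase j, Int.gcd q (g i - g j) else 0) ≤
        H * (2 * H * q.divisors.card) ^ (Fintype.card ι - 1) := by
  let w : ℕ → ι → ℕ → ℕ := fun a i b =>
    if i = j then (if b = a then 1 else 0) else if b = a then 0 else Int.gcd q (b - a)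
  have h1 : ∀ g ∈ Fintype.piFinset fun _ : ι => Finset.range H,
      (if ∀ i ≠ j, g i ≠ g j then ∏ i ∈ Finset.univ.erase j, Int.gcd q (g i - g j) else 0) ≤
        ∑ a ∈ Finset.range H, ∏ i, w a i (g i) := by
    intro g hg
    rw [Fintype.mem_piFinset] at hg
    split_ifs with h
    · refine le_trans ?_ (Finset.single_le_sum (f := fun a => ∏ i, w a i (g i))
        (fun _ _ => Nat.zero_le _) (hg j))
      rw [← Finset.mul_prod_erase _ _ (Finset.mem_univ j)]
      simp only [w, if_true, one_mul]
      refine (Finset.prod_congr rfl fun i hi => ?_).le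
      have hij := Finset.ne_of_mem_erase hi
      rw [if_neg hij, if_neg (h i hij)]
    · exact Nat.zero_le _
  refine (Finset.sum_le_sum h1).trans ?_
  rw [Finset.sum_comm]
  have h2 : ∀ a ∈ Finset.range H, ∑ g ∈ Fintype.piFinset fun _ : ι => Finset.range H,
      ∏ i, w a i (g i) ≤ (2 * H * q.divisors.card) ^ (Fintype.card ι - 1) := by
    intro a ha
    rw [← Finset.prod_univ_sum, ← Finset.mul_prod_erase _ _ (Finset.mem_univ j)]
    have h3 : ∑ b ∈ Finset.range H, w a j b = 1 := by
      simp only [w, if_true, Finset.sum_ite_eq', if_pos ha]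
    rw [h3, one_mul, ← Finset.card_univ, ← Finset.card_erase_of_mem (Finset.mem_univ j)]
    refine Finset.prod_le_pow_card _ _ _ fun i hi => ?_
    simp only [w, if_neg (Finset.ne_of_mem_erase hi)]
    exact Nat.sum_range_gcd_sub_le q H a hq (Finset.mem_range.1 ha)
  refine (Finset.sum_le_sum h2).trans ?_
  rw [Finset.sum_const, Finset.card_range, smul_eq_mul]

open Classical in
theorem sum_piFinset_norm_sum_prod_le {q : ℕ} [NeZero q] (hcf : ∀ p : ℕ, p.Prime → ¬p ^ 3 ∣ q)
    {χ : MulChar (ZMod q) ℂ} (hχ : χ.LocallyPrimitive) {ι : Type*} [Fintype ι] (σ : ι → ℂ →+* ℂ)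
    (hσ : ∀ i, σ i = RingHom.id ℂ ∨ σ i = starRingEnd ℂ) {r H : ℕ}
    (hι : Fintype.card ι = 2 * r) (hr : 0 < r) (hH : 0 < H) :
    ∑ g ∈ Fintype.piFinset fun _ : ι => Finset.range H,
      ‖∑ x : ZMod q, ∏ i, σ i (χ (x + (g i : ℤ)))‖ ≤
      (H : ℝ) ^ r * r ^ (2 * r) * q + 2 * r * 2 ^ (2 * r) *
        (q.divisors.card : ℝ) ^ (4 * r) * H ^ (2 * r) * √q := by
  set τ : ℝ := (q.divisors.card : ℝ) with hτ
  set P : Finset (ι → ℕ) := Fintype.piFinset fun _ => Finset.range H with hP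
  let G : ι → (ι → ℕ) → ℕ := fun j g => if ∀ i ≠ j, g i ≠ g j then
    ∏ i ∈ Finset.univ.erase j, Int.gcd q (g i - g j) else 0
  have hF : ∀ g ∈ P, ‖∑ x : ZMod q, ∏ i, σ i (χ (x + (g i : ℤ)))‖ ≤
      (if ∀ j, ∃ i, i ≠ j ∧ g i = g j then (q : ℝ) else 0) +
        τ ^ (2 * r) * √q * ∑ j, (G j g : ℝ) := by
    intro g _
    split_ifs with hg
    · have h1 : ‖∑ x : ZMod q, ∏ i, σ i (χ (x + (g i : ℤ)))‖ ≤ q := by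
        refine (norm_sum_le_of_le _ fun x _ => χ.norm_ringHom_prod_le_one σ hσ _).trans ?_
        simp [ZMod.card]
      have h2 : 0 ≤ τ ^ (2 * r) * √q * ∑ j, (G j g : ℝ) := by positivity
      linarith
    · push Not at hg
      obtain ⟨j, hj⟩ := hg
      rw [zero_add]
      refine (norm_sum_prod_le_of_locallyPrimitive σ hσ (fun i => (g i : ℤ)) j q hcf χ hχ).trans ?_
      rw [hι]
      refine mul_le_mul_of_nonneg_left ?_ (by positivity)
      refine le_trans ?_ (Finset.single_le_sum (f := fun j => (G j g : ℝ))
        (fun _ _ => Nat.cast_nonneg _) (Finset.mem_univ j))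
      simp only [G]
      rw [if_pos hj]
  refine (Finset.sum_le_sum hF).trans ?_
  rw [Finset.sum_add_distrib, ← Finset.sum_filter, Finset.sum_const, nsmul_eq_mul,
    ← Finset.mul_sum, Finset.sum_comm]
  refine add_le_add ?_ ?_
  · refine mul_le_mul_of_nonneg_right ?_ (Nat.cast_nonneg q)
    have := card_filter_forall_exists_ne_le hι hH
    rw [← hP] at this
    exact_mod_cast this
  · have h1 : ∀ j ∈ (Finset.univ : Finset ι), ∑ g ∈ P, (G j g : ℝ) ≤
        H * (2 * H * τ) ^ (2 * r - 1) := by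
      intro j _
      have := sum_piFinset_prod_gcd_le q H (NeZero.ne q) j
      rw [hι, ← hP] at this
      rw [hτ, ← Nat.cast_sum]
      refine (Nat.cast_le.2 this).trans_eq ?_
      push_cast
      rfl
    have hτ1 : 1 ≤ τ := by
      have : 1 ≤ q.divisors.card :=
        Finset.card_pos.2 ⟨1, Nat.one_mem_divisors.2 (NeZero.ne q)⟩
      rw [hτ]
      exact_mod_cast this
    have hH1 : (1 : ℝ) ≤ H := by exact_mod_cast hH
    have h2 : (H : ℝ) * (2 * H * τ) ^ (2 * r - 1) ≤ (2 * H * τ) ^ (2 * r) := by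
      conv_rhs => rw [← Nat.sub_add_cancel (show 1 ≤ 2 * r by omega), pow_succ']
      refine mul_le_mul_of_nonneg_right ?_ (by positivity)
      nlinarith
    calc τ ^ (2 * r) * √q * ∑ j, ∑ g ∈ P, (G j g : ℝ)
        ≤ τ ^ (2 * r) * √q * ∑ _j : ι, (2 * H * τ) ^ (2 * r) := by
          gcongr with j hj
          exact (h1 j hj).trans h2
      _ = _ := by
          rw [Finset.sum_const, Finset.card_univ, hι, nsmul_eq_mul, mul_pow, mul_pow]
          push_cast
          rw [show 4 * r = 2 * r + 2 * r by ring, pow_add]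
          ring

/-- The even moments of short character sums. -/
theorem sum_norm_sum_pow_le {q : ℕ} [NeZero q] (hcf : ∀ p : ℕ, p.Prime → ¬p ^ 3 ∣ q)
    {χ : MulChar (ZMod q) ℂ} (hχ : χ.LocallyPrimitive) {r H : ℕ} (hr : 0 < r) (hH : 0 < H) :
    ∑ x : ZMod q, ‖∑ h ∈ Finset.range H, χ (x + h)‖ ^ (2 * r) ≤
      (H : ℝ) ^ r * r ^ (2 * r) * q + 2 * r * 2 ^ (2 * r) *
        (q.divisors.card : ℝ) ^ (4 * r) * H ^ (2 * r) * √q := by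
  classical
  let σ : Fin r ⊕ Fin r → ℂ →+* ℂ := Sum.elim (fun _ => RingHom.id ℂ) fun _ => starRingEnd ℂ
  have hσ : ∀ i, σ i = RingHom.id ℂ ∨ σ i = starRingEnd ℂ := by
    rintro (i | i)
    · exact Or.inl rfl
    · exact Or.inr rfl
  have hexp : ((∑ x : ZMod q, ‖∑ h ∈ Finset.range H, χ (x + h)‖ ^ (2 * r) : ℝ) : ℂ) =
      ∑ g ∈ Fintype.piFinset fun _ : Fin r ⊕ Fin r => Finset.range H,
        ∑ x : ZMod q, ∏ i, σ i (χ (x + (g i : ℤ))) := by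
    rw [Finset.sum_comm]
    push_cast
    refine Finset.sum_congr rfl fun x _ => ?_
    have := Finset.prod_univ_sum (fun _ : Fin r ⊕ Fin r => Finset.range H)
      fun i b => σ i (χ (x + ((b : ℤ) : ZMod q)))
    push_cast at this
    rw [← this]
    simp only [← map_sum]
    rw [Fintype.prod_sum_type]
    simp only [σ, Sum.elim_inl, Sum.elim_inr, Finset.prod_const, Finset.card_univ,
      Fintype.card_fin, RingHom.id_apply]
    rw [← mul_pow, Complex.mul_conj', pow_mul]
  refine le_trans ?_ (sum_piFinset_norm_sum_prod_le hcf hχ σ hσ (by simp [two_mul]) hr hH)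
  refine le_trans (le_of_eq ?_) (norm_sum_le _ _)
  have h0 : 0 ≤ ∑ x : ZMod q, ‖∑ h ∈ Finset.range H, χ (x + h)‖ ^ (2 * r) := by positivity
  rw [← Real.norm_of_nonneg h0, ← Complex.norm_real, hexp]
  congr!

theorem sum_comp_pow_le {α β : Type*} [Fintype β] [DecidableEq β] (s : Finset α) (y : α → β) (T : β → ℝ)
    (hT : ∀ x, 0 ≤ T x) {r : ℕ} (hr : 0 < r) {W : ℝ}
    (hW : (((s ×ˢ s).filter fun p => y p.1 = y p.2).card : ℝ) ≤ W) :
    (∑ a ∈ s, T (y a)) ^ (2 * r) ≤ (s.card : ℝ) ^ (2 * r - 2) * W * ∑ x, T x ^ (2 * r) := by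
  have h1 : (∑ a ∈ s, T (y a)) ^ r ≤ (s.card : ℝ) ^ (r - 1) * ∑ a ∈ s, T (y a) ^ r := by
    obtain ⟨k, rfl⟩ := Nat.exists_eq_add_of_lt hr
    rw [zero_add, Nat.add_sub_cancel]
    rcases s.eq_empty_or_nonempty with rfl | hs
    · simp
    · have := pow_sum_div_card_le_sum_pow (s := s) (f := fun a => T (y a)) (fun a _ => hT _) k
      have hc : (0 : ℝ) < (s.card : ℝ) ^ k := by
        have := hs.card_pos
        positivity
      rwa [div_le_iff₀' hc] at this
  let v : β → ℝ := fun x => (s.filter fun a => y a = x).card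
  have h2 : ∑ a ∈ s, T (y a) ^ r = ∑ x, v x * T x ^ r := by
    rw [← Finset.sum_fiberwise s y]
    refine Finset.sum_congr rfl fun x _ => ?_
    rw [Finset.sum_congr rfl (g := fun _ => T x ^ r) fun a ha => by
      rw [(Finset.mem_filter.1 ha).2], Finset.sum_const, nsmul_eq_mul]
  have h3 : ∑ x, v x ^ 2 ≤ W := by
    refine le_trans (le_of_eq ?_) hW
    rw [Finset.card_eq_sum_card_fiberwise (f := fun p => y p.1) (t := Finset.univ)
      fun _ _ => Finset.mem_coe.2 (Finset.mem_univ _)]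
    push_cast
    refine Finset.sum_congr rfl fun x _ => ?_
    rw [pow_two, ← Nat.cast_mul, ← Finset.card_product]
    congr 2
    ext p
    simp only [Finset.mem_product, Finset.mem_filter]
    constructor
    · rintro ⟨⟨h1, h2⟩, h3, h4⟩
      exact ⟨⟨⟨h1, h3⟩, h2.trans h4.symm⟩, h2⟩
    · rintro ⟨⟨⟨h1, h3⟩, h5⟩, h2⟩
      exact ⟨⟨h1, h2⟩, h3, h5 ▸ h2⟩
  have h4 : (∑ a ∈ s, T (y a) ^ r) ^ 2 ≤ W * ∑ x, T x ^ (2 * r) := by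
    rw [h2]
    refine (Finset.sum_mul_sq_le_sq_mul_sq _ _ _).trans ?_
    simp only [← pow_mul, mul_comm r 2]
    exact mul_le_mul_of_nonneg_right h3 (Finset.sum_nonneg fun x _ => pow_nonneg (hT x) _)
  have h0 : 0 ≤ ∑ a ∈ s, T (y a) := Finset.sum_nonneg fun a _ => hT _
  calc (∑ a ∈ s, T (y a)) ^ (2 * r) = ((∑ a ∈ s, T (y a)) ^ r) ^ 2 := by
        rw [← pow_mul, mul_comm]
    _ ≤ ((s.card : ℝ) ^ (r - 1) * ∑ a ∈ s, T (y a) ^ r) ^ 2 := by gcongr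
    _ = (s.card : ℝ) ^ (2 * r - 2) * (∑ a ∈ s, T (y a) ^ r) ^ 2 := by
        rw [mul_pow, ← pow_mul, show (r - 1) * 2 = 2 * r - 2 by omega]
    _ ≤ (s.card : ℝ) ^ (2 * r - 2) * (W * ∑ x, T x ^ (2 * r)) := by gcongr
    _ = _ := by ring

theorem norm_sum_Icc_sub_sum_shift_le (f : ℕ → ℂ) (hf : ∀ n, ‖f n‖ ≤ 1) (N k : ℕ) :
    ‖∑ n ∈ Finset.Icc 1 N, f n - ∑ n ∈ Finset.Icc 1 N, f (n + k)‖ ≤ 2 * k := by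
  induction k with
  | zero => simp
  | succ k ih =>
    have h1 : ∑ n ∈ Finset.Icc 1 N, f (n + k) - ∑ n ∈ Finset.Icc 1 N, f (n + (k + 1)) =
        f (1 + k) - f (N + 1 + k) := by
      clear ih
      induction N with
      | zero => simp
      | succ N ihN =>
        rw [Finset.sum_Icc_succ_top (by omega), Finset.sum_Icc_succ_top (by omega),
          add_sub_add_comm, ihN, show N + 1 + (k + 1) = N + 1 + 1 + k by ring]
        ring
    have h2 : ‖f (1 + k) - f (N + 1 + k)‖ ≤ 2 := by
      refine (norm_sub_le _ _).trans ?_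
      linarith [hf (1 + k), hf (N + 1 + k)]
    rw [← h1] at h2
    refine (norm_sub_le_norm_sub_add_norm_sub _ (∑ n ∈ Finset.Icc 1 N, f (n + k)) _).trans ?_
    push_cast
    linarith

theorem card_filter_inv_mul_eq_le {q A N D : ℕ} [NeZero q]
    (hD : ∀ t ∈ Finset.Icc 1 (A * N), t.divisors.card ≤ D) :
    let s := ((Finset.Icc 1 A).filter fun a => a.Coprime q) ×ˢ Finset.Icc 1 N
    ((s ×ˢ s).filter fun p => (p.1.1 : ZMod q)⁻¹ * p.1.2 = (p.2.1 : ZMod q)⁻¹ * p.2.2).card ≤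
      s.card * (D * (A * N / q + 1)) := by
  intro s
  have hs : ∀ u ∈ s, (1 ≤ u.1 ∧ u.1 ≤ A) ∧ u.1.Coprime q ∧ 1 ≤ u.2 ∧ u.2 ≤ N := by
    intro u hu
    simpa [s, and_assoc] using hu
  have hfib : ∀ c : ZMod q, (s.filter fun u => ((u.1 * u.2 : ℕ) : ZMod q) = c).card ≤
      D * (A * N / q + 1) := by
    intro c
    refine card_filter_natCast_eq_le s (fun u => u.1 * u.2) (NeZero.ne q) (fun u hu => ?_)
      (fun t ht => ?_) c
    · obtain ⟨⟨h1, h2⟩, -, h3, h4⟩ := hs u hu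
      exact Finset.mem_Icc.2 ⟨Nat.mul_pos h1 h3, Nat.mul_le_mul h2 h4⟩
    · refine le_trans ?_ (hD t ht)
      have ht1 := (Finset.mem_Icc.1 ht).1
      refine Finset.card_le_card_of_injOn (fun u => u.1) ?_ ?_
      · intro u hu
        have h1 := (Finset.mem_filter.1 hu).2
        exact Finset.mem_coe.2 (Nat.mem_divisors.2 ⟨⟨u.2, h1.symm⟩, by omega⟩)
      · intro u hu w hw huw
        have h1 := (Finset.mem_filter.1 hu).2
        have h2 := (Finset.mem_filter.1 hw).2
        have h3 := (hs u (Finset.mem_filter.1 hu).1).1.1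
        simp only at huw h1 h2
        refine Prod.ext huw (Nat.eq_of_mul_eq_mul_left h3 ?_)
        rw [h1, huw, h2]
  calc _ ≤ ((s ×ˢ s).filter fun p =>
        ((p.2.1 * p.2.2 : ℕ) : ZMod q) = ((p.1.1 * p.1.2 : ℕ) : ZMod q)).card := by
        refine Finset.card_le_card_of_injOn (fun p => ((p.2.1, p.1.2), (p.1.1, p.2.2))) ?_ ?_
        · rintro ⟨⟨a, n⟩, ⟨a', n'⟩⟩ hp
          simp only [Finset.coe_filter, Finset.mem_product, Set.mem_ofPred_eq] at hp ⊢
          obtain ⟨⟨hp1, hp2⟩, hp3⟩ := hp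
          have ha := hs _ hp1
          have ha' := hs _ hp2
          refine ⟨⟨?_, ?_⟩, ?_⟩
          · simp only [s, Finset.mem_product] at hp1 hp2 ⊢
            exact ⟨hp2.1, hp1.2⟩
          · simp only [s, Finset.mem_product] at hp1 hp2 ⊢
            exact ⟨hp1.1, hp2.2⟩
          · have e1 := ZMod.coe_mul_inv_eq_one a ha.2.1
            have e2 := ZMod.coe_mul_inv_eq_one a' ha'.2.1
            push_cast
            linear_combination (-(a : ZMod q) * a') * hp3 + (a' * n : ZMod q) * e1 -
              (a * n' : ZMod q) * e2
        · rintro ⟨⟨a, n⟩, ⟨a', n'⟩⟩ _ ⟨⟨b, k⟩, ⟨b', k'⟩⟩ _ h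
          simp only [Prod.mk.injEq] at h ⊢
          tauto
    _ = ∑ u ∈ s, (s.filter fun w =>
          ((w.1 * w.2 : ℕ) : ZMod q) = ((u.1 * u.2 : ℕ) : ZMod q)).card := by
        simp only [Finset.card_filter, Finset.sum_product]
    _ ≤ ∑ _u ∈ s, D * (A * N / q + 1) := Finset.sum_le_sum fun u _ => hfib _
    _ = _ := by rw [Finset.sum_const, smul_eq_mul]

/-- The Burgess amplification. -/
theorem exists_card_mul_norm_sum_le {q : ℕ} [NeZero q] (hcf : ∀ p : ℕ, p.Prime → ¬p ^ 3 ∣ q)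
    {χ : MulChar (ZMod q) ℂ} (hχ : χ.LocallyPrimitive) {r H A N D : ℕ} (hr : 0 < r) (hH : 0 < H)
    (hD : ∀ t ∈ Finset.Icc 1 (A * N), t.divisors.card ≤ D) :
    let c : ℝ := ((Finset.Icc 1 A).filter fun a => a.Coprime q).card
    ∃ U : ℝ, 0 ≤ U ∧ c * H * ‖∑ n ∈ Finset.Icc 1 N, χ n‖ ≤ U + c * H * (2 * A * H) ∧
      U ^ (2 * r) ≤ (c * N) ^ (2 * r - 1) * (D * ((A * N : ℝ) / q + 1)) *
        ((H : ℝ) ^ r * r ^ (2 * r) * q + 2 * r * 2 ^ (2 * r) *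
          (q.divisors.card : ℝ) ^ (4 * r) * H ^ (2 * r) * √q) := by
  intro c
  set 𝒜 := (Finset.Icc 1 A).filter fun a => a.Coprime q with h𝒜
  set S := ∑ n ∈ Finset.Icc 1 N, χ n with hS
  let T : ZMod q → ℝ := fun x => ‖∑ h ∈ Finset.range H, χ (x + h)‖
  let y : ℕ × ℕ → ZMod q := fun u => (u.1 : ZMod q)⁻¹ * u.2
  refine ⟨∑ u ∈ 𝒜 ×ˢ Finset.Icc 1 N, T (y u), Finset.sum_nonneg fun _ _ => norm_nonneg _, ?_, ?_⟩
  · have h1 : ∑ a ∈ 𝒜, ∑ h ∈ Finset.range H, ∑ n ∈ Finset.Icc 1 N, χ ((n + a * h : ℕ) : ZMod q) =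
        ∑ u ∈ 𝒜 ×ˢ Finset.Icc 1 N, χ u.1 * ∑ h ∈ Finset.range H, χ (y u + h) := by
      rw [Finset.sum_product]
      refine Finset.sum_congr rfl fun a ha => ?_
      rw [Finset.sum_comm]
      refine Finset.sum_congr rfl fun n _ => ?_
      rw [Finset.mul_sum]
      refine Finset.sum_congr rfl fun h _ => ?_
      rw [← map_mul]
      congr 1
      have e1 := ZMod.coe_mul_inv_eq_one a (Finset.mem_filter.1 ha).2
      simp only [y]
      push_cast
      linear_combination (-(n : ZMod q)) * e1
    have h2 : ‖∑ u ∈ 𝒜 ×ˢ Finset.Icc 1 N, χ u.1 * ∑ h ∈ Finset.range H, χ (y u + h)‖ ≤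
        ∑ u ∈ 𝒜 ×ˢ Finset.Icc 1 N, T (y u) := by
      refine norm_sum_le_of_le _ fun u _ => ?_
      rw [norm_mul]
      exact mul_le_of_le_one_left (norm_nonneg _) (χ.norm_le_one_of_finite _)
    have h3 : ‖∑ a ∈ 𝒜, ∑ _h ∈ Finset.range H, S - ∑ a ∈ 𝒜, ∑ h ∈ Finset.range H,
        ∑ n ∈ Finset.Icc 1 N, χ ((n + a * h : ℕ) : ZMod q)‖ ≤ c * H * (2 * A * H) := by
      rw [← Finset.sum_sub_distrib]
      have h4 : ∀ a ∈ 𝒜, ‖∑ _h ∈ Finset.range H, S - ∑ h ∈ Finset.range H,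
          ∑ n ∈ Finset.Icc 1 N, χ ((n + a * h : ℕ) : ZMod q)‖ ≤ H * (2 * A * H) := by
        intro a ha
        rw [← Finset.sum_sub_distrib]
        have h5 : ∀ h ∈ Finset.range H, ‖S - ∑ n ∈ Finset.Icc 1 N,
            χ ((n + a * h : ℕ) : ZMod q)‖ ≤ 2 * A * H := by
          intro h hh
          refine (norm_sum_Icc_sub_sum_shift_le (fun n => χ (n : ZMod q))
            (fun n => χ.norm_le_one_of_finite _) N (a * h)).trans ?_
          have e1 : a ≤ A := (Finset.mem_Icc.1 (Finset.mem_filter.1 ha).1).2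
          have e2 : h ≤ H := (Finset.mem_range.1 hh).le
          rw [mul_assoc]
          have : a * h ≤ A * H := Nat.mul_le_mul e1 e2
          have : ((a * h : ℕ) : ℝ) ≤ A * H := by exact_mod_cast this
          linarith
        refine (norm_sum_le_of_le _ h5).trans ?_
        rw [Finset.sum_const, Finset.card_range, nsmul_eq_mul]
      refine (norm_sum_le_of_le _ h4).trans ?_
      rw [Finset.sum_const, nsmul_eq_mul]
      exact (mul_assoc c _ _).symm.le
    have h6 : ∑ a ∈ 𝒜, ∑ _h ∈ Finset.range H, S = (c * H : ℝ) * S := by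
      simp only [Finset.sum_const, Finset.card_range, nsmul_eq_mul, c]
      push_cast
      ring
    have h7 : c * H * ‖S‖ = ‖((c * H : ℝ) : ℂ) * S‖ := by
      rw [norm_mul, Complex.norm_real, Real.norm_of_nonneg (by positivity)]
    rw [h7, ← h6]
    rw [h1] at h3
    have := norm_le_norm_add_norm_sub' (∑ a ∈ 𝒜, ∑ _h ∈ Finset.range H, S)
      (∑ u ∈ 𝒜 ×ˢ Finset.Icc 1 N, χ u.1 * ∑ h ∈ Finset.range H, χ (y u + h))
    linarith
  · have hM := sum_norm_sum_pow_le hcf hχ hr hH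
    generalize (H : ℝ) ^ r * r ^ (2 * r) * q + 2 * r * 2 ^ (2 * r) *
      (q.divisors.card : ℝ) ^ (4 * r) * H ^ (2 * r) * √q = M at hM ⊢
    have hpair := card_filter_inv_mul_eq_le (q := q) hD
    simp only at hpair
    have hc : ((𝒜 ×ˢ Finset.Icc 1 N).card : ℝ) = c * N := by
      rw [Finset.card_product, Nat.card_Icc, Nat.add_sub_cancel]
      push_cast
      rfl
    have hW : ((((𝒜 ×ˢ Finset.Icc 1 N) ×ˢ (𝒜 ×ˢ Finset.Icc 1 N)).filter
        fun p => y p.1 = y p.2).card : ℝ) ≤ c * N * (D * ((A * N : ℝ) / q + 1)) := by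
      rw [← hc]
      refine (Nat.cast_le.2 hpair).trans ?_
      push_cast
      gcongr
      refine Nat.cast_div_le.trans_eq ?_
      push_cast
      rfl
    refine (sum_comp_pow_le _ y T (fun _ => norm_nonneg _) hr hW).trans ?_
    rw [hc]
    have h8 : (c * N) ^ (2 * r - 1) = (c * N) ^ (2 * r - 2) * (c * N) := by
      rw [← pow_succ, show 2 * r - 2 + 1 = 2 * r - 1 by omega]
    rw [h8, mul_assoc (_ ^ (2 * r - 2)) (c * N)]
    have hM' : ∑ x, T x ^ (2 * r) ≤ M := hM
    have hc0 : 0 ≤ c := Nat.cast_nonneg _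
    clear_value c
    exact mul_le_mul_of_nonneg_left hM' (by positivity)

open Filter in
theorem eventually_le_natCast_rpow (C : ℝ) {η : ℝ} (hη : 0 < η) :
    ∀ᶠ q : ℕ in atTop, C ≤ (q : ℝ) ^ η :=
  ((tendsto_rpow_atTop hη).comp tendsto_natCast_atTop_atTop).eventually_ge_atTop C

open Filter in
theorem eventually_card_divisors_le (k : ℕ) {η : ℝ} (hη : 0 < η) :
    ∀ᶠ q : ℕ in atTop, ∀ t : ℕ, t ≠ 0 → t ≤ q ^ k → (t.divisors.card : ℝ) ≤ (q : ℝ) ^ η := by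
  have hη' : 0 < η / (2 * (k + 1)) := by positivity
  obtain ⟨C, hC, hdiv⟩ := exists_card_divisors_le hη'
  filter_upwards [eventually_le_natCast_rpow C (half_pos hη), eventually_ge_atTop 1]
    with q hq hq1 t ht htq
  have hq1' : (1 : ℝ) ≤ q := by exact_mod_cast hq1
  have h1 : (t : ℝ) ^ (η / (2 * (k + 1))) ≤ (q : ℝ) ^ (η / 2) := by
    calc (t : ℝ) ^ (η / (2 * (k + 1))) ≤ ((q : ℝ) ^ k) ^ (η / (2 * (k + 1))) := by
          gcongr
          exact_mod_cast htq
      _ = (q : ℝ) ^ (k * (η / (2 * (k + 1)))) := by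
          rw [← Real.rpow_natCast, ← Real.rpow_mul (by positivity)]
      _ ≤ _ := by
          refine Real.rpow_le_rpow_of_exponent_le hq1' ?_
          have : (k : ℝ) / (k + 1) ≤ 1 := by
            rw [div_le_one (by positivity)]
            linarith
          calc k * (η / (2 * (k + 1))) = η / 2 * (k / (k + 1)) := by field_simp
            _ ≤ η / 2 * 1 := by gcongr
            _ = _ := mul_one _
  calc (t.divisors.card : ℝ) ≤ C * (t : ℝ) ^ (η / (2 * (k + 1))) := hdiv t ht
    _ ≤ (q : ℝ) ^ (η / 2) * (q : ℝ) ^ (η / 2) := by gcongr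
    _ = _ := by rw [← Real.rpow_add (by linarith), add_halves]

theorem norm_sum_le_of_amplification {q : ℕ} [NeZero q] (hcf : ∀ p : ℕ, p.Prime → ¬p ^ 3 ∣ q)
    {χ : MulChar (ZMod q) ℂ} (hχ : χ.LocallyPrimitive) {r H A N D : ℕ} (hr : 0 < r) (hH : 0 < H)
    (hD : ∀ t ∈ Finset.Icc 1 (A * N), t.divisors.card ≤ D) {c E : ℝ} (hE : 0 ≤ E)
    (hc : c = ((Finset.Icc 1 A).filter fun a => a.Coprime q).card) (hc0 : 0 < c)
    (hb : (D * ((A * N : ℝ) / q + 1)) * ((H : ℝ) ^ r * r ^ (2 * r) * q + 2 * r * 2 ^ (2 * r) *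
      (q.divisors.card : ℝ) ^ (4 * r) * H ^ (2 * r) * √q) ≤ c * N * H ^ (2 * r) * E ^ (2 * r)) :
    ‖∑ n ∈ Finset.Icc 1 N, χ n‖ ≤ N * E + 2 * A * H := by
  obtain ⟨U, hU0, hU1, hU2⟩ := exists_card_mul_norm_sum_le hcf hχ hr hH hD
  rw [← hc] at hU1 hU2
  have hH0 : (0 : ℝ) < H := by exact_mod_cast hH
  have hU : U ≤ c * N * H * E := by
    refine le_of_pow_le_pow_left₀ (show 2 * r ≠ 0 by omega) (by positivity) (hU2.trans ?_)
    rw [mul_assoc ((c * N) ^ (2 * r - 1))]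
    calc _ ≤ (c * N) ^ (2 * r - 1) * (c * N * H ^ (2 * r) * E ^ (2 * r)) := by gcongr
      _ = ((c * N) ^ (2 * r - 1) * (c * N)) * H ^ (2 * r) * E ^ (2 * r) := by ring
      _ = _ := by
        rw [← pow_succ, show 2 * r - 1 + 1 = 2 * r by omega, mul_pow _ E, mul_pow _ (H : ℝ)]
  have h1 : c * H * ‖∑ n ∈ Finset.Icc 1 N, χ n‖ ≤ c * H * (N * E + 2 * A * H) := by
    calc _ ≤ U + c * H * (2 * A * H) := hU1
      _ ≤ c * N * H * E + c * H * (2 * A * H) := by gcongr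
      _ = _ := by ring
  exact le_of_mul_le_mul_left h1 (by positivity)

theorem moment_bound_le {q r H τ : ℝ} {k : ℕ} {X L : ℝ} (hX : 0 ≤ X) (hXq : X ^ (2 * k) = q)
    (hH : 0 ≤ H) (hHX : H ≤ X) (hXH : X ≤ 2 * H) (hL : 1 ≤ L) (hτ : 0 ≤ τ) (hτL : τ ≤ L)
    (hr : 0 ≤ r) (hrL : r ^ (2 * k) * 2 ^ (2 * k) + 2 * r * 2 ^ (2 * k) ≤ L) :
    H ^ k * r ^ (2 * k) * q + 2 * r * 2 ^ (2 * k) * τ ^ (4 * k) * H ^ (2 * k) * √q ≤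
      L ^ (4 * k + 1) * H ^ (2 * k) * √q := by
  have hsq : √q = X ^ k := by
    rw [← hXq, mul_comm, pow_mul, Real.sqrt_sq (by positivity)]
  have h1 : H ^ k ≤ √q := by
    rw [hsq]
    gcongr
  have h2 : q ≤ 2 ^ (2 * k) * H ^ (2 * k) := by
    rw [← hXq, ← mul_pow]
    gcongr
  have hq : 0 ≤ q := hXq ▸ pow_nonneg hX _
  have hL4 : (1 : ℝ) ≤ L ^ (4 * k) := one_le_pow₀ hL
  calc H ^ k * r ^ (2 * k) * q + 2 * r * 2 ^ (2 * k) * τ ^ (4 * k) * H ^ (2 * k) * √q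
      ≤ √q * r ^ (2 * k) * (2 ^ (2 * k) * H ^ (2 * k)) * L ^ (4 * k) +
        2 * r * 2 ^ (2 * k) * L ^ (4 * k) * H ^ (2 * k) * √q := by
        refine add_le_add ?_ (by gcongr)
        calc H ^ k * r ^ (2 * k) * q ≤ √q * r ^ (2 * k) * (2 ^ (2 * k) * H ^ (2 * k)) := by
              gcongr
          _ ≤ _ := le_mul_of_one_le_right (by positivity) hL4
    _ = (r ^ (2 * k) * 2 ^ (2 * k) + 2 * r * 2 ^ (2 * k)) * L ^ (4 * k) * H ^ (2 * k) * √q := by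
        ring
    _ ≤ L * L ^ (4 * k) * H ^ (2 * k) * √q := by gcongr
    _ = _ := by rw [pow_succ']

theorem mul_bracket_le {D V M L Q A N c W s E : ℝ} {k : ℕ} (hL : 1 ≤ L)
    (hDL : D ≤ L) (hV : 0 ≤ V) (hVL : V ≤ L * Q * (A * N)) (hN : 0 ≤ N) (hc : 0 ≤ c)
    (hA : A ≤ c * L ^ 2) (hQ : 0 ≤ Q) (hW : 0 ≤ W) (hs : 0 ≤ s) (hM : 0 ≤ M)
    (hML : M ≤ L ^ (4 * k + 1) * W * s) (hE : L ^ (4 * k + 6) * (Q * s) ≤ E) :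
    D * V * M ≤ c * N * W * E := by
  have hL0 : 0 ≤ L := by linarith
  calc D * V * M ≤ L * (L * Q * (A * N)) * (L ^ (4 * k + 1) * W * s) := by
        have : 0 ≤ L * Q * (A * N) := hV.trans hVL
        gcongr
    _ ≤ L * (L * Q * (c * L ^ 2 * N)) * (L ^ (4 * k + 1) * W * s) := by gcongr
    _ = c * N * W * (L ^ (4 * k + 5) * (Q * s)) := by ring
    _ ≤ c * N * W * (L ^ (4 * k + 6) * (Q * s)) := by
        have : L ^ (4 * k + 5) ≤ L ^ (4 * k + 6) := pow_le_pow_right₀ hL (by omega)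
        gcongr
    _ ≤ _ := by gcongr

/-- A real number at least one is within a factor two of its integer part. -/
theorem Nat.le_two_mul_floor {x : ℝ} (hx : 1 ≤ x) : x ≤ 2 * (⌊x⌋₊ : ℝ) := by
  have h1 : 1 ≤ ⌊x⌋₊ := Nat.one_le_floor_iff x |>.2 hx
  have h2 : (1 : ℝ) ≤ ⌊x⌋₊ := by exact_mod_cast h1
  linarith [Nat.lt_floor_add_one x]

set_option maxHeartbeats 1000000 in
open Filter in
/-- Burgess' bound for primitive characters of cubefree modulus. -/
theorem burgess_of_locallyPrimitive_of_le {ε : ℝ} (hε : 0 < ε) (hε4 : ε ≤ 1 / 4) :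
    ∃ δ : ℝ, 0 < δ ∧ ∀ᶠ q : ℕ in atTop, (∀ p : ℕ, p.Prime → ¬p ^ 3 ∣ q) →
      ∀ χ : MulChar (ZMod q) ℂ, χ.LocallyPrimitive → ∀ N : ℕ, (q : ℝ) ^ (1 / 4 + ε) ≤ N →
        N ≤ q ^ 8 → ‖∑ n ∈ Finset.Icc 1 N, χ n‖ ≤ N * (q : ℝ) ^ (-δ) := by
  obtain ⟨r, hr⟩ := exists_nat_ge (1 / ε)
  have hr0' : (0 : ℝ) < r := lt_of_lt_of_le (by positivity) hr
  have hr0 : 0 < r := by exact_mod_cast hr0'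
  have hrε : 1 / (2 * r : ℝ) ≤ ε / 2 := by
    rw [div_le_iff₀ hε] at hr
    rw [div_le_iff₀ (by positivity)]
    linarith
  set δ : ℝ := ε / (4 * r) with hδ
  have hδ0 : 0 < δ := by positivity
  have hδε : δ ≤ ε / 2 := by
    have h1 : (1 : ℝ) ≤ r := by exact_mod_cast hr0
    rw [hδ, div_le_div_iff₀ (by positivity) two_pos]
    nlinarith
  set η : ℝ := ε / (2 * (4 * r + 6)) with hη
  have hη0 : 0 < η := by positivity
  have hη4 : 4 * η ≤ 1 / 4 := by
    have h1 : (1 : ℝ) ≤ r := by exact_mod_cast hr0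
    rw [hη, ← mul_div_assoc, div_le_iff₀ (by positivity)]
    nlinarith
  refine ⟨δ / 2, half_pos hδ0, ?_⟩
  filter_upwards [eventually_card_divisors_le 16 hη0,
    eventually_le_natCast_rpow ((r : ℝ) ^ (2 * r) * 2 ^ (2 * r) + 2 * r * 2 ^ (2 * r)) hη0,
    eventually_le_natCast_rpow 4 hη0, eventually_le_natCast_rpow 3 (half_pos hδ0),
    eventually_ge_atTop 1] with q hτ hLr hL4 hδ3 hq1 hcf χ hχ N hN hNq
  have : NeZero q := ⟨by omega⟩
  have hq1' : (1 : ℝ) ≤ q := by exact_mod_cast hq1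
  have hq0 : (0 : ℝ) < q := by linarith
  set L : ℝ := (q : ℝ) ^ η with hL
  have hL1 : 1 ≤ L := by linarith
  have hL0 : 0 < L := by linarith
  set X : ℝ := (q : ℝ) ^ (1 / (2 * r : ℝ)) with hX
  have hX1 : 1 ≤ X := Real.one_le_rpow hq1' (by positivity)
  have hXq : X ^ (2 * r) = q := by
    rw [hX, ← Real.rpow_natCast, ← Real.rpow_mul hq0.le]
    push_cast
    rw [one_div_mul_cancel (by positivity), Real.rpow_one]
  set H : ℕ := ⌊X⌋₊ with hH
  have hHX : (H : ℝ) ≤ X := Nat.floor_le (by linarith)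
  have hXH : X ≤ 2 * H := Nat.le_two_mul_floor hX1
  have hH1 : 1 ≤ H := Nat.one_le_floor_iff X |>.2 hX1
  have hH1' : (1 : ℝ) ≤ H := by exact_mod_cast hH1
  set E : ℝ := (q : ℝ) ^ (-δ) with hE
  have hE0 : 0 < E := Real.rpow_pos_of_pos hq0 _
  have hE1 : E ≤ 1 := Real.rpow_le_one_of_one_le_of_nonpos hq1' (by linarith)
  have hN0 : (0 : ℝ) < N := lt_of_lt_of_le (Real.rpow_pos_of_pos hq0 _) hN
  set Y : ℝ := N * E / H with hY
  have hYq : (q : ℝ) ^ (1 / 4 : ℝ) ≤ Y := by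
    rw [hY, le_div_iff₀ (by positivity)]
    calc (q : ℝ) ^ (1 / 4 : ℝ) * H ≤ (q : ℝ) ^ (1 / 4 : ℝ) * X := by gcongr
      _ = (q : ℝ) ^ (1 / 4 + 1 / (2 * r : ℝ)) := by rw [hX, ← Real.rpow_add hq0]
      _ ≤ (q : ℝ) ^ (1 / 4 + ε + -δ) :=
        Real.rpow_le_rpow_of_exponent_le hq1' (by linarith)
      _ = (q : ℝ) ^ (1 / 4 + ε) * E := by rw [Real.rpow_add hq0]
      _ ≤ _ := by gcongr
  have hY4 : L ^ 4 ≤ Y := by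
    refine le_trans ?_ hYq
    rw [hL, ← Real.rpow_natCast, ← Real.rpow_mul hq0.le]
    refine Real.rpow_le_rpow_of_exponent_le hq1' ?_
    push_cast
    linarith
  have hY1 : 1 ≤ Y := (one_le_pow₀ hL1).trans hY4
  set A : ℕ := ⌊Y⌋₊ with hA
  have hAY : (A : ℝ) ≤ Y := Nat.floor_le (by linarith)
  have hYA : Y ≤ 2 * A := Nat.le_two_mul_floor hY1
  have hA0 : (0 : ℝ) < A := by linarith
  have hYH : Y * H = N * E := by
    rw [hY]
    field_simp
  have hAN : A ≤ N := by
    have : (A : ℝ) ≤ N := by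
      refine hAY.trans ?_
      rw [hY, div_le_iff₀ (by positivity)]
      exact mul_le_mul_of_nonneg_left (hE1.trans hH1') hN0.le
    exact_mod_cast this
  have hD : ∀ t ∈ Finset.Icc 1 (A * N), t.divisors.card ≤ ⌊L⌋₊ := by
    intro t ht
    rw [Finset.mem_Icc] at ht
    refine Nat.le_floor (hτ t (by omega) (ht.2.trans ?_))
    calc A * N ≤ q ^ 8 * q ^ 8 := Nat.mul_le_mul (hAN.trans hNq) hNq
      _ = q ^ 16 := by ring
  have hDL : (⌊L⌋₊ : ℝ) ≤ L := Nat.floor_le hL0.le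
  have hτq : (q.divisors.card : ℝ) ≤ L := hτ q (by omega) (Nat.le_self_pow (by norm_num) q)
  set c : ℝ := (((Finset.Icc 1 A).filter fun a => a.Coprime q).card : ℝ) with hc
  have hcA : A / L ^ 2 ≤ c := by
    refine le_trans ?_ (Nat.card_filter_coprime_ge A (NeZero.ne q))
    have hτ0 : (0 : ℝ) < q.divisors.card := by
      exact_mod_cast Finset.card_pos.2 ⟨1, Nat.one_mem_divisors.2 (NeZero.ne q)⟩
    have h1 : (A : ℝ) / L - L ≤ A / q.divisors.card - q.divisors.card := by gcongr
    refine le_trans ?_ h1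
    have h2 : L ^ 4 ≤ 2 * A := hY4.trans hYA
    have h3 : (A : ℝ) / L - L - A / L ^ 2 = (A * (L - 1) - L ^ 3) / L ^ 2 := by
      field_simp
      ring
    have h4 : 0 ≤ (A * (L - 1) - L ^ 3) / L ^ 2 := by
      apply div_nonneg _ (by positivity)
      have h5 : 0 ≤ L ^ 3 := by positivity
      nlinarith
    linarith
  have hc0 : 0 < c := lt_of_lt_of_le (by positivity) hcA
  have hANq : (q : ℝ) ^ (1 / 2 + ε) ≤ 2 * (A * N) := by
    calc (q : ℝ) ^ (1 / 2 + ε) ≤ (q : ℝ) ^ (1 / 4 : ℝ) * (q : ℝ) ^ (1 / 4 + ε) := by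
          rw [← Real.rpow_add hq0]
          exact Real.rpow_le_rpow_of_exponent_le hq1' (by linarith)
      _ ≤ 2 * A * N := by gcongr; exact hYq.trans hYA
      _ = _ := by ring
  have hEε : E ^ (2 * r) = (q : ℝ) ^ (-(ε / 2)) := by
    rw [hE, ← Real.rpow_natCast, ← Real.rpow_mul hq0.le]
    congr 1
    rw [hδ]
    push_cast
    field_simp
    norm_num
  have hLε : L ^ (4 * r + 6) = (q : ℝ) ^ (ε / 2) := by
    rw [hL, ← Real.rpow_natCast, ← Real.rpow_mul hq0.le]
    congr 1
    rw [hη]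
    push_cast
    field_simp
  have hsum : (A * N : ℝ) / q + 1 ≤ L * (q : ℝ) ^ (-(1 / 2 + ε)) * (A * N) := by
    have h1 : (A * N : ℝ) / q ≤ (q : ℝ) ^ (-(1 / 2 + ε)) * (A * N) := by
      rw [div_eq_mul_inv, mul_comm, ← Real.rpow_neg_one]
      gcongr
      linarith
    have h2 : 1 ≤ 2 * ((q : ℝ) ^ (-(1 / 2 + ε)) * (A * N)) := by
      rw [Real.rpow_neg hq0.le, mul_left_comm, ← div_eq_inv_mul, one_le_div (by positivity)]
      exact hANq
    have h3 : 0 ≤ (q : ℝ) ^ (-(1 / 2 + ε)) * (A * N) := by positivity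
    nlinarith
  have hM := moment_bound_le (r := (r : ℝ)) (by linarith) hXq (by linarith) hHX hXH hL1
    (Nat.cast_nonneg q.divisors.card) hτq hr0'.le hLr
  have hsqrt : √(q : ℝ) = (q : ℝ) ^ (1 / 2 : ℝ) := Real.sqrt_eq_rpow _
  have hb : (⌊L⌋₊ * ((A * N : ℝ) / q + 1)) * ((H : ℝ) ^ r * r ^ (2 * r) * q +
      2 * r * 2 ^ (2 * r) * (q.divisors.card : ℝ) ^ (4 * r) * H ^ (2 * r) * √q) ≤
        c * N * H ^ (2 * r) * E ^ (2 * r) := by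
    have hcL : (A : ℝ) ≤ c * L ^ 2 := by rwa [div_le_iff₀ (by positivity)] at hcA
    have hV0 : 0 ≤ (A * N : ℝ) / q + 1 := by positivity
    have hQ0 : 0 ≤ (q : ℝ) ^ (-(1 / 2 + ε)) := by positivity
    have hW0 : 0 ≤ (H : ℝ) ^ (2 * r) := by positivity
    have hM0 : 0 ≤ (H : ℝ) ^ r * r ^ (2 * r) * q + 2 * r * 2 ^ (2 * r) *
      (q.divisors.card : ℝ) ^ (4 * r) * H ^ (2 * r) * √q := by positivity
    clear_value A H X Y c L E
    refine mul_bracket_le (k := r) (L := L) (Q := (q : ℝ) ^ (-(1 / 2 + ε))) (A := (A : ℝ))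
      (W := (H : ℝ) ^ (2 * r)) (s := √(q : ℝ)) hL1 hDL hV0 hsum hN0.le hc0.le hcL hQ0
      hW0 (Real.sqrt_nonneg _) hM0 hM (le_of_eq ?_)
    rw [hLε, hsqrt, hEε, ← Real.rpow_add hq0, ← Real.rpow_add hq0]
    ring_nf
  refine (norm_sum_le_of_amplification hcf hχ hr0 hH1 hD hE0.le hc hc0 hb).trans ?_
  have hE3 : 3 * E ≤ (q : ℝ) ^ (-(δ / 2)) := by
    calc 3 * E ≤ (q : ℝ) ^ (δ / 2) * E := by gcongr
      _ = _ := by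
        rw [hE, ← Real.rpow_add hq0]
        ring_nf
  calc N * E + 2 * A * H ≤ N * E + 2 * Y * H := by gcongr
    _ = N * (3 * E) := by linear_combination 2 * hYH
    _ ≤ _ := by gcongr

open DirichletCharacter in
theorem DirichletCharacter.IsPrimitive.locallyPrimitive {q : ℕ} [NeZero q]
    {χ : DirichletCharacter ℂ q} (hχ : χ.IsPrimitive) : MulChar.LocallyPrimitive χ := by
  intro p hp hpq
  have hd : q / p ∣ q := Nat.div_dvd_of_dvd hpq
  have hlt : q / p < q := Nat.div_lt_self (NeZero.pos q) hp.one_lt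
  have hnot : ¬χ.FactorsThrough (q / p) := fun h => by
    have h1 : χ.conductor ≤ q / p := Nat.sInf_le h
    rw [(isPrimitive_def χ).1 hχ] at h1
    omega
  rw [factorsThrough_iff_ker_unitsMap hd, SetLike.not_le_iff_exists] at hnot
  obtain ⟨x, hx, hxχ⟩ := hnot
  rw [MonoidHom.mem_ker] at hx hxχ
  have hx1 : (((x : ZMod q).val : ℤ) : ZMod (q / p)) = (1 : ℤ) := by
    have := congrArg Units.val hx
    rw [ZMod.unitsMap_val, Units.val_one] at this
    rw [Int.cast_natCast, Int.cast_one, ← this, ZMod.natCast_val]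
  obtain ⟨z, hz⟩ := (ZMod.intCast_eq_intCast_iff_dvd_sub _ _ _).1 hx1.symm
  have hxz : (1 + (q / p : ℕ) * z : ZMod q) = x := by
    have h2 : ((x : ZMod q).val : ℤ) = 1 + (q / p : ℕ) * z := by linarith
    have h3 := congrArg (fun t : ℤ => (t : ZMod q)) h2
    simp only [Int.cast_add, Int.cast_one, Int.cast_mul, Int.cast_natCast,
      ZMod.natCast_zmod_val] at h3
    exact h3.symm
  refine ⟨z, ?_, ?_⟩
  · rw [hxz]
    exact (x.isUnit.map χ).ne_zero
  · rw [hxz]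
    intro h
    apply hxχ
    rw [Units.ext_iff, MulChar.coe_toUnitHom, Units.val_one, h]

/-- Sums of a non-trivial Dirichlet character over intervals are bounded by the modulus. -/
theorem DirichletCharacter.norm_sum_Icc_le {q : ℕ} [NeZero q] {χ : DirichletCharacter ℂ q}
    (hχ : χ ≠ 1) (N : ℕ) : ‖∑ n ∈ Finset.Icc 1 N, χ n‖ ≤ q := by
  have hper : ∀ a : ℕ, ∑ i ∈ Finset.range q, χ ((a + i : ℕ) : ZMod q) = 0 := by
    intro a
    rw [← MulChar.sum_eq_zero_of_ne_one hχ, ← Equiv.sum_comp (Equiv.addLeft (a : ZMod q)),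
      ZMod.sum_eq_sum_range]
    refine Finset.sum_congr rfl fun i _ => ?_
    simp
  have hmul : ∀ k a : ℕ, ∑ i ∈ Finset.range (q * k), χ ((a + i : ℕ) : ZMod q) = 0 := by
    intro k a
    induction k with
    | zero => simp
    | succ k ih =>
      rw [Nat.mul_succ, Finset.sum_range_add, ih, zero_add, ← hper (a + q * k)]
      simp only [add_assoc]
  have h1 : ∑ n ∈ Finset.Icc 1 N, χ n = ∑ i ∈ Finset.range N, χ ((1 + i : ℕ) : ZMod q) := by
    rw [← Finset.Ico_add_one_right_eq_Icc, Finset.sum_Ico_eq_sum_range, Nat.add_sub_cancel]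
  rw [h1, ← Nat.div_add_mod N q, Finset.sum_range_add, hmul, zero_add]
  calc _ ≤ ∑ i ∈ Finset.range (N % q), ‖χ ((1 + (q * (N / q) + i) : ℕ) : ZMod q)‖ :=
        norm_sum_le _ _
    _ ≤ ∑ i ∈ Finset.range (N % q), 1 :=
        Finset.sum_le_sum fun _ _ => MulChar.norm_le_one_of_finite χ _
    _ ≤ q := by
        rw [Finset.sum_const, Finset.card_range, nsmul_one]
        exact_mod_cast (Nat.mod_lt _ (NeZero.pos q)).le

theorem MulChar.norm_sum_Icc_le_self {q : ℕ} [NeZero q] (χ : MulChar (ZMod q) ℂ) (N : ℕ) :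
    ‖∑ n ∈ Finset.Icc 1 N, χ n‖ ≤ N := by
  calc _ ≤ ∑ n ∈ Finset.Icc 1 N, ‖χ n‖ := norm_sum_le _ _
    _ ≤ ∑ n ∈ Finset.Icc 1 N, 1 :=
        Finset.sum_le_sum fun _ _ => MulChar.norm_le_one_of_finite χ _
    _ = N := by simp

open DirichletCharacter in
theorem DirichletCharacter.sum_Icc_eq_sum_divisors {m : ℕ} [NeZero m]
    (χ : DirichletCharacter ℂ m) (N : ℕ) :
    ∑ n ∈ Finset.Icc 1 N, χ n = ∑ d ∈ m.divisors, (ArithmeticFunction.moebius d : ℂ) *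
      (χ.primitiveCharacter d * ∑ k ∈ Finset.Icc 1 (N / d), χ.primitiveCharacter k) := by
  have h := Nat.sum_Icc_filter_coprime_eq N (NeZero.ne m)
    (fun n => χ.primitiveCharacter (n : ZMod χ.conductor))
  simp only [Nat.cast_mul, map_mul, ← Finset.mul_sum] at h
  rw [← h, Finset.sum_filter]
  refine Finset.sum_congr rfl fun n _ => ?_
  split_ifs with hn
  · have := χ.primitiveCharacter_apply_of_isCoprime (Nat.isCoprime_iff_coprime.2 hn)
    simpa using this.symm
  · exact χ.map_nonunit fun hu => hn ((ZMod.isUnit_iff_coprime n m).1 hu)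

theorem DirichletCharacter.norm_sum_Icc_le_of_forall_dvd {m : ℕ} [NeZero m]
    {χ : DirichletCharacter ℂ m} {N : ℕ} {B : ℝ}
    (hB : ∀ d, d ∣ m → ‖∑ k ∈ Finset.Icc 1 (N / d), χ.primitiveCharacter k‖ ≤ B) :
    ‖∑ n ∈ Finset.Icc 1 N, χ n‖ ≤ m.divisors.card * B := by
  have : NeZero χ.conductor := ⟨χ.conductor_ne_zero⟩
  rw [χ.sum_Icc_eq_sum_divisors]
  refine (norm_sum_le _ _).trans ?_
  rw [← nsmul_eq_mul]
  refine Finset.sum_le_card_nsmul _ _ _ fun d hd => ?_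
  rw [norm_mul, norm_mul]
  have h1 : ‖(ArithmeticFunction.moebius d : ℂ)‖ ≤ 1 := by
    rw [Complex.norm_intCast]
    exact_mod_cast ArithmeticFunction.abs_moebius_le_one
  have h2 := MulChar.norm_le_one_of_finite χ.primitiveCharacter d
  have h3 := hB d (Nat.dvd_of_mem_divisors hd)
  have h4 := norm_nonneg (∑ k ∈ Finset.Icc 1 (N / d), χ.primitiveCharacter k)
  calc _ ≤ 1 * (1 * B) := by gcongr
    _ = B := by ring

open Filter in
/-- Burgess' bound for non-trivial characters of cubefree modulus. -/
theorem burgess_of_ne_one {ε : ℝ} (hε : 0 < ε) (hε4 : ε ≤ 1 / 4) :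
    ∃ δ : ℝ, 0 < δ ∧ ∀ᶠ m : ℕ in atTop, (∀ p : ℕ, p.Prime → ¬p ^ 3 ∣ m) →
      ∀ χ : DirichletCharacter ℂ m, χ ≠ 1 → ∀ N : ℕ, (m : ℝ) ^ (1 / 4 + ε) ≤ N →
        N ≤ m → ‖∑ n ∈ Finset.Icc 1 N, χ n‖ ≤ N * (m : ℝ) ^ (-δ) := by
  obtain ⟨δ₀, hδ₀, hev⟩ := burgess_of_locallyPrimitive_of_le (ε := ε / 4) (by linarith)
    (by linarith)
  obtain ⟨Q, hQ⟩ := eventually_atTop.1 hev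
  obtain ⟨δ, hδ, hδε, hδδ, hδ8⟩ : ∃ δ : ℝ, 0 < δ ∧ δ ≤ ε / 2 ∧ δ ≤ δ₀ / 8 ∧ δ ≤ 1 / 8 :=
    ⟨min (ε / 2) (min (δ₀ / 8) (1 / 8)), by positivity, min_le_left _ _,
      (min_le_right _ _).trans (min_le_left _ _), (min_le_right _ _).trans (min_le_right _ _)⟩
  refine ⟨δ / 2, half_pos hδ, ?_⟩
  filter_upwards [eventually_card_divisors_le 1 (half_pos hδ),
    eventually_le_natCast_rpow Q (show (0 : ℝ) < 1 / 8 by norm_num),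
    eventually_le_natCast_rpow 2 (show (0 : ℝ) < ε / 4 by positivity),
    eventually_ge_atTop 1] with m hτ hQm h2 hm1 hcf χ hχ N hN hNm
  have : NeZero m := ⟨by omega⟩
  have : NeZero χ.conductor := ⟨χ.conductor_ne_zero⟩
  have hm1' : (1 : ℝ) ≤ m := by exact_mod_cast hm1
  have hm0 : (0 : ℝ) < m := by linarith
  have hN0 : (0 : ℝ) < N := lt_of_lt_of_le (Real.rpow_pos_of_pos hm0 _) hN
  have hB : ∀ d, d ∣ m → ‖∑ k ∈ Finset.Icc 1 (N / d), χ.primitiveCharacter k‖ ≤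
      N * (m : ℝ) ^ (-δ) := by
    intro d hdm
    have hd0 : 0 < d := Nat.pos_of_dvd_of_pos hdm (by omega)
    have hd0' : (0 : ℝ) < d := by exact_mod_cast hd0
    have htriv : ‖∑ k ∈ Finset.Icc 1 (N / d), χ.primitiveCharacter k‖ ≤ (N / d : ℕ) :=
      MulChar.norm_sum_Icc_le_self _ _
    have hNd : ((N / d : ℕ) : ℝ) ≤ N / d := Nat.cast_div_le
    rcases lt_or_ge ((m : ℝ) ^ (ε / 2)) d with hd | hd
    · refine htriv.trans (hNd.trans ?_)
      rw [div_eq_mul_inv, Real.rpow_neg hm0.le]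
      gcongr
      exact (Real.rpow_le_rpow_of_exponent_le hm1' hδε).trans hd.le
    rcases lt_or_ge (χ.conductor : ℝ) ((m : ℝ) ^ (1 / 8 : ℝ)) with hq | hq
    · have hψ : χ.primitiveCharacter ≠ 1 := by
        intro h
        apply hχ
        rw [← χ.changeLevel_primitiveCharacter, h, DirichletCharacter.changeLevel_one]
      refine (DirichletCharacter.norm_sum_Icc_le hψ _).trans (hq.le.trans ?_)
      calc (m : ℝ) ^ (1 / 8 : ℝ) ≤ (m : ℝ) ^ (1 / 4 + ε + -δ) :=
            Real.rpow_le_rpow_of_exponent_le hm1' (by linarith)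
        _ = (m : ℝ) ^ (1 / 4 + ε) * (m : ℝ) ^ (-δ) := Real.rpow_add hm0 _ _
        _ ≤ _ := by gcongr
    have hqm : χ.conductor ≤ m := Nat.le_of_dvd (by omega) χ.conductor_dvd_level
    have hqm' : (χ.conductor : ℝ) ≤ m := by exact_mod_cast hqm
    have hq0 : (0 : ℝ) < χ.conductor := by exact_mod_cast NeZero.pos χ.conductor
    have hq8 : m ≤ χ.conductor ^ 8 := by
      have : (m : ℝ) ≤ (χ.conductor : ℝ) ^ 8 := by
        calc (m : ℝ) = ((m : ℝ) ^ (1 / 8 : ℝ)) ^ 8 := by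
              rw [← Real.rpow_natCast, ← Real.rpow_mul hm0.le]
              norm_num
          _ ≤ _ := by gcongr
      exact_mod_cast this
    have hNd1 : (m : ℝ) ^ (1 / 4 + ε / 2) ≤ N / d := by
      rw [le_div_iff₀ hd0']
      calc (m : ℝ) ^ (1 / 4 + ε / 2) * d ≤ (m : ℝ) ^ (1 / 4 + ε / 2) * (m : ℝ) ^ (ε / 2) := by
            gcongr
        _ = (m : ℝ) ^ (1 / 4 + ε) := by
            rw [← Real.rpow_add hm0]
            ring_nf
        _ ≤ N := hN
    have hNd2 : (χ.conductor : ℝ) ^ (1 / 4 + ε / 4) ≤ (N / d : ℕ) := by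
      have h3 : (N / d : ℝ) ≤ 2 * (N / d : ℕ) := by
        have := Nat.le_two_mul_floor ((Real.one_le_rpow hm1' (by linarith)).trans hNd1)
        rwa [Nat.floor_div_eq_div] at this
      have h4 : (m : ℝ) ^ (1 / 4 + ε / 4) * 2 ≤ (N / d : ℕ) * 2 := by
        calc _ ≤ (m : ℝ) ^ (1 / 4 + ε / 4) * (m : ℝ) ^ (ε / 4) := by gcongr
          _ = (m : ℝ) ^ (1 / 4 + ε / 2) := by
              rw [← Real.rpow_add hm0]
              ring_nf
          _ ≤ _ := by linarith
      calc (χ.conductor : ℝ) ^ (1 / 4 + ε / 4) ≤ (m : ℝ) ^ (1 / 4 + ε / 4) := by gcongr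
        _ ≤ _ := by linarith
    have hQq : Q ≤ χ.conductor := by exact_mod_cast hQm.trans hq
    refine (hQ _ hQq (fun p hp h => hcf p hp (h.trans χ.conductor_dvd_level)) _
      χ.primitiveCharacter_isPrimitive.locallyPrimitive _ hNd2
      ((Nat.div_le_self _ _).trans (hNm.trans hq8))).trans ?_
    have h5 : ((N / d : ℕ) : ℝ) ≤ N := by exact_mod_cast Nat.div_le_self N d
    have h6 : (χ.conductor : ℝ) ^ (-δ₀) ≤ (m : ℝ) ^ (-δ) := by
      calc (χ.conductor : ℝ) ^ (-δ₀) ≤ ((m : ℝ) ^ (1 / 8 : ℝ)) ^ (-δ₀) :=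
            Real.rpow_le_rpow_of_nonpos (by positivity) hq (by linarith)
        _ = (m : ℝ) ^ (-(δ₀ / 8)) := by
            rw [← Real.rpow_mul hm0.le]
            ring_nf
        _ ≤ _ := Real.rpow_le_rpow_of_exponent_le hm1' (by linarith)
    gcongr
  refine (DirichletCharacter.norm_sum_Icc_le_of_forall_dvd hB).trans ?_
  have hτm := hτ m (by omega) (by simp)
  calc _ ≤ (m : ℝ) ^ (δ / 2) * (N * (m : ℝ) ^ (-δ)) := by gcongr
    _ = N * ((m : ℝ) ^ (δ / 2) * (m : ℝ) ^ (-δ)) := by ring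
    _ = _ := by
      rw [← Real.rpow_add hm0]
      ring_nf

theorem DirichletCharacter.sum_inv_apply_mul_apply_eq {m : ℕ} [NeZero m] (a b : ZMod m) :
    ∑ χ : DirichletCharacter ℂ m, χ⁻¹ a * χ b =
      if IsUnit a ∧ a = b then (m.totient : ℂ) else 0 := by
  by_cases ha : IsUnit a
  · simp only [ha, true_and]
    rw [← sum_char_inv_mul_char_eq ℂ ha b]
    refine Finset.sum_congr rfl fun χ _ => ?_
    rw [MulChar.inv_apply]
    congr 2
    obtain ⟨u, rfl⟩ := ha
    rw [Ring.inverse_unit, ← ZMod.inv_coe_unit]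
  · simp only [ha, false_and, if_false]
    exact Finset.sum_eq_zero fun χ _ => by rw [MulChar.map_nonunit _ ha, zero_mul]

theorem DirichletCharacter.sum_Icc_pow_eq {m : ℕ} (χ : DirichletCharacter ℂ m) (B k : ℕ) :
    (∑ n ∈ Finset.Icc 1 B, χ n) ^ k =
      ∑ x ∈ Fintype.piFinset fun _ : Fin k => Finset.Icc 1 B, χ ((∏ i, x i : ℕ) : ZMod m) := by
  rw [Finset.sum_pow']
  refine Finset.sum_congr rfl fun x _ => ?_
  rw [Nat.cast_prod, map_prod]

/-- A moment bound for character sums over intervals. -/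
theorem DirichletCharacter.sum_norm_sum_pow_le {m : ℕ} [NeZero m] {B k D : ℕ}
    (hD : ∀ t ∈ Finset.Icc 1 (B ^ k), t.divisors.card ≤ D) :
    ∑ χ : DirichletCharacter ℂ m, ‖∑ n ∈ Finset.Icc 1 B, χ n‖ ^ (2 * k) ≤
      (D : ℝ) ^ k * B ^ k * (B ^ k + m) := by
  classical
  set P := Fintype.piFinset fun _ : Fin k => Finset.Icc 1 B with hP
  have hcard : P.card = B ^ k := by simp [hP]
  have h1 : ∀ χ : DirichletCharacter ℂ m, ((‖∑ n ∈ Finset.Icc 1 B, χ n‖ ^ (2 * k) : ℝ) : ℂ) =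
      ∑ y ∈ P, ∑ x ∈ P, χ⁻¹ ((∏ i, y i : ℕ) : ZMod m) * χ ((∏ i, x i : ℕ) : ZMod m) := by
    intro χ
    rw [mul_comm 2 k, pow_mul, ← norm_pow, χ.sum_Icc_pow_eq, Complex.ofReal_pow,
      ← Complex.conj_mul', map_sum, Finset.sum_mul_sum]
    refine Finset.sum_congr rfl fun y _ => Finset.sum_congr rfl fun x _ => ?_
    rw [← MulChar.star_apply']
    rfl
  have h2 : ((∑ χ : DirichletCharacter ℂ m, ‖∑ n ∈ Finset.Icc 1 B, χ n‖ ^ (2 * k) : ℝ) : ℂ) =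
      ((∑ y ∈ P, ∑ x ∈ P, if IsUnit ((∏ i, y i : ℕ) : ZMod m) ∧
        ((∏ i, y i : ℕ) : ZMod m) = ((∏ i, x i : ℕ) : ZMod m) then (m.totient : ℝ) else 0 : ℝ)) := by
    push_cast
    simp only [← Complex.ofReal_pow, h1]
    rw [Finset.sum_comm]
    refine Finset.sum_congr rfl fun y _ => ?_
    rw [Finset.sum_comm]
    refine Finset.sum_congr rfl fun x _ => ?_
    rw [sum_inv_apply_mul_apply_eq, apply_ite ((↑) : ℝ → ℂ), Complex.ofReal_natCast,
      Complex.ofReal_zero]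
    simp only [Nat.cast_prod]
  rw [Complex.ofReal_injective h2]
  have h3 : ∀ y ∈ P, (∑ x ∈ P, if IsUnit ((∏ i, y i : ℕ) : ZMod m) ∧
      ((∏ i, y i : ℕ) : ZMod m) = ((∏ i, x i : ℕ) : ZMod m) then (m.totient : ℝ) else 0) ≤
        (D : ℝ) ^ k * (B ^ k + m) := by
    intro y _
    have h4 := card_piFinset_filter_natCast_prod_eq_le (fun _ : Fin k => B) (NeZero.ne m)
      (D := D) (by simpa using hD) ((∏ i, y i : ℕ) : ZMod m)
    rw [Fintype.card_fin, Finset.prod_const, Finset.card_univ, Fintype.card_fin] at h4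
    calc _ ≤ ∑ x ∈ P, if ((∏ i, x i : ℕ) : ZMod m) = ((∏ i, y i : ℕ) : ZMod m)
          then (m.totient : ℝ) else 0 := by
          refine Finset.sum_le_sum fun x _ => ?_
          split_ifs with h5 h6 h6
          · rfl
          · exact absurd h5.2.symm h6
          · positivity
          · rfl
      _ = (P.filter fun x => ((∏ i, x i : ℕ) : ZMod m) = ((∏ i, y i : ℕ) : ZMod m)).card *
          (m.totient : ℝ) := by
          rw [← Finset.sum_filter, Finset.sum_const, nsmul_eq_mul]
      _ ≤ ((D ^ k * (B ^ k / m + 1) : ℕ) : ℝ) * m := by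
          gcongr
          exact Nat.totient_le m
      _ = (D : ℝ) ^ k * ((B ^ k / m * m + m : ℕ) : ℝ) := by
          push_cast
          ring
      _ ≤ (D : ℝ) ^ k * ((B ^ k + m : ℕ) : ℝ) := by
          gcongr
          exact Nat.div_mul_le_self _ _
      _ = _ := by push_cast; rfl
  calc _ ≤ P.card • ((D : ℝ) ^ k * (B ^ k + m)) := Finset.sum_le_card_nsmul _ _ _ h3
    _ = _ := by
      rw [hcard, nsmul_eq_mul]
      push_cast
      ring

/-- A product of short variables represents a given residue class as soon as the contribution of
the trivial character dominates. -/
theorem DirichletCharacter.exists_prod_mul_eq {m : ℕ} [NeZero m] (lam : (ZMod m)ˣ) {k N z : ℕ}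
    (h : ∑ χ ∈ Finset.univ.erase (1 : DirichletCharacter ℂ m),
      ‖∑ n ∈ Finset.Icc 1 N, χ n‖ ^ k * ‖∑ n ∈ Finset.Icc 1 z, χ n‖ <
        ‖∑ n ∈ Finset.Icc 1 N, (1 : DirichletCharacter ℂ m) n‖ ^ k *
          ‖∑ n ∈ Finset.Icc 1 z, (1 : DirichletCharacter ℂ m) n‖) :
    ∃ u : Fin k → ℕ, (∀ i, u i ∈ Finset.Icc 1 N) ∧ ∃ v ∈ Finset.Icc 1 z,
      (lam : ZMod m) = (((∏ i, u i) * v : ℕ) : ZMod m) := by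
  classical
  by_contra! hne
  set F : DirichletCharacter ℂ m → ℂ := fun χ => χ⁻¹ (lam : ZMod m) *
    ((∑ n ∈ Finset.Icc 1 N, χ n) ^ k * ∑ n ∈ Finset.Icc 1 z, χ n) with hF
  have h0 : ∑ χ, F χ = 0 := by
    have h1 : ∀ χ, F χ = ∑ u ∈ Fintype.piFinset fun _ : Fin k => Finset.Icc 1 N,
        ∑ v ∈ Finset.Icc 1 z, χ⁻¹ (lam : ZMod m) * χ (((∏ i, u i) * v : ℕ) : ZMod m) := by
      intro χ
      simp only [hF]
      rw [χ.sum_Icc_pow_eq, Finset.sum_mul_sum]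
      simp only [Finset.mul_sum]
      refine Finset.sum_congr rfl fun u _ => Finset.sum_congr rfl fun v _ => ?_
      rw [Nat.cast_mul (∏ i, u i), map_mul]
    simp only [h1]
    rw [Finset.sum_comm]
    refine Finset.sum_eq_zero fun u hu => ?_
    rw [Finset.sum_comm]
    refine Finset.sum_eq_zero fun v hv => ?_
    rw [sum_inv_apply_mul_apply_eq, if_neg]
    exact fun h2 => hne u (Fintype.mem_piFinset.1 hu) v hv h2.2
  rw [← Finset.add_sum_erase _ _ (Finset.mem_univ (1 : DirichletCharacter ℂ m))] at h0
  have h1 : F 1 = -∑ χ ∈ Finset.univ.erase 1, F χ := eq_neg_of_add_eq_zero_left h0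
  have h2 : ‖F 1‖ ≤ ∑ χ ∈ Finset.univ.erase (1 : DirichletCharacter ℂ m),
      ‖∑ n ∈ Finset.Icc 1 N, χ n‖ ^ k * ‖∑ n ∈ Finset.Icc 1 z, χ n‖ := by
    rw [h1, norm_neg]
    refine (norm_sum_le _ _).trans (Finset.sum_le_sum fun χ _ => ?_)
    rw [norm_mul, norm_mul, norm_pow]
    exact mul_le_of_le_one_left (by positivity) (MulChar.norm_le_one_of_finite _ _)
  have h3 : ‖F 1‖ = ‖∑ n ∈ Finset.Icc 1 N, (1 : DirichletCharacter ℂ m) n‖ ^ k *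
      ‖∑ n ∈ Finset.Icc 1 z, (1 : DirichletCharacter ℂ m) n‖ := by
    simp only [hF, inv_one, MulChar.one_apply_coe, one_mul, norm_mul, norm_pow]
  linarith

theorem DirichletCharacter.norm_sum_Icc_one_eq {m : ℕ} (N : ℕ) :
    ‖∑ n ∈ Finset.Icc 1 N, (1 : DirichletCharacter ℂ m) n‖ =
      ((Finset.Icc 1 N).filter fun n => n.Coprime m).card := by
  classical
  have h : ∑ n ∈ Finset.Icc 1 N, (1 : DirichletCharacter ℂ m) n =
      (((Finset.Icc 1 N).filter fun n => n.Coprime m).card : ℂ) := by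
    rw [Finset.card_filter, Nat.cast_sum]
    refine Finset.sum_congr rfl fun n _ => ?_
    split_ifs with hn
    · rw [MulChar.one_apply ((ZMod.isUnit_iff_coprime n m).2 hn), Nat.cast_one]
    · rw [MulChar.map_nonunit _ fun hu => hn ((ZMod.isUnit_iff_coprime n m).1 hu), Nat.cast_zero]
  rw [h, Complex.norm_natCast]

theorem Finset.sum_pow_mul_le {ι : Type*} (T : Finset ι) {u v : ι → ℝ} {G θ : ℝ} (j : ℕ) {l : ℕ}
    (hl : l ≠ 0) (hu : ∀ i ∈ T, 0 ≤ u i) (huG : ∀ i ∈ T, u i ≤ G) (hv : ∀ i ∈ T, 0 ≤ v i)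
    (hθ : 0 < θ) (hθ1 : θ ≤ 1) :
    ∑ i ∈ T, u i ^ j * v i ≤ θ * ∑ i ∈ T, u i ^ j + G ^ j / θ ^ l * ∑ i ∈ T, v i ^ l := by
  rw [mul_sum, mul_sum, ← sum_add_distrib]
  refine sum_le_sum fun i hi => ?_
  have hui := hu i hi
  have hvi := hv i hi
  have hG := hui.trans (huG i hi)
  rcases le_or_gt (v i) θ with h | h
  · have : 0 ≤ G ^ j / θ ^ l * v i ^ l := by positivity
    nlinarith [mul_le_mul_of_nonneg_left h (pow_nonneg hui j)]
  · have h1 : 1 ≤ v i / θ := by rw [one_le_div hθ]; exact h.le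
    have h2 : v i ≤ (v i / θ) ^ l :=
      (le_div_self hvi hθ hθ1).trans (le_self_pow₀ h1 hl)
    have h3 : 0 ≤ θ * u i ^ j := by positivity
    calc u i ^ j * v i ≤ G ^ j * (v i / θ) ^ l := by
          gcongr
          exact huG i hi
      _ = G ^ j / θ ^ l * v i ^ l := by rw [div_pow]; ring
      _ ≤ _ := by linarith

theorem sq_inv_le_of_pow_four_le {L B C τ : ℝ} (hL : 4 ≤ L) (hB : L ^ 4 ≤ B) (hτ : 0 < τ)
    (hτL : τ ≤ L) (hC : B / τ - τ ≤ C) : (L ^ 2)⁻¹ ≤ C / B := by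
  have hL0 : 0 < L := by linarith
  have hB0 : 0 < B := lt_of_lt_of_le (by positivity) hB
  have h1 : B / L - L ≤ B / τ - τ := by gcongr
  rw [inv_eq_one_div, div_le_div_iff₀ (by positivity) hB0, one_mul]
  have h2 : (B / L - L) * L ^ 2 ≤ C * L ^ 2 := by
    gcongr
    exact h1.trans hC
  have h3 : (B / L - L) * L ^ 2 = B * L - L ^ 3 := by
    field_simp
  have h4 : 0 ≤ L ^ 3 := by positivity
  nlinarith

theorem DirichletCharacter.sum_norm_sum_div_pow_le {m : ℕ} [NeZero m] {B k : ℕ} {L : ℝ}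
    (hL : 0 ≤ L) (hD : ∀ t ∈ Finset.Icc 1 (B ^ k), (t.divisors.card : ℝ) ≤ L) (hB : 0 < B)
    (hm : m ≤ B ^ k) :
    ∑ χ : DirichletCharacter ℂ m, (‖∑ n ∈ Finset.Icc 1 B, χ n‖ / B) ^ (2 * k) ≤ 2 * L ^ k := by
  have hB0 : (0 : ℝ) < B := by exact_mod_cast hB
  have hm' : (m : ℝ) ≤ (B : ℝ) ^ k := by exact_mod_cast hm
  have h := DirichletCharacter.sum_norm_sum_pow_le (m := m) (B := B) (k := k) (D := ⌊L⌋₊)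
    fun t ht => Nat.le_floor (hD t ht)
  simp only [div_pow]
  rw [← Finset.sum_div, div_le_iff₀ (by positivity)]
  calc _ ≤ (⌊L⌋₊ : ℝ) ^ k * B ^ k * (B ^ k + m) := h
    _ ≤ L ^ k * B ^ k * (B ^ k + B ^ k) := by
        gcongr
        exact Nat.floor_le hL
    _ = _ := by ring

theorem exists_prod_mul_eq_of_forall_norm_le {m : ℕ} [NeZero m] {N z K : ℕ} {L G : ℝ}
    (hL : 4 ≤ L) (hK : K ≠ 0) (hτN : ∀ t ∈ Finset.Icc 1 (N ^ 4), (t.divisors.card : ℝ) ≤ L)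
    (hτz : ∀ t ∈ Finset.Icc 1 (z ^ K), (t.divisors.card : ℝ) ≤ L) (hN : m ≤ N ^ 4)
    (hz : m ≤ z ^ K) (hNL : L ^ 4 ≤ N) (hzL : L ^ 4 ≤ z)
    (hG : ∀ χ : DirichletCharacter ℂ m, χ ≠ 1 → ‖∑ n ∈ Finset.Icc 1 N, χ n‖ ≤ N * G)
    (hGL : G ^ 8 * L ^ (49 * K + 20) ≤ 1) (lam : (ZMod m)ˣ) :
    ∃ u : Fin 8 → ℕ, (∀ i, u i ∈ Finset.Icc 1 N) ∧ ∃ v ∈ Finset.Icc 1 z,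
      (lam : ZMod m) = (((∏ i, u i) * v : ℕ) : ZMod m) := by
  classical
  have hL0 : 0 < L := by linarith
  have hN0 : (0 : ℝ) < N := lt_of_lt_of_le (by positivity) hNL
  have hz0 : (0 : ℝ) < z := lt_of_lt_of_le (by positivity) hzL
  have hm1 : 1 ≤ m := NeZero.pos m
  have hτm : (m.divisors.card : ℝ) ≤ L := hτN m (Finset.mem_Icc.2 ⟨hm1, hN⟩)
  have hτ0 : (0 : ℝ) < m.divisors.card := by
    exact_mod_cast Finset.card_pos.2 ⟨1, Nat.one_mem_divisors.2 (NeZero.ne m)⟩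
  apply DirichletCharacter.exists_prod_mul_eq
  set u : DirichletCharacter ℂ m → ℝ := fun χ => ‖∑ n ∈ Finset.Icc 1 N, χ n‖ / N with hu
  set v : DirichletCharacter ℂ m → ℝ := fun χ => ‖∑ n ∈ Finset.Icc 1 z, χ n‖ / z with hv
  have hu0 : ∀ χ, 0 ≤ u χ := fun χ => by positivity
  have hv0 : ∀ χ, 0 ≤ v χ := fun χ => by positivity
  have hsu : ∑ χ, u χ ^ 8 ≤ 2 * L ^ 4 :=
    DirichletCharacter.sum_norm_sum_div_pow_le (k := 4) hL0.le hτN (by exact_mod_cast hN0) hN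
  have hsv : ∑ χ, v χ ^ (2 * K) ≤ 2 * L ^ K :=
    DirichletCharacter.sum_norm_sum_div_pow_le hL0.le hτz (by exact_mod_cast hz0) hz
  have hmain : ((L ^ 2)⁻¹) ^ 8 * (L ^ 2)⁻¹ ≤ u 1 ^ 8 * v 1 := by
    have h1 : (L ^ 2)⁻¹ ≤ u 1 := by
      rw [hu]
      dsimp only
      rw [DirichletCharacter.norm_sum_Icc_one_eq]
      exact sq_inv_le_of_pow_four_le hL hNL hτ0 hτm (Nat.card_filter_coprime_ge N (NeZero.ne m))
    have h2 : (L ^ 2)⁻¹ ≤ v 1 := by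
      rw [hv]
      dsimp only
      rw [DirichletCharacter.norm_sum_Icc_one_eq]
      exact sq_inv_le_of_pow_four_le hL hzL hτ0 hτm (Nat.card_filter_coprime_ge z (NeZero.ne m))
    gcongr
  have herr : ∑ χ ∈ Finset.univ.erase (1 : DirichletCharacter ℂ m), u χ ^ 8 * v χ ≤
      4 * (L ^ 20)⁻¹ := by
    have hθ1 : (L ^ 24)⁻¹ ≤ 1 := inv_le_one_of_one_le₀ (one_le_pow₀ (by linarith))
    have h := Finset.sum_pow_mul_le (Finset.univ.erase (1 : DirichletCharacter ℂ m))
      (u := u) (v := v) (G := G) (θ := (L ^ 24)⁻¹) 8 (l := 2 * K) (by omega)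
      (fun χ _ => hu0 χ) (fun χ hχ => by
        rw [hu]
        dsimp only
        rw [div_le_iff₀ hN0, mul_comm]
        exact hG χ (Finset.ne_of_mem_erase hχ)) (fun χ _ => hv0 χ) (by positivity) hθ1
    have h1 : ∑ χ ∈ Finset.univ.erase (1 : DirichletCharacter ℂ m), u χ ^ 8 ≤ 2 * L ^ 4 :=
      (Finset.sum_le_sum_of_subset_of_nonneg (Finset.erase_subset _ _)
        fun χ _ _ => pow_nonneg (hu0 χ) _).trans hsu
    have h2 : ∑ χ ∈ Finset.univ.erase (1 : DirichletCharacter ℂ m), v χ ^ (2 * K) ≤ 2 * L ^ K :=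
      (Finset.sum_le_sum_of_subset_of_nonneg (Finset.erase_subset _ _)
        fun χ _ _ => pow_nonneg (hv0 χ) _).trans hsv
    have hG0 : 0 ≤ G ^ 8 := by
      rw [show G ^ 8 = (G ^ 4) ^ 2 by ring]
      positivity
    have h3 : G ^ 8 / ((L ^ 24)⁻¹) ^ (2 * K) * (2 * L ^ K) ≤ 2 * (L ^ 20)⁻¹ := by
      rw [← div_eq_mul_inv, le_div_iff₀ (by positivity)]
      calc G ^ 8 / ((L ^ 24)⁻¹) ^ (2 * K) * (2 * L ^ K) * L ^ 20
          = 2 * (G ^ 8 * L ^ (49 * K + 20)) := by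
            rw [inv_pow, div_inv_eq_mul, ← pow_mul, pow_add,
              show 49 * K = 24 * (2 * K) + K by ring, pow_add]
            ring
        _ ≤ 2 := by linarith
    calc _ ≤ (L ^ 24)⁻¹ * (2 * L ^ 4) + G ^ 8 / ((L ^ 24)⁻¹) ^ (2 * K) * (2 * L ^ K) := by
          refine h.trans ?_
          gcongr
      _ ≤ 2 * (L ^ 20)⁻¹ + 2 * (L ^ 20)⁻¹ := by
          refine add_le_add (le_of_eq ?_) h3
          field_simp
      _ = _ := by ring
  have hlt : 4 * (L ^ 20)⁻¹ < ((L ^ 2)⁻¹) ^ 8 * (L ^ 2)⁻¹ := by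
    have h1 : ((L ^ 2)⁻¹) ^ 8 * (L ^ 2)⁻¹ = L ^ 2 * (L ^ 20)⁻¹ := by
      field_simp
    rw [h1]
    gcongr
    nlinarith
  have hfin := (herr.trans_lt hlt).trans_le hmain
  have huv : ∀ χ, ‖∑ n ∈ Finset.Icc 1 N, χ n‖ ^ 8 * ‖∑ n ∈ Finset.Icc 1 z, χ n‖ =
      (N ^ 8 * z : ℝ) * (u χ ^ 8 * v χ) := by
    intro χ
    simp only [hu, hv]
    field_simp
  simp only [huv]
  rw [← Finset.mul_sum]
  gcongr

open Filter in
theorem eventually_exists_prod_mul_eq {ε : ℝ} (hε : 0 < ε) (hε4 : ε ≤ 1 / 4) :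
    ∀ᶠ m : ℕ in atTop, (∀ p : ℕ, p.Prime → ¬p ^ 3 ∣ m) → ∀ lam : (ZMod m)ˣ,
      ∃ u : Fin 8 → ℕ, (∀ i, 1 ≤ u i ∧ (u i : ℝ) ≤ (m : ℝ) ^ (1 / 4 + ε / 2)) ∧
        ∃ v : ℕ, 1 ≤ v ∧ (v : ℝ) ≤ (m : ℝ) ^ (ε / 2) ∧
          (lam : ZMod m) = (((∏ i, u i) * v : ℕ) : ZMod m) := by
  obtain ⟨δ, hδ, hev⟩ := burgess_of_ne_one (ε := ε / 4) (by linarith) (by linarith)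
  obtain ⟨K, hK⟩ := exists_nat_ge (4 / ε)
  have hK4 : 4 ≤ ε * K := by rwa [div_le_iff₀' hε] at hK
  have hK1 : (1 : ℝ) ≤ K := by nlinarith
  have hK0 : K ≠ 0 := by
    rintro rfl
    norm_num at hK1
  obtain ⟨κ, hκ, hκε, hκδ⟩ : ∃ κ : ℝ, 0 < κ ∧ 16 * κ ≤ ε ∧ 10 * K * κ ≤ δ := by
    refine ⟨min (ε / 16) (δ / (10 * K)), by positivity, ?_, ?_⟩
    · linarith [min_le_left (ε / 16) (δ / (10 * K))]
    · have := min_le_right (ε / 16) (δ / (10 * K))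
      rwa [le_div_iff₀' (by positivity)] at this
  filter_upwards [hev, eventually_card_divisors_le (K + 4) hκ, eventually_le_natCast_rpow 4 hκ,
    eventually_le_natCast_rpow 2 (show 0 < ε / 4 by positivity), eventually_ge_atTop 1]
    with m hB hτ hL h2 hm1 hcf lam
  have : NeZero m := ⟨by omega⟩
  have hm1' : (1 : ℝ) ≤ m := by exact_mod_cast hm1
  have hm0 : (0 : ℝ) < m := by linarith
  have hfloor : ∀ a : ℝ, 0 ≤ a → (m : ℝ) ^ (a + ε / 4) ≤ (⌊(m : ℝ) ^ (a + ε / 2)⌋₊ : ℝ) := by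
    intro a ha
    have h3 := Nat.le_two_mul_floor (Real.one_le_rpow hm1' (show 0 ≤ a + ε / 2 by linarith))
    have h4 : (m : ℝ) ^ (a + ε / 4) * 2 ≤ (m : ℝ) ^ (a + ε / 2) := by
      calc _ ≤ (m : ℝ) ^ (a + ε / 4) * (m : ℝ) ^ (ε / 4) := by gcongr
        _ = _ := by
          rw [← Real.rpow_add hm0]
          ring_nf
    linarith
  obtain ⟨N, hN⟩ : ∃ N : ℕ, N = ⌊(m : ℝ) ^ (1 / 4 + ε / 2)⌋₊ := ⟨_, rfl⟩
  obtain ⟨z, hz⟩ : ∃ z : ℕ, z = ⌊(m : ℝ) ^ (ε / 2)⌋₊ := ⟨_, rfl⟩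
  have hN1 : (m : ℝ) ^ (1 / 4 + ε / 4) ≤ N := hN ▸ hfloor _ (by norm_num)
  have hz1 : (m : ℝ) ^ (ε / 4) ≤ z := by simpa [hz] using hfloor 0 le_rfl
  have hN2 : (N : ℝ) ≤ (m : ℝ) ^ (1 / 4 + ε / 2) := hN ▸ Nat.floor_le (by positivity)
  have hz2 : (z : ℝ) ≤ (m : ℝ) ^ (ε / 2) := hz ▸ Nat.floor_le (by positivity)
  have hle : ∀ {a : ℝ} {b : ℕ}, a ≤ 1 → (b : ℝ) ≤ (m : ℝ) ^ a → b ≤ m := by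
    intro a b ha hb
    have := hb.trans (Real.rpow_le_rpow_of_exponent_le hm1' ha)
    rw [Real.rpow_one] at this
    exact_mod_cast this
  have hNm : N ≤ m := hle (by linarith) hN2
  have hzm : z ≤ m := hle (by linarith) hz2
  have hpow : ∀ {a : ℝ} {b k : ℕ}, (m : ℝ) ^ a ≤ b → 1 ≤ a * k → m ≤ b ^ k := by
    intro a b k hab hk
    have : (m : ℝ) ≤ (b : ℝ) ^ k := by
      calc (m : ℝ) = (m : ℝ) ^ (1 : ℝ) := (Real.rpow_one _).symm
        _ ≤ (m : ℝ) ^ (a * k) := Real.rpow_le_rpow_of_exponent_le hm1' hk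
        _ = ((m : ℝ) ^ a) ^ k := by rw [Real.rpow_mul hm0.le, Real.rpow_natCast]
        _ ≤ _ := by gcongr
    exact_mod_cast this
  have hL4 : ((m : ℝ) ^ κ) ^ 4 ≤ (m : ℝ) ^ (ε / 4) := by
    rw [← Real.rpow_natCast, ← Real.rpow_mul hm0.le]
    refine Real.rpow_le_rpow_of_exponent_le hm1' ?_
    push_cast
    linarith
  have hdiv : ∀ {b k : ℕ}, b ≤ m → k ≤ K + 4 → ∀ t ∈ Finset.Icc 1 (b ^ k),
      (t.divisors.card : ℝ) ≤ (m : ℝ) ^ κ := by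
    intro b k hb hk t ht
    rw [Finset.mem_Icc] at ht
    exact hτ t (by omega) (ht.2.trans ((Nat.pow_le_pow_left hb k).trans
      (Nat.pow_le_pow_right hm1 hk)))
  obtain ⟨u, hu, v, hv, huv⟩ := exists_prod_mul_eq_of_forall_norm_le (m := m) (N := N) (z := z)
    (K := K) (L := (m : ℝ) ^ κ) (G := (m : ℝ) ^ (-δ)) hL hK0 (hdiv hNm (by omega))
    (hdiv hzm (by omega)) (hpow hN1 (by push_cast; linarith)) (hpow hz1 (by linarith))
    ((hL4.trans (Real.rpow_le_rpow_of_exponent_le hm1' (by linarith))).trans hN1)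
    (hL4.trans hz1) (fun χ hχ => hB hcf χ hχ N hN1 hNm)
    (by
      rw [← Real.rpow_natCast, ← Real.rpow_mul hm0.le, ← Real.rpow_natCast,
        ← Real.rpow_mul hm0.le, ← Real.rpow_add hm0]
      refine Real.rpow_le_one_of_one_le_of_nonpos hm1' ?_
      push_cast
      nlinarith) lam
  simp only [Finset.mem_Icc] at hu hv
  exact ⟨u, fun i => ⟨(hu i).1, le_trans (by exact_mod_cast (hu i).2) hN2⟩, v, hv.1,
    le_trans (by exact_mod_cast hv.2) hz2, huv⟩

/-- For every ε > 0, every sufficiently large cubefree m and every unit λ of ℤ/mℤ, λ is a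
product of eight positive integers each at most m^(1/4+ε). -/
theorem stmt5 :
    ∀ ε : ℝ, 0 < ε → ∃ M : ℕ, ∀ m : ℕ, M ≤ m → (∀ p : ℕ, p.Prime → ¬ p ^ 3 ∣ m) →
      ∀ lam : (ZMod m)ˣ,
      ∃ x : Fin 8 → ℕ, (∀ i, 1 ≤ x i ∧ (x i : ℝ) ≤ (m : ℝ) ^ ((1 : ℝ)/4 + ε)) ∧
        (lam : ZMod m) = ((x 0 * x 1 * x 2 * x 3 * x 4 * x 5 * x 6 * x 7 : ℕ) : ZMod m) := by
  intro ε hε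
  obtain ⟨ε', hε', hεε', hε4⟩ : ∃ ε' : ℝ, 0 < ε' ∧ ε' ≤ ε ∧ ε' ≤ 1 / 4 :=
    ⟨min ε (1 / 4), by positivity, min_le_left _ _, min_le_right _ _⟩
  obtain ⟨M, hM⟩ := Filter.eventually_atTop.1 (eventually_exists_prod_mul_eq hε' hε4)
  refine ⟨M + 1, fun m hm hcf lam => ?_⟩
  obtain ⟨u, hu, v, hv1, hv2, huv⟩ := hM m (by omega) hcf lam
  have hm1 : (1 : ℝ) ≤ m := by exact_mod_cast (by omega : 1 ≤ m)
  have hm0 : (0 : ℝ) < m := by linarith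
  refine ⟨Function.update u 0 (u 0 * v), fun i => ?_, ?_⟩
  · by_cases hi : i = 0
    · subst hi
      rw [Function.update_self]
      refine ⟨Nat.mul_pos (hu 0).1 hv1, ?_⟩
      calc ((u 0 * v : ℕ) : ℝ) = u 0 * v := Nat.cast_mul _ _
        _ ≤ (m : ℝ) ^ (1 / 4 + ε' / 2) * (m : ℝ) ^ (ε' / 2) :=
          mul_le_mul (hu 0).2 hv2 (Nat.cast_nonneg _) (Real.rpow_nonneg hm0.le _)
        _ = (m : ℝ) ^ (1 / 4 + ε' / 2 + ε' / 2) := (Real.rpow_add hm0 _ _).symm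
        _ ≤ _ := Real.rpow_le_rpow_of_exponent_le hm1 (by linarith)
    · rw [Function.update_of_ne hi]
      exact ⟨(hu i).1, (hu i).2.trans (Real.rpow_le_rpow_of_exponent_le hm1 (by linarith))⟩
  · rw [huv, Fin.prod_univ_eight]
    congr 1
    simp [Function.update_of_ne]
    ring
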